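/- Let n₀, n₁, m₀, m₁ be natural numbers with n₀ − n₁ ≥ 2 and m₁ − m₀ ≥ 1. For natural numbers N, M let σ_{N,M} denote the self-map of the one-point compactification of ℂ^N × ℝ^M obtained by extending the map (v, x) ↦ (i·v, −x) (coordinatewise multiplication by the imaginary unit on the ℂ^N factor and negation on the ℝ^M factor) by sending the point at infinity ∞ to ∞. Suppose there exists a continuous map f from the one-point compactification of ℂ^{n₀} × ℝ^{m₀} to the one-point compactification of ℂ^{n₁} × ℝ^{m₁} such that f(∞) = ∞, f(0) = 0, and f ∘ σ_{n₀,m₀} = σ_{n₁,m₁} ∘ f. Then (n₀ − n₁) + A(n₀ − n₁) ≤ m₁ − m₀. -/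

import Mathlib

open OnePoint

/-- The function `A : ℤ → {1,2,3}`:
`A N = 1` if `N ≡ 0, 2 (mod 8)`, `A N = 3` if `N ≡ 6 (mod 8)`,
and `A N = 2` if `N ≡ 1, 3, 4, 5, 7 (mod 8)`. -/
def crabbStolzA (N : ℤ) : ℤ :=
  if N % 8 = 0 ∨ N % 8 = 2 then 1
  else if N % 8 = 6 then 3
  else 2

/-- The involution-like self-map `σ_{N,M}` of the one-point compactification of
`ℂ^N × ℝ^M`, extending `(v, x) ↦ (i • v, -x)` by `∞ ↦ ∞`. -/
noncomputable def sigmaMap (N M : ℕ) :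
    OnePoint (EuclideanSpace ℂ (Fin N) × EuclideanSpace ℝ (Fin M)) →
      OnePoint (EuclideanSpace ℂ (Fin N) × EuclideanSpace ℝ (Fin M)) :=
  OnePoint.map fun p => (Complex.I • p.1, -p.2)

set_option linter.unusedSectionVars false

namespace BorsukUlam

section Inertia

open Module

variable {X : Type*} [NormedAddCommGroup X] [InnerProductSpace ℂ X] [FiniteDimensional ℂ X]

/-- `U` splits into a `q`-positive subspace of dimension `d` and a complementary `q`-negative
subspace, both with spectral gap `δ`. -/
def HasSplit (q : X → ℝ) (U : Submodule ℂ X) (δ : ℝ) (d : ℕ) : Prop :=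
  ∃ E F : Submodule ℂ X, E ≤ U ∧ F ≤ U ∧ (∀ v ∈ E, δ * ‖v‖ ^ 2 ≤ q v) ∧
    (∀ v ∈ F, q v ≤ -(δ * ‖v‖ ^ 2)) ∧ finrank ℂ E = d ∧
    finrank ℂ E + finrank ℂ F = finrank ℂ U

/-- The positive index of inertia of `q` on `U`. -/
noncomputable def posIndex (q : X → ℝ) (U : Submodule ℂ X) : ℕ :=
  sSup {d | ∃ E : Submodule ℂ X, E ≤ U ∧ (∀ v ∈ E, v ≠ 0 → 0 < q v) ∧ finrank ℂ E = d}

theorem finrank_add_le_of_pos_neg {q : X → ℝ} {U E F : Submodule ℂ X} (hE : E ≤ U) (hF : F ≤ U)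
    (hEq : ∀ v ∈ E, v ≠ 0 → 0 < q v) (hFq : ∀ v ∈ F, q v ≤ 0) :
    finrank ℂ E + finrank ℂ F ≤ finrank ℂ U := by
  have hdis : E ⊓ F = ⊥ := by
    rw [Submodule.eq_bot_iff]
    rintro v ⟨h1, h2⟩
    by_contra h
    exact absurd (hEq v h1 h) (not_lt.2 (hFq v h2))
  have h := Submodule.finrank_sup_add_finrank_inf_eq E F
  rw [hdis, finrank_bot, add_zero] at h
  rw [← h]
  exact Submodule.finrank_mono (sup_le hE hF)

theorem HasSplit.posIndex_eq {q : X → ℝ} {U : Submodule ℂ X} {δ : ℝ} {d : ℕ}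
    (h : HasSplit q U δ d) (hδ : 0 < δ) : posIndex q U = d := by
  obtain ⟨E, F, hE, hF, hEq, hFq, hd, hsum⟩ := h
  have hpos : ∀ v ∈ E, v ≠ 0 → 0 < q v := fun v hv h0 =>
    lt_of_lt_of_le (by positivity) (hEq v hv)
  have hmem : d ∈ {d | ∃ E : Submodule ℂ X, E ≤ U ∧ (∀ v ∈ E, v ≠ 0 → 0 < q v) ∧
      finrank ℂ E = d} := ⟨E, hE, hpos, hd⟩
  have hub : ∀ d' ∈ {d | ∃ E : Submodule ℂ X, E ≤ U ∧ (∀ v ∈ E, v ≠ 0 → 0 < q v) ∧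
      finrank ℂ E = d}, d' ≤ d := by
    rintro d' ⟨E', hE', hp', rfl⟩
    have := finrank_add_le_of_pos_neg hE' hF hp'
      (fun v hv => (hFq v hv).trans (neg_nonpos.2 (by positivity)))
    omega
  exact le_antisymm (csSup_le ⟨d, hmem⟩ hub) (le_csSup ⟨d, hub⟩ hmem)

theorem HasSplit.perturb {q q' : X → ℝ} {U : Submodule ℂ X} {δ ε : ℝ} {d : ℕ}
    (h : HasSplit q U δ d) (hq : ∀ v ∈ U, |q' v - q v| ≤ ε * ‖v‖ ^ 2) :
    HasSplit q' U (δ - ε) d := by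
  obtain ⟨E, F, hE, hF, hEq, hFq, hd, hsum⟩ := h
  refine ⟨E, F, hE, hF, fun v hv => ?_, fun v hv => ?_, hd, hsum⟩
  · have := abs_le.1 (hq v (hE hv)); have := hEq v hv; nlinarith
  · have := abs_le.1 (hq v (hF hv)); have := hFq v hv; nlinarith

theorem HasSplit.congr {q q' : X → ℝ} {U : Submodule ℂ X} {δ : ℝ} {d : ℕ}
    (h : HasSplit q U δ d) (hq : ∀ v ∈ U, q' v = q v) : HasSplit q' U δ d := by
  obtain ⟨E, F, hE, hF, hEq, hFq, hd, hsum⟩ := h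
  refine ⟨E, F, hE, hF, fun v hv => ?_, fun v hv => ?_, hd, hsum⟩
  · rw [hq v (hE hv)]; exact hEq v hv
  · rw [hq v (hF hv)]; exact hFq v hv

theorem HasSplit.le {q : X → ℝ} {U : Submodule ℂ X} {δ : ℝ} {d : ℕ}
    (h : HasSplit q U δ d) : d ≤ finrank ℂ U := by
  obtain ⟨E, F, hE, hF, hEq, hFq, hd, hsum⟩ := h
  omega

theorem HasSplit.neg {q : X → ℝ} {U : Submodule ℂ X} {δ : ℝ} {d : ℕ}
    (h : HasSplit q U δ d) : HasSplit (fun v => -q v) U δ (finrank ℂ U - d) := by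
  obtain ⟨E, F, hE, hF, hEq, hFq, hd, hsum⟩ := h
  refine ⟨F, E, hF, hE, fun v hv => ?_, fun v hv => ?_, by omega, by omega⟩
  · have := hFq v hv; linarith
  · have := hEq v hv; linarith

theorem HasSplit.sup {q : X → ℝ} {U V : Submodule ℂ X} {δ : ℝ} {d e : ℕ}
    (hU : HasSplit q U δ d) (hV : HasSplit q V δ e)
    (hq : ∀ u ∈ U, ∀ v ∈ V, q (u + v) = q u + q v)
    (hn : ∀ u ∈ U, ∀ v ∈ V, inner ℂ u v = 0) : HasSplit q (U ⊔ V) δ (d + e) := by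
  obtain ⟨E, F, hE, hF, hEq, hFq, hd, hsum⟩ := hU
  obtain ⟨E', F', hE', hF', hEq', hFq', hd', hsum'⟩ := hV
  have hnorm : ∀ u ∈ U, ∀ v ∈ V, ‖u + v‖ ^ 2 = ‖u‖ ^ 2 + ‖v‖ ^ 2 := fun u hu v hv => by
    have := norm_add_sq_eq_norm_sq_add_norm_sq_of_inner_eq_zero u v (hn u hu v hv)
    simpa [sq] using this
  have hdis : U ⊓ V = ⊥ := by
    rw [Submodule.eq_bot_iff]
    rintro v ⟨h1, h2⟩
    simpa using hn v h1 v h2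
  have key : ∀ {P Q : Submodule ℂ X}, P ≤ U → Q ≤ V →
      finrank ℂ ↥(P ⊔ Q) = finrank ℂ P + finrank ℂ Q := by
    intro P Q hP hQ
    have h := Submodule.finrank_sup_add_finrank_inf_eq P Q
    have : P ⊓ Q = ⊥ := le_bot_iff.1 (hdis ▸ inf_le_inf hP hQ)
    rw [this, finrank_bot, add_zero] at h
    exact h
  refine ⟨E ⊔ E', F ⊔ F', sup_le_sup hE hE', sup_le_sup hF hF', fun v hv => ?_, fun v hv => ?_,
    ?_, ?_⟩
  · obtain ⟨a, ha, b, hb, rfl⟩ := Submodule.mem_sup.1 hv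
    rw [hq _ (hE ha) _ (hE' hb), hnorm _ (hE ha) _ (hE' hb)]
    linarith [hEq a ha, hEq' b hb]
  · obtain ⟨a, ha, b, hb, rfl⟩ := Submodule.mem_sup.1 hv
    rw [hq _ (hF ha) _ (hF' hb), hnorm _ (hF ha) _ (hF' hb)]
    linarith [hFq a ha, hFq' b hb]
  · rw [key hE hE', hd, hd']
  · rw [key hE hE', key hF hF', key le_rfl le_rfl]; omega

theorem HasSplit.map {Y : Type*} [NormedAddCommGroup Y] [InnerProductSpace ℂ Y]
    [FiniteDimensional ℂ Y] {q : X → ℝ} {q' : Y → ℝ} {U : Submodule ℂ X} {δ : ℝ} {d : ℕ}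
    (φ : X →ₗᵢ[ℂ] Y) (h : HasSplit q U δ d) (hq : ∀ v ∈ U, q' (φ v) = q v) :
    HasSplit q' (U.map φ.toLinearMap) δ d := by
  obtain ⟨E, F, hE, hF, hEq, hFq, hd, hsum⟩ := h
  have hr : ∀ P : Submodule ℂ X, finrank ℂ (P.map φ.toLinearMap) = finrank ℂ P := fun P =>
    (Submodule.equivMapOfInjective φ.toLinearMap φ.injective P).symm.finrank_eq
  refine ⟨E.map φ.toLinearMap, F.map φ.toLinearMap, Submodule.map_mono hE, Submodule.map_mono hF,
    ?_, ?_, ?_, ?_⟩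
  · rintro _ ⟨v, hv, rfl⟩
    have := hEq v hv
    simpa [hq v (hE hv)] using this
  · rintro _ ⟨v, hv, rfl⟩
    have := hFq v hv
    simpa [hq v (hF hv)] using this
  · rw [hr, hd]
  · rw [hr, hr, hr, hsum]

/-- The quadratic form of an operator. -/
noncomputable def qform (T : X →ₗ[ℂ] X) (v : X) : ℝ := (inner ℂ v (T v)).re

theorem qform_eigen_sum {n : ℕ} (T : X →ₗ[ℂ] X) (hT : T.IsSymmetric) (hn : finrank ℂ X = n)
    (v : X) : qform T v =
      ∑ i, hT.eigenvalues hn i * ‖inner ℂ (hT.eigenvectorBasis hn i) v‖ ^ 2 := by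
  unfold qform
  rw [← (hT.eigenvectorBasis hn).sum_inner_mul_inner v (T v), Complex.re_sum]
  refine Finset.sum_congr rfl fun i _ => ?_
  rw [← hT (hT.eigenvectorBasis hn i) v, hT.apply_eigenvectorBasis, inner_smul_left]
  rw [← inner_conj_symm v, mul_left_comm, ← Complex.normSq_eq_conj_mul_self]
  rw [Complex.normSq_eq_norm_sq, RCLike.conj_ofReal]
  exact (Complex.re_ofReal_mul _ _).trans (by rw [Complex.ofReal_re]; rfl)

/-- Spectral splitting of a symmetric operator with a gap; the positive part is preserved by every
semilinear map commuting with the operator. -/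
theorem exists_spectral_split_top (T : X →ₗ[ℂ] X) (hT : T.IsSymmetric) {δ : ℝ}
    (hgap : ∀ v, δ * ‖v‖ ≤ ‖T v‖) :
    ∃ E F : Submodule ℂ X, (∀ v ∈ E, δ * ‖v‖ ^ 2 ≤ qform T v) ∧
      (∀ v ∈ F, qform T v ≤ -(δ * ‖v‖ ^ 2)) ∧
      finrank ℂ E + finrank ℂ F = finrank ℂ X ∧
      (∀ J : X →ₛₗ[starRingEnd ℂ] X, (∀ v, T (J v) = J (T v)) → ∀ v ∈ E, J v ∈ E) := by
  set n := finrank ℂ X with hn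
  set b := hT.eigenvectorBasis hn.symm with hb
  set l := hT.eigenvalues hn.symm with hl
  have hTb : ∀ i, T (b i) = (l i : ℂ) • b i := fun i => hT.apply_eigenvectorBasis hn.symm i
  have hgapl : ∀ i, δ ≤ |l i| := fun i => by
    have := hgap (b i)
    rw [hTb, norm_smul, b.orthonormal.1 i] at this
    simpa using this
  have hmem : ∀ (p : Fin n → Prop) (v : X),
      v ∈ Submodule.span ℂ (b '' {i | p i}) ↔ ∀ i, ¬ p i → inner ℂ (b i) v = 0 := by
    intro p v
    constructor
    · intro hv i hi
      have : Submodule.span ℂ (b '' {i | p i}) ≤ (LinearMap.ker (innerₛₗ ℂ (b i))) := by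
        rw [Submodule.span_le]
        rintro _ ⟨k, hk, rfl⟩
        simp only [SetLike.mem_coe, LinearMap.mem_ker, innerₛₗ_apply_apply]
        exact b.orthonormal.2 (fun h => hi (h ▸ hk))
      simpa using this hv
    · intro h
      rw [← b.sum_repr' v]
      refine Submodule.sum_mem _ fun i _ => ?_
      by_cases hi : p i
      · exact Submodule.smul_mem _ _ (Submodule.subset_span ⟨i, hi, rfl⟩)
      · rw [h i hi, zero_smul]; exact Submodule.zero_mem _
  have hfin : ∀ (p : Fin n → Prop) [DecidablePred p],
      finrank ℂ (Submodule.span ℂ (b '' {i | p i})) = Fintype.card {i // p i} := by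
    intro p _
    have h := finrank_span_eq_card (R := ℂ) (b := fun i : {i // p i} => b i)
      (b.orthonormal.linearIndependent.comp _ Subtype.val_injective)
    have hs : b '' {i | p i} = Set.range fun i : {i // p i} => b i := by ext x; simp
    rw [← h, hs]
  refine ⟨Submodule.span ℂ (b '' {i | 0 < l i}), Submodule.span ℂ (b '' {i | ¬ 0 < l i}),
    ?_, ?_, ?_, ?_⟩
  · intro v hv
    rw [qform_eigen_sum T hT hn.symm, ← b.sum_sq_norm_inner_right v, Finset.mul_sum]
    refine Finset.sum_le_sum fun i _ => ?_
    by_cases hi : 0 < l i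
    · have := hgapl i
      rw [abs_of_pos hi] at this
      exact mul_le_mul_of_nonneg_right this (by positivity)
    · rw [← hb, (hmem _ v).1 hv i hi]; simp
  · intro v hv
    rw [qform_eigen_sum T hT hn.symm, ← b.sum_sq_norm_inner_right v, Finset.mul_sum,
      ← Finset.sum_neg_distrib]
    refine Finset.sum_le_sum fun i _ => ?_
    by_cases hi : 0 < l i
    · rw [← hb, (hmem _ v).1 hv i (by simpa using hi)]; simp
    · have := hgapl i
      rw [abs_of_nonpos (not_lt.1 hi)] at this
      rw [← neg_mul]
      exact mul_le_mul_of_nonneg_right (by linarith) (by positivity)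
  · classical
    rw [hfin, hfin, Fintype.card_subtype_compl, Fintype.card_fin]
    have : Fintype.card {i // 0 < l i} ≤ n := by
      simpa using Fintype.card_subtype_le (fun i : Fin n => 0 < l i)
    omega
  · intro J hJ v hv
    have : Submodule.span ℂ (b '' {i | 0 < l i}) ≤
        (Submodule.span ℂ (b '' {i | 0 < l i})).comap J := by
      rw [Submodule.span_le]
      rintro _ ⟨i, hi, rfl⟩
      rw [SetLike.mem_coe, Submodule.mem_comap, hmem]
      intro k hk
      have h1 : (inner ℂ (T (b k)) (J (b i)) : ℂ) = inner ℂ (b k) (T (J (b i))) := hT _ _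
      rw [hTb, hJ, hTb, inner_smul_left, map_smulₛₗ, inner_smul_right] at h1
      simp only [Complex.conj_ofReal] at h1
      have h2 : ((l k : ℂ) - l i) * inner ℂ (b k) (J (b i)) = 0 := by rw [sub_mul, h1, sub_self]
      rcases mul_eq_zero.1 h2 with h3 | h3
      · exfalso
        have : l k = l i := by exact_mod_cast sub_eq_zero.1 h3
        exact hk (this ▸ hi)
      · exact h3
    exact this hv

theorem exists_hasSplit (T : X →ₗ[ℂ] X) (hT : T.IsSymmetric) {U : Submodule ℂ X}
    (hU : ∀ v ∈ U, T v ∈ U) {δ : ℝ} (hgap : ∀ v ∈ U, δ * ‖v‖ ≤ ‖T v‖) :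
    ∃ d, HasSplit (qform T) U δ d := by
  obtain ⟨E, F, hE, hF, hs, -⟩ := exists_spectral_split_top (T.restrict hU)
    (hT.restrict_invariant hU) (fun v => hgap v v.2)
  have h : HasSplit (qform (T.restrict hU)) (⊤ : Submodule ℂ U) δ (finrank ℂ E) :=
    ⟨E, F, le_top, le_top, hE, hF, rfl, by rw [hs, finrank_top]⟩
  have h2 := h.map (q' := qform T) U.subtypeₗᵢ (fun v _ => rfl)
  refine ⟨finrank ℂ E, ?_⟩
  have h3 : (⊤ : Submodule ℂ U).map U.subtypeₗᵢ.toLinearMap = U := Submodule.map_subtype_top U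
  rwa [h3] at h2

theorem even_finrank_of_quaternionic (J : X →ₛₗ[starRingEnd ℂ] X)
    (hJ : ∀ v, J (J v) = -v) : Even (finrank ℂ X) := by
  set b := finBasis ℂ X
  set M : Matrix (Fin (finrank ℂ X)) (Fin (finrank ℂ X)) ℂ := Matrix.of fun l k => b.repr (J (b k)) l
  have hJb : ∀ k, J (b k) = ∑ l, M l k • b l := fun k => (b.sum_repr (J (b k))).symm
  have hM : M * M.map (starRingEnd ℂ) = -1 := by
    ext m k
    have h := hJ (b k)
    rw [hJb k, map_sum] at h
    simp only [map_smulₛₗ, hJb] at h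
    have h2 := congrArg (fun v => b.repr v m) h
    simp only [map_sum, _root_.map_smul, Finsupp.coe_finsetSum, Finset.sum_apply, Finsupp.smul_apply,
      b.repr_self, map_neg, Finsupp.neg_apply, smul_eq_mul, Finsupp.single_apply] at h2
    rw [Matrix.mul_apply, Matrix.neg_apply, Matrix.one_apply]
    simp only [mul_ite, mul_one, mul_zero, Finset.sum_ite_eq', Finset.mem_univ, if_true] at h2
    simp only [Matrix.map_apply]
    calc _ = ∑ x, (starRingEnd ℂ) (M x k) * M m x := Finset.sum_congr rfl fun _ _ => mul_comm _ _
      _ = _ := by rw [h2]; simp [eq_comm]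
  have hdet := congrArg Matrix.det hM
  rw [Matrix.det_mul, Matrix.det_neg, Matrix.det_one, mul_one, Fintype.card_fin] at hdet
  have h3 : (M.map (starRingEnd ℂ)).det = starRingEnd ℂ M.det :=
    ((starRingEnd ℂ).map_det M).symm
  rw [h3, Complex.mul_conj] at hdet
  by_contra hodd
  rw [Nat.not_even_iff_odd] at hodd
  rw [hodd.neg_one_pow] at hdet
  have : Complex.normSq M.det = -1 := by exact_mod_cast hdet
  linarith [Complex.normSq_nonneg M.det]

theorem HasSplit.even_of_quaternionic {T : X →ₗ[ℂ] X} (hT : T.IsSymmetric) {U : Submodule ℂ X}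
    (hU : ∀ v ∈ U, T v ∈ U) {δ : ℝ} (hδ : 0 < δ) (hgap : ∀ v ∈ U, δ * ‖v‖ ≤ ‖T v‖)
    (J : X →ₛₗ[starRingEnd ℂ] X) (hJ : ∀ v, J (J v) = -v) (hJU : ∀ v ∈ U, J v ∈ U)
    (hJT : ∀ v, T (J v) = J (T v)) {d : ℕ} (hd : HasSplit (qform T) U δ d) : Even d := by
  obtain ⟨E, F, hE, hF, hs, hJE⟩ := exists_spectral_split_top (T.restrict hU)
    (hT.restrict_invariant hU) (fun v => hgap v v.2)
  have h : HasSplit (qform (T.restrict hU)) (⊤ : Submodule ℂ U) δ (finrank ℂ E) :=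
    ⟨E, F, le_top, le_top, hE, hF, rfl, by rw [hs, finrank_top]⟩
  have h2 := h.map (q' := qform T) U.subtypeₗᵢ (fun v _ => rfl)
  have h3 : (⊤ : Submodule ℂ U).map U.subtypeₗᵢ.toLinearMap = U := Submodule.map_subtype_top U
  rw [h3] at h2
  rw [← hd.posIndex_eq hδ, h2.posIndex_eq hδ]
  set JU : U →ₛₗ[starRingEnd ℂ] U := (J.domRestrict U).codRestrict U (fun v => hJU v v.2)
  have hJE' := hJE JU (fun v => Subtype.ext (hJT v))
  refine even_finrank_of_quaternionic ((JU.domRestrict E).codRestrict E (fun v => hJE' v v.2)) ?_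
  intro v
  apply Subtype.ext; apply Subtype.ext
  exact hJ v

theorem abs_qform_sub_le (S T : X →ₗ[ℂ] X) {ε : ℝ} {v : X} (h : ‖S v - T v‖ ≤ ε * ‖v‖) :
    |qform S v - qform T v| ≤ ε * ‖v‖ ^ 2 := by
  unfold qform
  rw [← Complex.sub_re, ← inner_sub_right]
  calc _ ≤ ‖inner ℂ v (S v - T v)‖ := Complex.abs_re_le_norm _
    _ ≤ ‖v‖ * ‖S v - T v‖ := norm_inner_le_norm _ _
    _ ≤ ‖v‖ * (ε * ‖v‖) := by gcongr
    _ = _ := by ring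

theorem exists_hasSplit_of_homotopy (T₀ T₁ : X →ₗ[ℂ] X) (h₀ : T₀.IsSymmetric)
    (h₁ : T₁.IsSymmetric) {U : Submodule ℂ X} (hU₀ : ∀ v ∈ U, T₀ v ∈ U) (hU₁ : ∀ v ∈ U, T₁ v ∈ U)
    {δ : ℝ} (hδ : 0 < δ)
    (hgap : ∀ t : ℝ, 0 ≤ t → t ≤ 1 → ∀ v ∈ U,
      δ * ‖v‖ ≤ ‖((1 - t : ℝ) : ℂ) • T₀ v + (t : ℂ) • T₁ v‖) :
    posIndex (qform T₀) U = posIndex (qform T₁) U := by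
  set T : unitInterval → (X →ₗ[ℂ] X) := fun t => ((1 - t : ℝ) : ℂ) • T₀ + ((t : ℝ) : ℂ) • T₁
  have hsym : ∀ t, (T t).IsSymmetric := fun t x y => by
    simp only [T, LinearMap.add_apply, LinearMap.smul_apply, inner_add_left, inner_add_right,
      inner_smul_left, inner_smul_right, h₀ x y, h₁ x y, Complex.conj_ofReal]
  have hinv : ∀ t, ∀ v ∈ U, T t v ∈ U := fun t v hv =>
    U.add_mem (U.smul_mem _ (hU₀ v hv)) (U.smul_mem _ (hU₁ v hv))
  have hg : ∀ t : unitInterval, ∀ v ∈ U, δ * ‖v‖ ≤ ‖T t v‖ := fun t v hv => by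
    simpa [T] using hgap t t.2.1 t.2.2 v hv
  choose d hd using fun t => exists_hasSplit (T t) (hsym t) (hinv t) (hg t)
  set C := ‖LinearMap.toContinuousLinearMap (T₁ - T₀)‖ with hC
  have hclose : ∀ s t : unitInterval, ∀ v, ‖T t v - T s v‖ ≤ (|(t : ℝ) - s| * C) * ‖v‖ := by
    intro s t v
    have : T t v - T s v = (((t : ℝ) - s : ℝ) : ℂ) • (T₁ - T₀) v := by
      simp only [T, LinearMap.add_apply, LinearMap.smul_apply, LinearMap.sub_apply]
      push_cast
      module
    rw [this, norm_smul, Complex.norm_real, mul_assoc, Real.norm_eq_abs]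
    refine mul_le_mul_of_nonneg_left ?_ (abs_nonneg _)
    exact (LinearMap.toContinuousLinearMap (T₁ - T₀)).le_opNorm v
  have hloc : IsLocallyConstant d := by
    rw [IsLocallyConstant.iff_eventually_eq]
    intro s
    have hcont : Continuous fun t : unitInterval => |(t : ℝ) - s| * C := by fun_prop
    have : ∀ᶠ t : unitInterval in nhds s, |(t : ℝ) - s| * C < δ :=
      hcont.continuousAt.eventually_lt_const (by simpa using hδ)
    filter_upwards [this] with t ht
    have h2 := (hd s).perturb (q' := qform (T t)) (fun v _ => abs_qform_sub_le _ _ (hclose s t v))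
    rw [← (hd t).posIndex_eq hδ, h2.posIndex_eq (by linarith)]
  have h01 : d 0 = d 1 := hloc.apply_eq_of_preconnectedSpace 0 1
  have e0 : T 0 = T₀ := by simp [T]
  have e1 : T 1 = T₁ := by simp [T]
  rw [← e0, ← e1, (hd 0).posIndex_eq hδ, (hd 1).posIndex_eq hδ, h01]

end Inertia

section Window

open Matrix
open scoped Matrix.Norms.L2Operator

/-- Width of the averaging windows. -/
def bw (n : ℕ) : ℕ := 4 * (n + 1)

/-- Length of the lattice. -/
def lw (n : ℕ) : ℕ := bw n * (n + 1)

instance (n : ℕ) : NeZero (bw n) := ⟨by unfold bw; omega⟩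

instance (n : ℕ) : NeZero (lw n + bw n) := ⟨by unfold bw; omega⟩

/-- Fourier modes. -/
abbrev Lat (A : Type*) (n : ℕ) : Type _ := A → Fin (lw n + 1)

/-- Positions. -/
abbrev Pos (A : Type*) (n : ℕ) : Type _ := A → Fin (lw n + bw n)

/-- Discrete angles. -/
abbrev Ang (A : Type*) (n : ℕ) : Type _ := A → ZMod (bw n)

variable {A : Type*} [Fintype A] [DecidableEq A] {n : ℕ}

/-- The lattice point `a` is seen from the position `x`. -/
def InBox (x : Pos A n) (a : Lat A n) : Prop :=
  ∀ i, (a i : ℕ) ≤ x i ∧ (x i : ℕ) < a i + bw n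

instance (x : Pos A n) (a : Lat A n) : Decidable (InBox x a) := by
  unfold InBox; infer_instance

/-- Reduction of a lattice point modulo the window width. -/
def red (a : Lat A n) : Ang A n := fun i => ((a i : ℕ) : ZMod (bw n))

theorem eq_of_inBox {x : Pos A n} {a b : Lat A n} (ha : InBox x a) (hb : InBox x b)
    (h : red a = red b) : a = b := by
  funext i
  have h1 := congrFun h i
  simp only [red] at h1
  rw [ZMod.natCast_eq_natCast_iff] at h1
  have ha := ha i
  have hb := hb i
  apply Fin.ext
  rcases le_total (a i : ℕ) (b i) with hab | hab
  · have := (Nat.modEq_iff_dvd' hab).1 h1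
    have := Nat.eq_zero_of_dvd_of_lt this (by omega)
    omega
  · have := (Nat.modEq_iff_dvd' hab).1 h1.symm
    have := Nat.eq_zero_of_dvd_of_lt this (by omega)
    omega

/-- The pairing of angles and modes. -/
noncomputable def pair (ξ t : Ang A n) : ℂ := ZMod.stdAddChar (∑ i, ξ i * t i)

theorem pair_add_left (ξ η t : Ang A n) : pair (ξ + η) t = pair ξ t * pair η t := by
  simp [pair, add_mul, Finset.sum_add_distrib, AddChar.map_add_eq_mul]

theorem pair_add_right (ξ s t : Ang A n) : pair ξ (s + t) = pair ξ s * pair ξ t := by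
  simp [pair, mul_add, Finset.sum_add_distrib, AddChar.map_add_eq_mul]

theorem pair_neg_right (ξ t : Ang A n) : pair ξ (-t) = pair (-ξ) t := by
  simp [pair]

theorem conj_pair (ξ t : Ang A n) : starRingEnd ℂ (pair ξ t) = pair (-ξ) t := by
  simp only [pair, Pi.neg_apply, neg_mul, Finset.sum_neg_distrib]
  rw [ZMod.stdAddChar_apply, ZMod.stdAddChar_apply, AddChar.map_neg_eq_inv,
    Circle.coe_inv_eq_conj]

theorem pair_zero_left (t : Ang A n) : pair 0 t = 1 := by simp [pair]

theorem map_sum_eq_prod_stdAddChar {ι : Type*} [Fintype ι] (t : ι → ZMod (bw n)) :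
    (ZMod.stdAddChar (∑ i, t i) : ℂ) = ∏ i, ZMod.stdAddChar (t i) := by
  classical
  have : ∀ s : Finset ι, (ZMod.stdAddChar (∑ i ∈ s, t i) : ℂ) = ∏ i ∈ s, ZMod.stdAddChar (t i) := by
    intro s
    induction s using Finset.induction_on with
    | empty => simp
    | insert a s ha ih => rw [Finset.sum_insert ha, Finset.prod_insert ha, AddChar.map_add_eq_mul, ih]
  exact this _

theorem sum_pair (t : Ang A n) :
    ∑ ξ : Ang A n, pair ξ t = if t = 0 then (bw n : ℂ) ^ Fintype.card A else 0 := by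
  have h : ∀ ξ : Ang A n, pair ξ t = ∏ i, ZMod.stdAddChar (ξ i * t i) := fun ξ => by
    rw [pair]
    exact map_sum_eq_prod_stdAddChar _
  simp only [h]
  rw [← Fintype.prod_sum (fun i (y : ZMod (bw n)) => (ZMod.stdAddChar (y * t i) : ℂ))]
  simp only [AddChar.sum_mulShift _ (ZMod.isPrimitive_stdAddChar (bw n)), ZMod.card]
  split_ifs with ht
  · subst ht; simp
  · obtain ⟨i, hi⟩ := Function.ne_iff.1 ht
    exact Finset.prod_eq_zero (Finset.mem_univ i) (by simp_all)

/-- A windowed Fourier operator. -/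
noncomputable def wop (κ : Pos A n → Lat A n → ℂ) (g : Lat A n → Ang A n) :
    Matrix (Pos A n × Ang A n) (Lat A n) ℂ :=
  of fun p a => ((bw n : ℂ) ^ Fintype.card A)⁻¹ * κ p.1 a * pair (-p.2) (g a)

theorem wop_conjTranspose_mul_self (κ : Pos A n → Lat A n → ℂ) (g : Lat A n → Ang A n)
    (h : ∀ x a b, κ x a ≠ 0 → κ x b ≠ 0 → g a = g b → a = b) :
    (wop κ g)ᴴ * wop κ g =
      diagonal fun a => ((((bw n : ℝ) ^ Fintype.card A)⁻¹ * ∑ x, ‖κ x a‖ ^ 2 : ℝ) : ℂ) := by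
  have hN : (bw n : ℂ) ≠ 0 := Nat.cast_ne_zero.2 (NeZero.ne _)
  ext a b
  rw [mul_apply, Fintype.sum_prod_type]
  have key : ∀ x : Pos A n, ∑ ξ : Ang A n, (wop κ g)ᴴ a (x, ξ) * wop κ g (x, ξ) b =
      ((bw n : ℂ) ^ Fintype.card A)⁻¹ * (starRingEnd ℂ (κ x a) * κ x b) *
        (if g a = g b then 1 else 0) := by
    intro x
    have : ∀ ξ : Ang A n, (wop κ g)ᴴ a (x, ξ) * wop κ g (x, ξ) b =
        (((bw n : ℂ) ^ Fintype.card A)⁻¹ * ((bw n : ℂ) ^ Fintype.card A)⁻¹ *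
          (starRingEnd ℂ (κ x a) * κ x b)) * pair ξ (g a - g b) := by
      intro ξ
      simp only [wop, conjTranspose_apply, of_apply, star_mul', RCLike.star_def, conj_pair,
        neg_neg, sub_eq_add_neg, pair_add_right, pair_neg_right, map_inv₀, map_pow,
        map_natCast]
      ring
    simp only [this]
    rw [← Finset.mul_sum, sum_pair]
    simp only [sub_eq_zero]
    split_ifs
    · field_simp
    · simp
  simp only [key]
  by_cases hab : a = b
  · subst hab
    simp only [diagonal_apply_eq, if_true, mul_one]
    rw [← Finset.mul_sum]
    push_cast
    congr 1
    refine Finset.sum_congr rfl fun x _ => ?_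
    rw [← Complex.normSq_eq_conj_mul_self, Complex.normSq_eq_norm_sq]
    push_cast; rfl
  · rw [diagonal_apply_ne _ hab]
    refine Finset.sum_eq_zero fun x _ => ?_
    split_ifs with hg
    · by_cases ha : κ x a = 0
      · simp [ha]
      by_cases hb : κ x b = 0
      · simp [hb]
      exact absurd (h x a b ha hb hg) hab
    · simp

theorem norm_wop_le (κ : Pos A n → Lat A n → ℂ) (g : Lat A n → Ang A n)
    (h : ∀ x a b, κ x a ≠ 0 → κ x b ≠ 0 → g a = g b → a = b) {C : ℝ} (hC : 0 ≤ C)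
    (hb : ∀ a, ((bw n : ℝ) ^ Fintype.card A)⁻¹ * ∑ x, ‖κ x a‖ ^ 2 ≤ C ^ 2) :
    ‖wop κ g‖ ≤ C := by
  refine le_of_sq_le_sq ?_ hC
  rw [sq, ← l2_opNorm_conjTranspose_mul_self, wop_conjTranspose_mul_self κ g h,
    l2_opNorm_diagonal, pi_norm_le_iff_of_nonneg (sq_nonneg C)]
  intro a
  rw [Complex.norm_real, Real.norm_of_nonneg (by positivity)]
  exact hb a

theorem card_fin_window {L : ℕ} (a w : ℕ) (h : a + w ≤ L) :
    (Finset.univ.filter fun y : Fin L => a ≤ (y : ℕ) ∧ (y : ℕ) < a + w).card = w := by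
  have h2 : (Finset.univ.filter fun y : Fin L => a ≤ (y : ℕ) ∧ (y : ℕ) < a + w).map
      Fin.valEmbedding = Finset.Ico a (a + w) := by
    ext y
    simp only [Finset.mem_map, Finset.mem_filter, Finset.mem_univ, true_and, Fin.valEmbedding_apply,
      Finset.mem_Ico]
    constructor
    · rintro ⟨z, hz, rfl⟩; exact hz
    · intro hy; exact ⟨⟨y, by omega⟩, hy, rfl⟩
  rw [← Finset.card_map Fin.valEmbedding, h2, Nat.card_Ico]; omega

theorem filter_inBox (a : Lat A n) :
    (Finset.univ.filter fun x : Pos A n => InBox x a) =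
      Fintype.piFinset fun i => Finset.univ.filter fun y : Fin (lw n + bw n) =>
        (a i : ℕ) ≤ y ∧ (y : ℕ) < a i + bw n := by
  ext x
  simp only [Finset.mem_filter, Finset.mem_univ, true_and, Fintype.mem_piFinset]
  rfl

theorem card_inBox (a : Lat A n) :
    (Finset.univ.filter fun x : Pos A n => InBox x a).card = bw n ^ Fintype.card A := by
  rw [filter_inBox, Fintype.card_piFinset]
  rw [Finset.prod_congr rfl fun i _ => card_fin_window (L := lw n + bw n) (a i) (bw n) (by omega)]
  simp

theorem card_inBox_face_le (a : Lat A n) (i : A) (c : ℕ) :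
    (Finset.univ.filter fun x : Pos A n => InBox x a ∧ (x i : ℕ) = c).card * bw n ≤
      bw n ^ Fintype.card A := by
  have h : (Finset.univ.filter fun x : Pos A n => InBox x a ∧ (x i : ℕ) = c) ⊆
      Fintype.piFinset fun k => Finset.univ.filter fun y : Fin (lw n + bw n) =>
        ((a k : ℕ) ≤ y ∧ (y : ℕ) < a k + bw n) ∧ (k = i → (y : ℕ) = c) := by
    intro x hx
    simp only [Finset.mem_filter, Finset.mem_univ, true_and] at hx
    simp only [Fintype.mem_piFinset, Finset.mem_filter, Finset.mem_univ, true_and]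
    exact fun k => ⟨hx.1 k, fun hk => hk ▸ hx.2⟩
  refine (Nat.mul_le_mul_right _ (Finset.card_le_card h)).trans ?_
  rw [Fintype.card_piFinset, ← Finset.mul_prod_erase _ _ (Finset.mem_univ i)]
  have h1 : (Finset.univ.filter fun y : Fin (lw n + bw n) =>
        ((a i : ℕ) ≤ y ∧ (y : ℕ) < a i + bw n) ∧ (i = i → (y : ℕ) = c)).card ≤ 1 := by
    rw [Finset.card_le_one]
    intro y hy z hz
    simp only [Finset.mem_filter, Finset.mem_univ, true_and, forall_const] at hy hz
    exact Fin.ext (hy.2.trans hz.2.symm)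
  have h2 : ∏ k ∈ Finset.univ.erase i, (Finset.univ.filter fun y : Fin (lw n + bw n) =>
        ((a k : ℕ) ≤ y ∧ (y : ℕ) < a k + bw n) ∧ (k = i → (y : ℕ) = c)).card ≤
      bw n ^ (Fintype.card A - 1) := by
    have : (Finset.univ.erase i).card = Fintype.card A - 1 := by
      rw [Finset.card_erase_of_mem (Finset.mem_univ i), Finset.card_univ]
    rw [← this]
    refine Finset.prod_le_pow_card _ _ _ fun k _ => ?_
    refine (Finset.card_le_card ?_).trans
      (card_fin_window (L := lw n + bw n) (a k) (bw n) (by omega)).le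
    intro y hy
    simp only [Finset.mem_filter, Finset.mem_univ, true_and] at hy ⊢
    exact hy.1
  have hpos : 0 < Fintype.card A := Fintype.card_pos_iff.2 ⟨i⟩
  calc _ ≤ 1 * bw n ^ (Fintype.card A - 1) * bw n := by gcongr
    _ = bw n ^ Fintype.card A := by
      rw [one_mul, ← pow_succ]; congr 1; omega

/-- The averaging isometry. -/
noncomputable def iso (A : Type*) [Fintype A] [DecidableEq A] (n : ℕ) :
    Matrix (Pos A n × Ang A n) (Lat A n) ℂ :=
  wop (fun x a => if InBox x a then 1 else 0) red

theorem iso_conjTranspose_mul_self : (iso A n)ᴴ * iso A n = 1 := by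
  rw [iso, wop_conjTranspose_mul_self]
  · ext a b
    rw [diagonal_apply, one_apply]
    split_ifs with hab
    · have : ∀ x : Pos A n, ‖(if InBox x a then 1 else 0 : ℂ)‖ ^ 2 =
          if InBox x a then (1 : ℝ) else 0 := fun x => by split_ifs <;> simp
      simp only [this]
      rw [Finset.sum_boole, card_inBox]
      push_cast
      exact inv_mul_cancel₀ (pow_ne_zero _ (Nat.cast_ne_zero.2 (NeZero.ne _)))
    · rfl
  · intro x a b ha hb h
    simp only [ne_eq, ite_eq_right_iff, one_ne_zero, imp_false, not_not] at ha hb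
    exact eq_of_inBox ha hb h

end Window

section Multiplier

open Matrix
open scoped Matrix.Norms.L2Operator

variable {A : Type*} [Fintype A] [DecidableEq A] {n : ℕ}

theorem card_inBox_diff_le (a b : Lat A n) (i : A) (hoff : ∀ k, k ≠ i → a k = b k)
    (h1 : (a i : ℕ) ≤ b i + 1) (h2 : (b i : ℕ) ≤ a i + 1) :
    (Finset.univ.filter fun x : Pos A n => InBox x a ∧ ¬ InBox x b).card * bw n ≤
      bw n ^ Fintype.card A := by
  refine le_trans (Nat.mul_le_mul_right _ (Finset.card_le_card ?_))
    (card_inBox_face_le a i (if (a i : ℕ) < b i then a i else a i + bw n - 1))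
  intro x hx
  simp only [Finset.mem_filter, Finset.mem_univ, true_and] at hx ⊢
  refine ⟨hx.1, ?_⟩
  obtain ⟨k, hk⟩ := not_forall.1 hx.2
  have hki : k = i := by
    by_contra hne
    rw [← hoff k hne] at hk
    exact hk (hx.1 k)
  subst hki
  have := hx.1 k
  split_ifs <;> omega

theorem norm_cut_le (σ : Lat A n → ℂ) (P : Pos A n → Lat A n → Prop) [∀ x a, Decidable (P x a)]
    (γ : Lat A n → Ang A n) {C : ℝ} (hC : 0 ≤ C) (hσ : ∀ a, ‖σ a‖ ≤ C)
    (hinj : ∀ x a b, P x a → P x b → σ a ≠ 0 → σ b ≠ 0 → γ a = γ b → a = b)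
    (hcard : ∀ a, σ a ≠ 0 → (Finset.univ.filter fun x : Pos A n => P x a).card * bw n ≤
      bw n ^ Fintype.card A) :
    ‖wop (fun x a => if P x a then σ a else 0) γ‖ ≤ C / Real.sqrt (bw n) := by
  have hN : (0 : ℝ) < bw n := Nat.cast_pos.2 (NeZero.pos _)
  refine norm_wop_le _ _ ?_ (by positivity) fun a => ?_
  · intro x a b ha hb
    simp only [ne_eq, ite_eq_right_iff, Classical.not_imp] at ha hb
    exact hinj x a b ha.1 hb.1 ha.2 hb.2
  · by_cases ha : σ a = 0
    · simp only [ha, ite_self, norm_zero]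
      simp only [ne_eq, OfNat.ofNat_ne_zero, not_false_eq_true, zero_pow, Finset.sum_const_zero,
        mul_zero]
      positivity
    have h1 : ∑ x : Pos A n, ‖(if P x a then σ a else 0 : ℂ)‖ ^ 2 =
        (Finset.univ.filter fun x : Pos A n => P x a).card * ‖σ a‖ ^ 2 := by
      rw [← nsmul_eq_mul, ← Finset.sum_const, Finset.sum_filter]
      exact Finset.sum_congr rfl fun x _ => by split_ifs <;> simp
    rw [h1, div_pow, Real.sq_sqrt hN.le]
    have h2 : ((Finset.univ.filter fun x : Pos A n => P x a).card : ℝ) * bw n ≤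
      (bw n : ℝ) ^ Fintype.card A := by exact_mod_cast hcard a ha
    have h3 : ‖σ a‖ ^ 2 ≤ C ^ 2 := by gcongr; exact hσ a
    rw [inv_mul_le_iff₀ (by positivity), ← mul_div_assoc, le_div_iff₀ hN]
    have := mul_le_mul h2 h3 (by positivity) (by positivity)
    linarith

theorem norm_multiplier_sub_le (m : Pos A n × Ang A n → ℂ) (ρ : Pos A n → ℂ) (σ : Lat A n → ℂ)
    (φ : Ang A n → ℂ) (γ : Lat A n → Ang A n) (g : Lat A n → Lat A n) (hg : g.Injective)
    (hm : ∀ x ξ, m (x, ξ) = φ ξ * ρ x)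
    (hφ : ∀ ξ a, φ ξ * pair (-ξ) (red a) = pair (-ξ) (γ a))
    (hγ : ∀ a b, γ a = γ b → red a = red b)
    (hgγ : ∀ a, σ a ≠ 0 → red (g a) = γ a)
    (hcard : ∀ a, σ a ≠ 0 → (Finset.univ.filter fun x : Pos A n =>
      InBox x a ∧ ¬ InBox x (g a)).card * bw n ≤ bw n ^ Fintype.card A)
    (hcard' : ∀ a, σ a ≠ 0 → (Finset.univ.filter fun x : Pos A n =>
      InBox x (g a) ∧ ¬ InBox x a).card * bw n ≤ bw n ^ Fintype.card A)
    {C η : ℝ} (hC : 0 ≤ C) (hη : 0 ≤ η) (hσ : ∀ a, ‖σ a‖ ≤ C)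
    (hρ : ∀ x a, InBox x a → ‖ρ x - σ a‖ ≤ η) :
    ‖(diagonal m * iso A n - iso A n * (of fun b a => if b = g a then σ a else 0) : Matrix (Pos A n × Ang A n) (Lat A n) ℂ)‖ ≤
      η + C / Real.sqrt (bw n) + C / Real.sqrt (bw n) := by
  have hdec : (diagonal m * iso A n - iso A n * (of fun b a => if b = g a then σ a else 0) : Matrix (Pos A n × Ang A n) (Lat A n) ℂ) =
      wop (fun x a => if InBox x a then ρ x - σ a else 0) γ +
      wop (fun x a => if InBox x a ∧ ¬ InBox x (g a) then σ a else 0) γ -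
      wop (fun x a => if InBox x (g a) ∧ ¬ InBox x a then σ a else 0) γ := by
    ext ⟨x, ξ⟩ a
    have h1 : (iso A n * (of fun b a => if b = g a then σ a else 0)) (x, ξ) a =
        iso A n (x, ξ) (g a) * σ a := by
      rw [mul_apply]; simp
    rw [Matrix.sub_apply, Matrix.sub_apply, Matrix.add_apply, h1, diagonal_mul, hm]
    simp only [iso, wop, of_apply]
    by_cases hs : σ a = 0
    · simp only [hs, mul_zero, sub_zero, ite_self, zero_mul, add_zero, ← hφ]
      split_ifs <;> ring
    · rw [hgγ a hs, ← hφ]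
      by_cases hb1 : InBox x a <;> by_cases hb2 : InBox x (g a) <;> simp [hb1, hb2] <;> ring
  rw [hdec]
  refine (norm_sub_le _ _).trans (add_le_add ((norm_add_le _ _).trans (add_le_add ?_ ?_)) ?_)
  · refine norm_wop_le _ _ ?_ hη fun a => ?_
    · intro x a b ha hb h
      simp only [ne_eq, ite_eq_right_iff, Classical.not_imp] at ha hb
      exact eq_of_inBox ha.1 hb.1 (hγ a b h)
    · have h2 : ∑ x : Pos A n, ‖(if InBox x a then ρ x - σ a else 0 : ℂ)‖ ^ 2 ≤
          ∑ x : Pos A n, if InBox x a then η ^ 2 else 0 := by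
        refine Finset.sum_le_sum fun x _ => ?_
        split_ifs with h
        · have := hρ x a h
          gcongr
        · simp
      rw [← Finset.sum_filter, Finset.sum_const, card_inBox, nsmul_eq_mul] at h2
      have hN : (0 : ℝ) < bw n := Nat.cast_pos.2 (NeZero.pos _)
      rw [inv_mul_le_iff₀ (by positivity)]
      exact_mod_cast h2
  · refine norm_cut_le σ (fun x a => InBox x a ∧ ¬ InBox x (g a)) γ hC hσ ?_ hcard
    intro x a b ha hb _ _ h
    exact eq_of_inBox ha.1 hb.1 (hγ a b h)
  · refine norm_cut_le σ (fun x a => InBox x (g a) ∧ ¬ InBox x a) γ hC hσ ?_ hcard'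
    intro x a b ha hb h1 h2 h
    exact hg (eq_of_inBox ha.1 hb.1 (by rw [hgγ a h1, hgγ b h2, h]))

end Multiplier

section Polar

open Matrix Filter Topology
open scoped Matrix.Norms.L2Operator

theorem tendsto_nhds_infty_of_norm {X V : Type*} [NormedAddCommGroup V]
    {l : Filter X} {f : X → OnePoint V}
    (h : ∀ R : ℝ, ∀ᶠ x in l, ∀ v : V, f x = (v : OnePoint V) → R < ‖v‖) :
    Tendsto f l (𝓝 (OnePoint.infty : OnePoint V)) := by
  rw [tendsto_def]
  intro s hs
  obtain ⟨t, hts, hto, htm⟩ := mem_nhds_iff.1 hs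
  have hK := (OnePoint.isOpen_iff_of_mem htm).1 hto
  obtain ⟨R, hR⟩ := hK.2.isBounded.exists_norm_le
  filter_upwards [h R] with x hx
  apply hts
  by_contra hnot
  cases hfx : f x with
  | infty => exact hnot (hfx ▸ htm)
  | coe v =>
    have h1 := hR v (by
      simp only [Set.mem_preimage, Set.mem_compl_iff] at *
      rwa [← hfx])
    exact absurd (hx v hfx) (not_lt.2 h1)

variable {A : Type*} [Fintype A] [DecidableEq A] {n : ℕ}

/-- The radius as a function of the action variable. -/
noncomputable def rad (s : ℝ) : ℝ := max 0 (s - 1 / 4) / (3 / 4 - s)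

open Classical in
/-- Action-angle coordinates on the one-point compactification. -/
noncomputable def pol (s : A → ℝ) (ω : A → Circle) : OnePoint (A → ℂ) :=
  if ∀ i, s i < 3 / 4 then ((fun i => (rad (s i) : ℂ) * ω i : A → ℂ) : OnePoint (A → ℂ))
  else OnePoint.infty

theorem pol_of_lt {s : A → ℝ} (hs : ∀ i, s i < 3 / 4) (ω : A → Circle) :
    pol s ω = ((fun i => (rad (s i) : ℂ) * ω i : A → ℂ) : OnePoint (A → ℂ)) := if_pos hs

theorem pol_of_le {s : A → ℝ} {i : A} (hs : 3 / 4 ≤ s i) (ω : A → Circle) :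
    pol s ω = OnePoint.infty := if_neg fun h => absurd (h i) (not_lt.2 hs)

theorem rad_of_le {s : ℝ} (hs : s ≤ 1 / 4) : rad s = 0 := by
  rw [rad, max_eq_left (by linarith), zero_div]

theorem rad_nonneg {s : ℝ} (hs : s < 3 / 4) : 0 ≤ rad s :=
  div_nonneg (le_max_left _ _) (by linarith)

theorem continuous_pol : Continuous fun p : (A → ℝ) × (A → Circle) => pol p.1 p.2 := by
  rw [continuous_iff_continuousAt]
  rintro ⟨s, ω⟩
  by_cases hs : ∀ i, s i < 3 / 4
  · have hev : ∀ᶠ p : (A → ℝ) × (A → Circle) in 𝓝 (s, ω), ∀ i, p.1 i < 3 / 4 := by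
      rw [eventually_all]
      intro i
      have : Continuous fun p : (A → ℝ) × (A → Circle) => p.1 i := by fun_prop
      exact this.continuousAt.eventually_lt_const (hs i)
    have hc : ContinuousAt (fun p : (A → ℝ) × (A → Circle) =>
        ((fun i => (rad (p.1 i) : ℂ) * p.2 i : A → ℂ) : OnePoint (A → ℂ))) (s, ω) := by
      refine OnePoint.continuous_coe.continuousAt.comp ?_
      rw [continuousAt_pi]
      intro i
      have h1 : ContinuousAt (fun p : (A → ℝ) × (A → Circle) => rad (p.1 i)) (s, ω) := by
        unfold rad
        refine ContinuousAt.div (by fun_prop) (by fun_prop) ?_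
        have := hs i
        simp only; linarith
      have h2 : Continuous fun p : (A → ℝ) × (A → Circle) => (p.2 i : ℂ) :=
        continuous_subtype_val.comp ((continuous_apply i).comp continuous_snd)
      exact (Complex.continuous_ofReal.continuousAt.comp h1).mul h2.continuousAt
    refine hc.congr ?_
    filter_upwards [hev] with p hp
    rw [pol_of_lt hp]
  · obtain ⟨i, hi⟩ := not_forall.1 hs
    rw [not_lt] at hi
    rw [ContinuousAt, pol_of_le (s := (s, ω).1) hi]
    refine tendsto_nhds_infty_of_norm fun R => ?_
    have hpos : (0 : ℝ) < 1 / (4 * (|R| + 1)) := by positivity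
    have hcont : Continuous fun p : (A → ℝ) × (A → Circle) => p.1 i := by fun_prop
    have hev : ∀ᶠ p : (A → ℝ) × (A → Circle) in 𝓝 (s, ω),
        3 / 4 - 1 / (4 * (|R| + 1)) < p.1 i :=
      hcont.continuousAt.eventually_const_lt (by simp only; linarith)
    filter_upwards [hev] with p hp v hv
    by_cases hlt : ∀ k, p.1 k < 3 / 4
    · rw [pol_of_lt hlt, OnePoint.coe_eq_coe] at hv
      have h1 : ‖v i‖ ≤ ‖v‖ := norm_le_pi_norm v i
      refine lt_of_lt_of_le ?_ h1
      rw [← hv]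
      simp only [norm_mul, Circle.norm_coe, mul_one, Complex.norm_real]
      rw [Real.norm_of_nonneg (rad_nonneg (hlt i))]
      have hd : 0 < 3 / 4 - p.1 i := by linarith [hlt i]
      have hle : 1 / (4 * (|R| + 1)) ≤ 1 / 4 := by
        apply one_div_le_one_div_of_le <;> nlinarith [abs_nonneg R]
      rw [rad, lt_div_iff₀ hd, max_eq_right (by linarith)]
      have h3 : 3 / 4 - p.1 i < 1 / (4 * (|R| + 1)) := by linarith
      rw [lt_div_iff₀ (by positivity)] at h3
      have h4 : R * (3 / 4 - p.1 i) ≤ |R| * (3 / 4 - p.1 i) :=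
        mul_le_mul_of_nonneg_right (le_abs_self R) hd.le
      nlinarith
    · obtain ⟨k, hk⟩ := not_forall.1 hlt
      rw [pol_of_le (not_lt.1 hk)] at hv
      exact absurd hv (OnePoint.infty_ne_coe v)

theorem exists_pol_modulus {Y : Type*} [PseudoMetricSpace Y] {h : OnePoint (A → ℂ) → Y}
    (hc : Continuous h) {ε : ℝ} (hε : 0 < ε) :
    ∃ δ > 0, ∀ s t : A → ℝ, (∀ i, s i ∈ Set.Icc (0 : ℝ) 2) → (∀ i, t i ∈ Set.Icc (0 : ℝ) 2) →
      (∀ i, |s i - t i| < δ) → ∀ ω, dist (h (pol s ω)) (h (pol t ω)) < ε := by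
  have hK : IsCompact ((Set.Icc (0 : A → ℝ) 2) ×ˢ (Set.univ : Set (A → Circle))) :=
    isCompact_Icc.prod isCompact_univ
  have hu := hK.uniformContinuousOn_of_continuous (hc.comp continuous_pol).continuousOn
  obtain ⟨δ, hδ, H⟩ := Metric.uniformContinuousOn_iff.1 hu ε hε
  refine ⟨δ, hδ, fun s t hs ht hst ω => ?_⟩
  refine H (s, ω) ⟨⟨fun i => (hs i).1, fun i => (hs i).2⟩, trivial⟩
    (t, ω) ⟨⟨fun i => (ht i).1, fun i => (ht i).2⟩, trivial⟩ ?_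
  rw [Prod.dist_eq, dist_self, max_lt_iff]
  exact ⟨(dist_pi_lt_iff hδ).2 hst, hδ⟩

/-- The point of the compactification attached to a position and an angle. -/
noncomputable def spt (p : Pos A n × Ang A n) : OnePoint (A → ℂ) :=
  pol (fun i => ((p.1 i : ℕ) : ℝ) / lw n) (fun i => ZMod.toCircle (p.2 i))

theorem lw_pos (n : ℕ) : 0 < lw n := by unfold lw bw; positivity

theorem bw_le_lw (n : ℕ) : bw n ≤ lw n := by unfold lw; nlinarith [Nat.zero_le (bw n * n)]

theorem bw_div_lw (n : ℕ) : (bw n : ℝ) / lw n = 1 / (n + 1) := by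
  have : (bw n : ℝ) ≠ 0 := Nat.cast_ne_zero.2 (NeZero.ne _)
  unfold lw; push_cast; field_simp

theorem pos_div_mem (x : ℕ) (hx : x ≤ lw n + bw n) :
    ((x : ℕ) : ℝ) / lw n ∈ Set.Icc (0 : ℝ) 2 := by
  have := lw_pos n
  have h1 : (0 : ℝ) < lw n := by exact_mod_cast this
  refine ⟨by positivity, ?_⟩
  rw [div_le_iff₀ h1]
  have h2 := bw_le_lw n
  have : x ≤ 2 * lw n := by omega
  exact_mod_cast this

/-- `h` is approximately preserved by quantization. -/
def AM (h : OnePoint (A → ℂ) → ℂ) : Prop :=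
  ∀ ε > 0, ∀ᶠ n in atTop, ∃ S : Matrix (Lat A n) (Lat A n) ℂ,
    ‖(diagonal (fun p : Pos A n × Ang A n => h (spt p)) * iso A n - iso A n * S : Matrix (Pos A n × Ang A n) (Lat A n) ℂ)‖ ≤ ε

theorem am_of_homogeneous (h : OnePoint (A → ℂ) → ℂ) (hc : Continuous h)
    (φ : ∀ n, Ang A n → ℂ) (γ : ∀ n, Lat A n → Ang A n) (g : ∀ n, Lat A n → Lat A n)
    (hg : ∀ n, (g n).Injective)
    (hm : ∀ (n : ℕ) (s : A → ℝ) (ξ : Ang A n),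
      h (pol s fun i => ZMod.toCircle (ξ i)) = φ n ξ * h (pol s 1))
    (hφ : ∀ n ξ a, φ n ξ * pair (-ξ) (red a) = pair (-ξ) (γ n a))
    (hγ : ∀ n a b, γ n a = γ n b → red a = red b)
    (hgγ : ∀ n a, h (pol (fun i => ((a i : ℕ) : ℝ) / lw n) 1) ≠ 0 → red (g n a) = γ n a)
    (hcard : ∀ n a, h (pol (fun i => ((a i : ℕ) : ℝ) / lw n) 1) ≠ 0 →
      (Finset.univ.filter fun x : Pos A n =>
        InBox x a ∧ ¬ InBox x (g n a)).card * bw n ≤ bw n ^ Fintype.card A)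
    (hcard' : ∀ n a, h (pol (fun i => ((a i : ℕ) : ℝ) / lw n) 1) ≠ 0 →
      (Finset.univ.filter fun x : Pos A n =>
        InBox x (g n a) ∧ ¬ InBox x a).card * bw n ≤ bw n ^ Fintype.card A) : AM h := by
  intro ε hε
  obtain ⟨C, hC⟩ := (isCompact_range hc).isBounded.exists_norm_le
  have hC0 : 0 ≤ C := (norm_nonneg _).trans (hC _ ⟨OnePoint.infty, rfl⟩)
  obtain ⟨δ, hδ, hmod⟩ := exists_pol_modulus hc (half_pos hε)
  have e1 : ∀ᶠ n : ℕ in atTop, (1 : ℝ) / (n + 1) < δ :=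
    tendsto_one_div_add_atTop_nhds_zero_nat.eventually_lt_const hδ
  have hbw : Tendsto (fun n : ℕ => (bw n : ℝ)) atTop atTop := by
    refine tendsto_natCast_atTop_atTop.comp ?_
    exact tendsto_atTop_mono (fun n => by simp only [id, bw]; omega) tendsto_id
  have hsq : Tendsto (fun n : ℕ => C / Real.sqrt (bw n)) atTop (𝓝 0) :=
    tendsto_const_nhds.div_atTop (Real.tendsto_sqrt_atTop.comp hbw)
  have e2 := hsq.eventually_lt_const (show (0 : ℝ) < ε / 4 by positivity)
  filter_upwards [e1, e2] with n hn1 hn2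
  refine ⟨_, (norm_multiplier_sub_le (fun p => h (spt p))
    (fun x => h (pol (fun i => ((x i : ℕ) : ℝ) / lw n) 1))
    (fun a => h (pol (fun i => ((a i : ℕ) : ℝ) / lw n) 1)) (φ n) (γ n) (g n) (hg n)
    (fun x ξ => hm n _ ξ) (hφ n) (hγ n) (hgγ n) (hcard n) (hcard' n) hC0 (half_pos hε).le
    (fun a => hC _ ⟨_, rfl⟩) (fun x a hxa => ?_)).trans ?_⟩
  · rw [← dist_eq_norm]
    refine (hmod _ _ (fun i => pos_div_mem _ (x i).2.le)
      (fun i => pos_div_mem _ (by have := (a i).2; omega)) (fun i => ?_) _).le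
    have hl : (0 : ℝ) < lw n := by exact_mod_cast lw_pos n
    rw [← sub_div, abs_div, abs_of_pos hl]
    refine lt_of_lt_of_le' hn1 ?_
    rw [← bw_div_lw]
    gcongr
    have := hxa i
    rw [abs_le]
    have h1 : ((a i : ℕ) : ℝ) ≤ (x i : ℕ) := by exact_mod_cast this.1
    have h2 : ((x i : ℕ) : ℝ) ≤ (a i : ℕ) + bw n := by exact_mod_cast this.2.le
    have h3 : (0 : ℝ) ≤ bw n := Nat.cast_nonneg _
    constructor <;> linarith
  · linarith

end Polar

section Generators

open Matrix Filter Topology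
open scoped Matrix.Norms.L2Operator

theorem continuous_elim_of_decay {V Y : Type*} [NormedAddCommGroup V] [ProperSpace V]
    [NormedAddCommGroup Y] {y : Y} {g : V → Y} (hg : Continuous g) {C : ℝ}
    (hb : ∀ v, ‖g v - y‖ * (1 + ‖v‖) ≤ C) :
    Continuous fun x : OnePoint V => x.elim y g := by
  rw [OnePoint.continuous_iff]
  refine ⟨?_, hg⟩
  simp only [OnePoint.elim_some, OnePoint.elim_infty]
  rw [coclosedCompact_eq_cocompact, tendsto_iff_norm_sub_tendsto_zero]
  have h1 : Tendsto (fun v : V => C / (1 + ‖v‖)) (cocompact V) (𝓝 0) :=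
    tendsto_const_nhds.div_atTop
      (tendsto_atTop_add_const_left _ _ (tendsto_norm_cocompact_atTop))
  refine squeeze_zero (fun _ => norm_nonneg _) (fun v => ?_) h1
  rw [le_div_iff₀ (by positivity)]
  exact hb v

variable {A : Type*} [Fintype A] [DecidableEq A] {n : ℕ}

theorem one_add_sq_norm_le (z : A → ℂ) : 1 + ‖z‖ ^ 2 ≤ 1 + ∑ i, ‖z i‖ ^ 2 := by
  have : ‖z‖ ≤ Real.sqrt (∑ i, ‖z i‖ ^ 2) := by
    rw [pi_norm_le_iff_of_nonneg (Real.sqrt_nonneg _)]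
    intro i
    exact Real.le_sqrt_of_sq_le (Finset.single_le_sum (f := fun i => ‖z i‖ ^ 2)
      (fun _ _ => sq_nonneg _) (Finset.mem_univ i))
  have h2 := Real.sq_sqrt (show 0 ≤ ∑ i, ‖z i‖ ^ 2 from Finset.sum_nonneg fun _ _ => sq_nonneg _)
  nlinarith [norm_nonneg z]

theorem one_add_sum_pos (z : A → ℂ) : 0 < 1 + ∑ i, ‖z i‖ ^ 2 :=
  lt_of_lt_of_le (by positivity) (one_add_sq_norm_le z)

/-- A bump function on the compactification. -/
noncomputable def chi : C(OnePoint (A → ℂ), ℂ) where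
  toFun x := x.elim 0 fun z => (((1 + ∑ i, ‖z i‖ ^ 2)⁻¹ : ℝ) : ℂ)
  continuous_toFun := by
    refine continuous_elim_of_decay (C := 2) ?_ fun z => ?_
    · refine Complex.continuous_ofReal.comp (Continuous.inv₀ (by fun_prop) fun z => ?_)
      exact (one_add_sum_pos z).ne'
    · have h0 := one_add_sum_pos z
      have h := one_add_sq_norm_le z
      rw [sub_zero, Complex.norm_real, Real.norm_of_nonneg (by positivity),
        ← div_eq_inv_mul, div_le_iff₀ h0]
      nlinarith [sq_nonneg (‖z‖ - 1)]

/-- Damped coordinate functions on the compactification. -/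
noncomputable def coo (i : A) : C(OnePoint (A → ℂ), ℂ) where
  toFun x := x.elim 0 fun z => (((1 + ∑ i, ‖z i‖ ^ 2)⁻¹ : ℝ) : ℂ) * z i
  continuous_toFun := by
    refine continuous_elim_of_decay (C := 2) ?_ fun z => ?_
    · refine (Complex.continuous_ofReal.comp (Continuous.inv₀ (by fun_prop) fun z => ?_)).mul
        (continuous_apply i)
      exact (one_add_sum_pos z).ne'
    · have h0 := one_add_sum_pos z
      have h := one_add_sq_norm_le z
      have hi := norm_le_pi_norm z i
      rw [sub_zero, norm_mul, Complex.norm_real, Real.norm_of_nonneg (by positivity), mul_assoc,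
        ← div_eq_inv_mul, div_le_iff₀ h0]
      nlinarith [sq_nonneg (‖z‖ - 1), norm_nonneg z, mul_le_mul_of_nonneg_right hi
        (show 0 ≤ 1 + ‖z‖ by positivity)]

theorem topologicalClosure_eq_top_of_chi_mem (S : StarSubalgebra ℂ C(OnePoint (A → ℂ), ℂ))
    (h1 : chi ∈ S) (h2 : ∀ i, coo i ∈ S) : S.topologicalClosure = ⊤ := by
  refine ContinuousMap.starSubalgebra_topologicalClosure_eq_top_of_separatesPoints S ?_
  intro x y hxy
  by_contra hcon
  have key : ∀ f ∈ S, f x = f y := fun f hf => by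
    by_contra hne
    exact hcon ⟨f, ⟨f, hf, rfl⟩, hne⟩
  have k1 := key _ h1
  have k2 := fun i => key _ (h2 i)
  have hne : ∀ z : A → ℂ, (((1 + ∑ i, ‖z i‖ ^ 2)⁻¹ : ℝ) : ℂ) ≠ 0 := fun z =>
    Complex.ofReal_ne_zero.2 (inv_ne_zero (one_add_sum_pos z).ne')
  cases x with
  | infty =>
    cases y with
    | infty => exact hxy rfl
    | coe w => exact hne w k1.symm
  | coe z =>
    cases y with
    | infty => exact hne z k1
    | coe w =>
      apply hxy
      congr 1
      funext i
      have h3 := k2 i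
      have k1' : (((1 + ∑ i, ‖z i‖ ^ 2)⁻¹ : ℝ) : ℂ) = (((1 + ∑ i, ‖w i‖ ^ 2)⁻¹ : ℝ) : ℂ) := k1
      have h3' : (((1 + ∑ i, ‖z i‖ ^ 2)⁻¹ : ℝ) : ℂ) * z i =
        (((1 + ∑ i, ‖w i‖ ^ 2)⁻¹ : ℝ) : ℂ) * w i := h3
      rw [← k1'] at h3'
      exact mul_left_cancel₀ (hne z) h3'

theorem chi_pol (s : A → ℝ) (ω : A → Circle) : chi (pol s ω) = chi (pol s 1) := by
  by_cases hs : ∀ i, s i < 3 / 4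
  · rw [pol_of_lt hs, pol_of_lt hs]
    simp [chi, Circle.norm_coe]
  · obtain ⟨i, hi⟩ := not_forall.1 hs
    rw [pol_of_le (not_lt.1 hi), pol_of_le (not_lt.1 hi)]

theorem coo_pol (i : A) (s : A → ℝ) (ω : A → Circle) :
    coo i (pol s ω) = ω i * coo i (pol s 1) := by
  by_cases hs : ∀ i, s i < 3 / 4
  · rw [pol_of_lt hs, pol_of_lt hs]
    simp only [coo, ContinuousMap.coe_mk, OnePoint.elim_some, norm_mul, Circle.norm_coe,
      Pi.one_apply, Circle.coe_one, mul_one]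
    ring
  · obtain ⟨k, hk⟩ := not_forall.1 hs
    rw [pol_of_le (not_lt.1 hk), pol_of_le (not_lt.1 hk)]
    simp [coo]

theorem mem_Ioo_of_coo_pol_ne {i : A} {s : A → ℝ} {ω : A → Circle} (h : coo i (pol s ω) ≠ 0) :
    s i ∈ Set.Ioo (1 / 4 : ℝ) (3 / 4) := by
  by_contra hcon
  apply h
  by_cases hs : ∀ i, s i < 3 / 4
  · have hi : s i ≤ 1 / 4 := by
      by_contra hlt
      exact hcon ⟨not_le.1 hlt, hs i⟩
    rw [pol_of_lt hs]
    simp [coo, rad_of_le hi]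
  · obtain ⟨k, hk⟩ := not_forall.1 hs
    rw [pol_of_le (not_lt.1 hk)]
    simp [coo]

theorem am_chi : AM (chi : C(OnePoint (A → ℂ), ℂ)) := by
  refine am_of_homogeneous _ chi.continuous (fun _ _ => 1) (fun _ => red) (fun _ => id)
    (fun _ => Function.injective_id) (fun n s ξ => ?_) (fun _ _ _ => one_mul _)
    (fun _ _ _ h => h) (fun _ _ _ => rfl) (fun _ _ _ => ?_) (fun _ _ _ => ?_)
  · rw [chi_pol, one_mul]
  · simp
  · simp

theorem val_of_mem_Ioo {a : Fin (lw n + 1)} (h : ((a : ℕ) : ℝ) / lw n ∈ Set.Ioo (1 / 4 : ℝ) (3 / 4)) :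
    0 < (a : ℕ) ∧ (a : ℕ) < lw n := by
  have hl : (0 : ℝ) < lw n := by exact_mod_cast lw_pos n
  obtain ⟨h1, h2⟩ := h
  rw [lt_div_iff₀ hl] at h1
  rw [div_lt_iff₀ hl] at h2
  constructor
  · have : (0 : ℝ) < ((a : ℕ) : ℝ) := by linarith
    exact_mod_cast this
  · have : ((a : ℕ) : ℝ) < lw n := by linarith
    exact_mod_cast this

theorem am_coo (i : A) : AM (coo i : C(OnePoint (A → ℂ), ℂ)) := by
  have hsub : ∀ (n : ℕ) (a : Lat A n),
      coo i (pol (fun i => ((a i : ℕ) : ℝ) / lw n) 1) ≠ 0 →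
      ((a - Pi.single i 1 : Lat A n) i : ℕ) + 1 = a i := by
    intro n a h
    have h' := mem_Ioo_of_coo_pol_ne h
    have := val_of_mem_Ioo h'
    have hne : a i ≠ 0 := fun h0 => by rw [h0] at this; simp at this
    rw [Pi.sub_apply, Pi.single_eq_same, Fin.val_sub_one_of_ne_zero hne]
    omega
  refine am_of_homogeneous _ (coo i).continuous (fun _ ξ => ZMod.stdAddChar (ξ i))
    (fun _ a => red a - Pi.single i 1) (fun _ a => a - Pi.single i 1)
    (fun _ => sub_left_injective) (fun n s ξ => ?_) (fun n ξ a => ?_)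
    (fun _ _ _ h => sub_left_injective h) (fun n a h => ?_) (fun n a h => ?_) (fun n a h => ?_)
  · rw [coo_pol, ZMod.stdAddChar_apply]
  · rw [sub_eq_add_neg, pair_add_right, pair_neg_right, neg_neg, mul_comm]
    congr 1
    simp [pair, Pi.single_apply]
  · funext k
    by_cases hk : k = i
    · subst hk
      have := hsub n a h
      simp only [red, Pi.sub_apply, Pi.single_eq_same] at this ⊢
      rw [← this]
      push_cast; ring
    · simp [red, hk]
  · refine card_inBox_diff_le a _ i (fun k hk => by simp [hk]) ?_ ?_ <;> have := hsub n a h <;> omega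
  · refine card_inBox_diff_le _ a i (fun k hk => by simp [hk]) ?_ ?_ <;> have := hsub n a h <;> omega

theorem am_star_coo (i : A) : AM (star (coo i) : C(OnePoint (A → ℂ), ℂ)) := by
  have hne' : ∀ x, (star (coo i) : C(OnePoint (A → ℂ), ℂ)) x ≠ 0 → coo i x ≠ 0 := fun x hx h0 =>
    hx (by simp [h0])
  have hadd : ∀ (n : ℕ) (a : Lat A n),
      (star (coo i) : C(OnePoint (A → ℂ), ℂ)) (pol (fun i => ((a i : ℕ) : ℝ) / lw n) 1) ≠ 0 →
      ((a + Pi.single i 1 : Lat A n) i : ℕ) = a i + 1 := by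
    intro n a h
    have h' := mem_Ioo_of_coo_pol_ne (hne' _ h)
    have := val_of_mem_Ioo h'
    rw [Pi.add_apply, Pi.single_eq_same, Fin.val_add_one_of_lt']
    omega
  refine am_of_homogeneous _ (star (coo i)).continuous (fun _ ξ => ZMod.stdAddChar (-ξ i))
    (fun _ a => red a + Pi.single i 1) (fun _ a => a + Pi.single i 1)
    (fun _ => add_left_injective _) (fun n s ξ => ?_) (fun n ξ a => ?_)
    (fun _ _ _ h => add_left_injective _ h) (fun n a h => ?_) (fun n a h => ?_) (fun n a h => ?_)
  · rw [ContinuousMap.star_apply, coo_pol, ZMod.stdAddChar_apply, star_mul', AddChar.map_neg_eq_inv,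
      Circle.coe_inv_eq_conj]
    rfl
  · rw [pair_add_right, mul_comm]
    congr 1
    simp [pair, Pi.single_apply]
  · funext k
    by_cases hk : k = i
    · subst hk
      have := hadd n a h
      simp only [red, Pi.add_apply, Pi.single_eq_same] at this ⊢
      rw [this]
      push_cast; ring
    · simp [red, hk]
  · refine card_inBox_diff_le a _ i (fun k hk => by simp [hk]) ?_ ?_ <;> have := hadd n a h <;> omega
  · refine card_inBox_diff_le _ a i (fun k hk => by simp [hk]) ?_ ?_ <;> have := hadd n a h <;> omega

theorem am_star_chi : AM (star chi : C(OnePoint (A → ℂ), ℂ)) := by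
  have : (star chi : C(OnePoint (A → ℂ), ℂ)) = chi := by
    ext x
    cases x <;> simp [chi]
  rw [this]
  exact am_chi

end Generators

section Algebra

open Matrix Filter Topology
open scoped Matrix.Norms.L2Operator

variable {A : Type*} [Fintype A] [DecidableEq A] {n : ℕ}

theorem norm_iso_le : ‖iso A n‖ ≤ 1 := by
  refine le_of_sq_le_sq ?_ zero_le_one
  rw [sq, ← l2_opNorm_conjTranspose_mul_self, iso_conjTranspose_mul_self, one_pow, ← diagonal_one,
    l2_opNorm_diagonal, pi_norm_le_iff_of_nonneg zero_le_one]
  intro a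
  simp

theorem norm_diagonal_comp_le {P : Type*} [Fintype P] [DecidableEq P] (m : P → ℂ) {C : ℝ}
    (hC : 0 ≤ C) (h : ∀ p, ‖m p‖ ≤ C) : ‖(diagonal m : Matrix P P ℂ)‖ ≤ C := by
  rw [l2_opNorm_diagonal, pi_norm_le_iff_of_nonneg hC]
  exact h

theorem AM.add {g h : OnePoint (A → ℂ) → ℂ} (hg : AM g) (hh : AM h) :
    AM (fun x => g x + h x) := by
  intro ε hε
  filter_upwards [hg _ (half_pos hε), hh _ (half_pos hε)] with n ⟨S, hS⟩ ⟨T, hT⟩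
  refine ⟨S + T, ?_⟩
  have : ((diagonal fun p : Pos A n × Ang A n => g (spt p) + h (spt p)) * iso A n - iso A n * (S + T) : Matrix (Pos A n × Ang A n) (Lat A n) ℂ) =
      ((diagonal fun p : Pos A n × Ang A n => g (spt p)) * iso A n - iso A n * S) +
        ((diagonal fun p : Pos A n × Ang A n => h (spt p)) * iso A n - iso A n * T) := by
    rw [← diagonal_add, Matrix.add_mul, Matrix.mul_add]; abel
  rw [this]
  exact (norm_add_le _ _).trans (by linarith)

theorem AM.mul {g h : C(OnePoint (A → ℂ), ℂ)} (hg : AM g) (hh : AM h) :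
    AM (fun x => g x * h x) := by
  intro ε hε
  obtain ⟨C, hC⟩ := (isCompact_range g.continuous).isBounded.exists_norm_le
  obtain ⟨C', hC'⟩ := (isCompact_range h.continuous).isBounded.exists_norm_le
  have hC0 : 0 ≤ C := (norm_nonneg _).trans (hC _ ⟨OnePoint.infty, rfl⟩)
  have hC0' : 0 ≤ C' := (norm_nonneg _).trans (hC' _ ⟨OnePoint.infty, rfl⟩)
  set η : ℝ := min 1 (ε / (C + C' + 1)) with hη
  have hη0 : 0 < η := lt_min one_pos (by positivity)
  have hη1 : η ≤ 1 := min_le_left _ _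
  have hη2 : η * (C + C' + 1) ≤ ε := by
    rw [← le_div_iff₀ (by positivity)]; exact min_le_right _ _
  filter_upwards [hg _ hη0, hh _ hη0] with n ⟨S, hS⟩ ⟨T, hT⟩
  refine ⟨S * T, ?_⟩
  have hDg : ‖(diagonal fun p : Pos A n × Ang A n => g (spt p))‖ ≤ C :=
    norm_diagonal_comp_le _ hC0 fun p => hC _ ⟨_, rfl⟩
  have hDh : ‖(diagonal fun p : Pos A n × Ang A n => h (spt p))‖ ≤ C' :=
    norm_diagonal_comp_le _ hC0' fun p => hC' _ ⟨_, rfl⟩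
  have hTn : ‖T‖ ≤ C' + 1 := by
    have h1 : T = (iso A n)ᴴ * (iso A n * T) := by
      rw [← Matrix.mul_assoc, iso_conjTranspose_mul_self, Matrix.one_mul]
    have h2 : (iso A n * T : Matrix (Pos A n × Ang A n) (Lat A n) ℂ) = (diagonal fun p : Pos A n × Ang A n => h (spt p)) * iso A n -
      ((diagonal fun p : Pos A n × Ang A n => h (spt p)) * iso A n - iso A n * T) := by abel
    have h3 : ‖(iso A n * T : Matrix (Pos A n × Ang A n) (Lat A n) ℂ)‖ ≤ C' + 1 := by
      rw [h2]
      refine (norm_sub_le _ _).trans (add_le_add ?_ (hT.trans hη1))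
      refine (l2_opNorm_mul _ _).trans ?_
      nlinarith [norm_iso_le (A := A) (n := n), norm_nonneg (iso A n)]
    rw [h1]
    refine (l2_opNorm_mul _ _).trans ?_
    rw [l2_opNorm_conjTranspose]
    nlinarith [norm_iso_le (A := A) (n := n), norm_nonneg (iso A n), norm_nonneg (iso A n * T : Matrix (Pos A n × Ang A n) (Lat A n) ℂ)]
  have key : ((diagonal fun p : Pos A n × Ang A n => g (spt p) * h (spt p)) * iso A n - iso A n * (S * T) : Matrix (Pos A n × Ang A n) (Lat A n) ℂ) =
      (diagonal fun p : Pos A n × Ang A n => g (spt p)) * ((diagonal fun p : Pos A n × Ang A n => h (spt p)) * iso A n - iso A n * T) +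
        ((diagonal fun p : Pos A n × Ang A n => g (spt p)) * iso A n - iso A n * S) * T := by
    rw [← diagonal_mul_diagonal, Matrix.mul_sub, Matrix.sub_mul]
    simp only [Matrix.mul_assoc]
    abel
  rw [key]
  refine (norm_add_le _ _).trans ?_
  have b1 := (l2_opNorm_mul (diagonal fun p : Pos A n × Ang A n => g (spt p))
    ((diagonal fun p : Pos A n × Ang A n => h (spt p)) * iso A n - iso A n * T)).trans
      (mul_le_mul hDg hT (norm_nonneg _) hC0)
  have b2 := (l2_opNorm_mul ((diagonal fun p : Pos A n × Ang A n => g (spt p)) * iso A n - iso A n * S) T).trans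
      (mul_le_mul hS hTn (norm_nonneg _) hη0.le)
  nlinarith

theorem am_const (c : ℂ) : AM (fun _ : OnePoint (A → ℂ) => c) := by
  intro ε hε
  refine Eventually.of_forall fun n => ⟨c • (1 : Matrix _ _ ℂ), ?_⟩
  have : (diagonal fun _ : Pos A n × Ang A n => c) = c • (1 : Matrix _ _ ℂ) := by
    rw [smul_one_eq_diagonal]
  rw [this, Matrix.smul_mul, Matrix.mul_smul, Matrix.one_mul, Matrix.mul_one, sub_self, norm_zero]
  exact hε.le

/-- The algebra of approximate multipliers. -/
noncomputable def amAlg (A : Type*) [Fintype A] [DecidableEq A] :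
    StarSubalgebra ℂ C(OnePoint (A → ℂ), ℂ) where
  carrier := {h | AM h ∧ AM (star h : C(OnePoint (A → ℂ), ℂ))}
  mul_mem' := by
    rintro g h ⟨hg, hg'⟩ ⟨hh, hh'⟩
    refine ⟨hg.mul hh, ?_⟩
    rw [star_mul]
    exact hh'.mul hg'
  add_mem' := by
    rintro g h ⟨hg, hg'⟩ ⟨hh, hh'⟩
    refine ⟨hg.add hh, ?_⟩
    rw [star_add]
    exact hg'.add hh'
  algebraMap_mem' := fun c => ⟨am_const c, am_const (star c)⟩
  star_mem' := by
    rintro h ⟨h1, h2⟩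
    refine ⟨h2, ?_⟩
    rw [star_star]
    exact h1

theorem am_of_continuous (h : C(OnePoint (A → ℂ), ℂ)) : AM h := by
  have htop := topologicalClosure_eq_top_of_chi_mem (amAlg A) ⟨am_chi, am_star_chi⟩
    fun i => ⟨am_coo i, am_star_coo i⟩
  have hmem : h ∈ (amAlg A).topologicalClosure := htop ▸ StarSubalgebra.mem_top
  intro ε hε
  obtain ⟨g, hg, hgh⟩ := Metric.mem_closure_iff.1 hmem (ε / 2) (half_pos hε)
  filter_upwards [hg.1 _ (half_pos hε)] with n ⟨S, hS⟩
  refine ⟨S, ?_⟩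
  have : ((diagonal fun p : Pos A n × Ang A n => h (spt p)) * iso A n - iso A n * S : Matrix (Pos A n × Ang A n) (Lat A n) ℂ) =
      (diagonal fun p : Pos A n × Ang A n => h (spt p) - g (spt p)) * iso A n +
        ((diagonal fun p : Pos A n × Ang A n => g (spt p)) * iso A n - iso A n * S) := by
    rw [← diagonal_sub, Matrix.sub_mul]; abel
  rw [this]
  refine (norm_add_le _ _).trans ?_
  have h1 : ‖(diagonal fun p : Pos A n × Ang A n => h (spt p) - g (spt p))‖ ≤ ε / 2 := by
    refine norm_diagonal_comp_le _ (half_pos hε).le fun p => ?_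
    rw [← dist_eq_norm]
    exact (ContinuousMap.dist_apply_le_dist _).trans hgh.le
  have h2 := l2_opNorm_mul (diagonal fun p : Pos A n × Ang A n => h (spt p) - g (spt p)) (iso A n)
  nlinarith [norm_iso_le (A := A) (n := n), norm_nonneg (iso A n)]

end Algebra

section Quantization

open Matrix Filter Topology Kronecker
open scoped Matrix.Norms.L2Operator

/-- The operator attached to a matrix has a lower bound `δ`. -/
def Gap {X : Type*} [Fintype X] [DecidableEq X] (T : Matrix X X ℂ) (δ : ℝ) : Prop :=
  ∀ v : EuclideanSpace ℂ X, δ * ‖v‖ ≤ ‖toEuclideanLin T v‖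

variable {P ι : Type*} [Fintype P] [DecidableEq P] [Fintype ι] [DecidableEq ι]

/-- The block diagonal operator attached to an array of matrices. -/
def bd (h : P → Matrix ι ι ℂ) : Matrix (P × ι) (P × ι) ℂ :=
  of fun x y => if x.1 = y.1 then h x.1 x.2 y.2 else 0

/-- A component of a vector. -/
def cpt (v : EuclideanSpace ℂ (P × ι)) (p : P) : EuclideanSpace ℂ ι :=
  WithLp.toLp 2 fun μ => v (p, μ)

theorem norm_sq_eq_sum_cpt (v : EuclideanSpace ℂ (P × ι)) : ‖v‖ ^ 2 = ∑ p, ‖cpt v p‖ ^ 2 := by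
  simp only [EuclideanSpace.norm_sq_eq, Fintype.sum_prod_type, cpt]

theorem cpt_bd (h : P → Matrix ι ι ℂ) (v : EuclideanSpace ℂ (P × ι)) (p : P) :
    cpt (toEuclideanLin (bd h) v) p = toEuclideanLin (h p) (cpt v p) := by
  ext μ
  simp only [cpt, toEuclideanLin_apply, mulVec, dotProduct, bd, of_apply, Fintype.sum_prod_type,
    ite_mul, zero_mul]
  rw [Finset.sum_eq_single p]
  · simp
  · intro q _ hq
    simp [hq.symm]
  · simp

theorem gap_bd {h : P → Matrix ι ι ℂ} {δ : ℝ} (hδ : 0 ≤ δ) (hh : ∀ p, Gap (h p) δ) :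
    Gap (bd h) δ := by
  intro v
  refine le_of_sq_le_sq ?_ (norm_nonneg _)
  rw [mul_pow, norm_sq_eq_sum_cpt, norm_sq_eq_sum_cpt (toEuclideanLin (bd h) v), Finset.mul_sum]
  refine Finset.sum_le_sum fun p _ => ?_
  rw [cpt_bd, ← mul_pow]
  exact pow_le_pow_left₀ (by positivity) (hh p _) 2

theorem norm_toEuclideanLin_le {m n : Type*} [Fintype m] [Fintype n] [DecidableEq m]
    [DecidableEq n] (M : Matrix m n ℂ) (v : EuclideanSpace ℂ n) :
    ‖toEuclideanLin M v‖ ≤ ‖M‖ * ‖v‖ := l2_opNorm_mulVec M v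

theorem l2_opNorm_le_of_forall {m n : Type*} [Fintype m] [Fintype n] [DecidableEq m]
    [DecidableEq n] {M : Matrix m n ℂ} {C : ℝ} (hC : 0 ≤ C)
    (h : ∀ v : EuclideanSpace ℂ n, ‖toEuclideanLin M v‖ ≤ C * ‖v‖) : ‖M‖ ≤ C := by
  rw [l2_opNorm_def]
  exact ContinuousLinearMap.opNorm_le_bound _ hC h

theorem norm_bd_le {h : P → Matrix ι ι ℂ} {C : ℝ} (hC : 0 ≤ C) (hh : ∀ p, ‖h p‖ ≤ C) :
    ‖bd h‖ ≤ C := by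
  refine l2_opNorm_le_of_forall hC fun v => le_of_sq_le_sq ?_ (by positivity)
  rw [mul_pow, norm_sq_eq_sum_cpt, norm_sq_eq_sum_cpt v, Finset.mul_sum]
  refine Finset.sum_le_sum fun p _ => ?_
  rw [cpt_bd, ← mul_pow]
  refine pow_le_pow_left₀ (by positivity) ((norm_toEuclideanLin_le _ _).trans ?_) 2
  gcongr
  exact hh p

theorem norm_kronecker_single_le {L : Type*} [Fintype L] [DecidableEq L] (B : Matrix P L ℂ)
    (μ ν : ι) : ‖B ⊗ₖ (single μ ν (1 : ℂ))‖ ≤ ‖B‖ := by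
  refine l2_opNorm_le_of_forall (norm_nonneg _) fun v => ?_
  set u : EuclideanSpace ℂ L := WithLp.toLp 2 fun l => v (l, ν) with hu
  have h1 : ‖toEuclideanLin (B ⊗ₖ (single μ ν (1 : ℂ))) v‖ ^ 2 = ‖toEuclideanLin B u‖ ^ 2 := by
    simp only [EuclideanSpace.norm_sq_eq, Fintype.sum_prod_type]
    refine Finset.sum_congr rfl fun p _ => ?_
    have h2 : ∀ μ', (toEuclideanLin (B ⊗ₖ (single μ ν (1 : ℂ))) v) (p, μ') =
        if μ' = μ then (toEuclideanLin B u) p else 0 := by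
      intro μ'
      simp only [toEuclideanLin_apply, mulVec, dotProduct, kroneckerMap_apply,
        Fintype.sum_prod_type, hu]
      by_cases hμ : μ' = μ
      · subst hμ
        simp [single_apply]
      · simp [single_apply, hμ, Ne.symm hμ]
    simp only [h2]
    rw [Finset.sum_eq_single μ] <;> simp +contextual
  have h3 : ‖u‖ ≤ ‖v‖ := by
    refine le_of_sq_le_sq ?_ (norm_nonneg _)
    simp only [EuclideanSpace.norm_sq_eq, Fintype.sum_prod_type, hu]
    refine Finset.sum_le_sum fun l _ => ?_
    exact Finset.single_le_sum (f := fun ν => ‖v (l, ν)‖ ^ 2) (fun _ _ => sq_nonneg _)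
      (Finset.mem_univ ν)
  have h4 : ‖toEuclideanLin (B ⊗ₖ (single μ ν (1 : ℂ))) v‖ = ‖toEuclideanLin B u‖ :=
    (sq_eq_sq₀ (norm_nonneg _) (norm_nonneg _)).1 h1
  rw [h4]
  exact (norm_toEuclideanLin_le _ _).trans (by gcongr)

variable {A : Type*} [Fintype A] [DecidableEq A] {n : ℕ}

/-- The averaging isometry with coefficients. -/
noncomputable def isoM (A : Type*) [Fintype A] [DecidableEq A] (ι : Type*) [DecidableEq ι] (n : ℕ) :
    Matrix ((Pos A n × Ang A n) × ι) (Lat A n × ι) ℂ :=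
  iso A n ⊗ₖ (1 : Matrix ι ι ℂ)

theorem isoM_conjTranspose_mul_self : (isoM A ι n)ᴴ * isoM A ι n = 1 := by
  rw [isoM, conjTranspose_kronecker, ← mul_kronecker_mul, iso_conjTranspose_mul_self]
  simp

/-- The operator attached to an array of matrices by compression. -/
noncomputable def qz (h : Pos A n × Ang A n → Matrix ι ι ℂ) :
    Matrix (Lat A n × ι) (Lat A n × ι) ℂ :=
  (isoM A ι n)ᴴ * bd h * isoM A ι n

theorem qz_apply (h : Pos A n × Ang A n → Matrix ι ι ℂ) (a b : Lat A n) (μ ν : ι) :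
    qz h (a, μ) (b, ν) =
      ∑ p, starRingEnd ℂ (iso A n p a) * iso A n p b * h p μ ν := by
  rw [qz, Matrix.mul_assoc, mul_apply]
  simp only [mul_apply, Fintype.sum_prod_type, isoM, conjTranspose_apply, kroneckerMap_apply, bd,
    of_apply, one_apply, ite_mul, zero_mul]
  refine Finset.sum_congr rfl fun x _ => Finset.sum_congr rfl fun ξ _ => ?_
  rw [Finset.sum_eq_single μ (fun ν' _ h' => by simp [h']) (by simp)]
  simp only [if_true, mul_one]
  rw [Finset.sum_eq_single x, Finset.sum_eq_single ξ, Finset.sum_eq_single ν]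
  · simp; ring
  · intro ν' _ h'; simp [h']
  · simp
  · intro ξ' _ h'
    refine Finset.sum_eq_zero fun ν' _ => ?_
    simp [Ne.symm h']
  · simp
  · intro x' _ h'
    refine Finset.sum_eq_zero fun ξ' _ => Finset.sum_eq_zero fun ν' _ => ?_
    simp [Ne.symm h']
  · simp

theorem isHermitian_qz {h : Pos A n × Ang A n → Matrix ι ι ℂ} (hh : ∀ p, (h p).IsHermitian) :
    (qz h).IsHermitian := by
  refine IsHermitian.ext fun x y => ?_
  obtain ⟨a, μ⟩ := x
  obtain ⟨b, ν⟩ := y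
  rw [qz_apply, qz_apply, RCLike.star_def, map_sum]
  refine Finset.sum_congr rfl fun p _ => ?_
  have := (hh p).apply μ ν
  rw [RCLike.star_def] at this
  rw [map_mul, map_mul, this, Complex.conj_conj]
  ring

theorem bd_smul_add (h₀ h₁ : P → Matrix ι ι ℂ) (r s : ℂ) :
    bd (fun p => r • h₀ p + s • h₁ p) = r • bd h₀ + s • bd h₁ := by
  ext x y
  simp only [bd, of_apply, Matrix.add_apply, Matrix.smul_apply]
  split_ifs <;> simp

theorem qz_smul_add (h₀ h₁ : Pos A n × Ang A n → Matrix ι ι ℂ) (r s : ℂ) :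
    qz (fun p => r • h₀ p + s • h₁ p) = r • qz h₀ + s • qz h₁ := by
  rw [qz, bd_smul_add, Matrix.mul_add, Matrix.add_mul]
  simp [qz]

/-- The failure of an array to be preserved by the averaging isometry. -/
noncomputable def dev (h : Pos A n × Ang A n → Matrix ι ι ℂ) :
    Matrix ((Pos A n × Ang A n) × ι) (Lat A n × ι) ℂ :=
  bd h * isoM A ι n - isoM A ι n * qz h

theorem dev_smul_add (h₀ h₁ : Pos A n × Ang A n → Matrix ι ι ℂ) (r s : ℂ) :
    dev (fun p => r • h₀ p + s • h₁ p) = r • dev h₀ + s • dev h₁ := by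
  rw [dev, bd_smul_add, qz_smul_add, Matrix.mul_add, Matrix.add_mul]
  simp only [dev, Matrix.smul_mul, Matrix.mul_smul, smul_sub]
  abel

theorem norm_toEuclideanLin_isoM (v : EuclideanSpace ℂ (Lat A n × ι)) :
    ‖toEuclideanLin (isoM A ι n) v‖ = ‖v‖ := by
  refine (sq_eq_sq₀ (norm_nonneg _) (norm_nonneg _)).1 ?_
  have h : ∀ {m : Type _} [Fintype m] (u : EuclideanSpace ℂ m),
      ((‖u‖ ^ 2 : ℝ) : ℂ) = star (WithLp.ofLp u) ⬝ᵥ WithLp.ofLp u := by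
    intro m _ u
    rw [EuclideanSpace.norm_sq_eq]
    push_cast
    refine Finset.sum_congr rfl fun i _ => ?_
    rw [Pi.star_apply, RCLike.star_def, ← Complex.normSq_eq_conj_mul_self,
      Complex.normSq_eq_norm_sq]
    push_cast; rfl
  have h2 : ((‖toEuclideanLin (isoM A ι n) v‖ ^ 2 : ℝ) : ℂ) = ((‖v‖ ^ 2 : ℝ) : ℂ) := by
    rw [h, h, toEuclideanLin_apply, star_mulVec, dotProduct_mulVec, vecMul_vecMul,
      isoM_conjTranspose_mul_self, vecMul_one]
  exact_mod_cast h2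

theorem norm_isoM_le : ‖isoM A ι n‖ ≤ 1 :=
  l2_opNorm_le_of_forall zero_le_one fun v => by rw [norm_toEuclideanLin_isoM, one_mul]

theorem gap_qz {h : Pos A n × Ang A n → Matrix ι ι ℂ} {δ ε : ℝ} (hδ : 0 ≤ δ)
    (hh : ∀ p, Gap (h p) δ) (hε : ‖dev h‖ ≤ ε) : Gap (qz h) (δ - ε) := by
  intro v
  have h1 := gap_bd hδ hh (toEuclideanLin (isoM A ι n) v)
  rw [norm_toEuclideanLin_isoM] at h1
  have h2 := norm_toEuclideanLin_le (dev h) v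
  have h3 : toEuclideanLin (dev h) v = toEuclideanLin (bd h) (toEuclideanLin (isoM A ι n) v) -
      toEuclideanLin (isoM A ι n) (toEuclideanLin (qz h) v) := by
    simp only [dev, toEuclideanLin_apply, sub_mulVec, mulVec_mulVec]
    rfl
  have h4 := norm_sub_norm_le (toEuclideanLin (bd h) (toEuclideanLin (isoM A ι n) v))
    (toEuclideanLin (isoM A ι n) (toEuclideanLin (qz h) v))
  rw [← h3, norm_toEuclideanLin_isoM] at h4
  have h5 : ‖dev h‖ * ‖v‖ ≤ ε * ‖v‖ := by gcongr
  linarith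

theorem norm_qz_le {h : Pos A n × Ang A n → Matrix ι ι ℂ} {C : ℝ} (hC : 0 ≤ C)
    (hh : ∀ p, ‖h p‖ ≤ C) : ‖qz h‖ ≤ C := by
  have h1 := norm_isoM_le (A := A) (ι := ι) (n := n)
  have h2 := norm_bd_le hC hh
  refine (l2_opNorm_mul _ _).trans ?_
  have h3 : ‖(isoM A ι n)ᴴ * bd h‖ ≤ C := by
    refine (l2_opNorm_mul _ _).trans ?_
    rw [l2_opNorm_conjTranspose]
    nlinarith [norm_nonneg (isoM A ι n), norm_nonneg (bd h)]
  nlinarith [norm_nonneg (isoM A ι n), norm_nonneg ((isoM A ι n)ᴴ * bd h)]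

theorem eventually_norm_dev_le {H : OnePoint (A → ℂ) → Matrix ι ι ℂ} (hH : Continuous H) {ε : ℝ}
    (hε : 0 < ε) : ∀ᶠ n in atTop,
      ‖dev (fun p : Pos A n × Ang A n => H (spt p))‖ ≤ ε := by
  set c : ℝ := ((Fintype.card ι : ℝ) ^ 2 + 1) with hc
  have hc0 : 0 < c := by positivity
  have hcont : ∀ μ ν, Continuous fun x => H x μ ν := fun μ ν => by
    exact (continuous_apply_apply μ ν).comp hH
  have hev : ∀ᶠ n in atTop, ∀ μ ν, ∃ S : Matrix (Lat A n) (Lat A n) ℂ,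
      ‖(diagonal (fun p : Pos A n × Ang A n => H (spt p) μ ν) * iso A n - iso A n * S :
        Matrix (Pos A n × Ang A n) (Lat A n) ℂ)‖ ≤ ε / (2 * c) := by
    rw [eventually_all]
    intro μ
    rw [eventually_all]
    intro ν
    exact am_of_continuous ⟨_, hcont μ ν⟩ _ (by positivity)
  filter_upwards [hev] with n hn
  choose S hS using hn
  set h : Pos A n × Ang A n → Matrix ι ι ℂ := fun p => H (spt p) with hh
  set S' : Matrix (Lat A n × ι) (Lat A n × ι) ℂ := ∑ μ, ∑ ν, S μ ν ⊗ₖ single μ ν (1 : ℂ) with hS'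
  have hbd : bd h = ∑ μ, ∑ ν, diagonal (fun p => h p μ ν) ⊗ₖ single μ ν (1 : ℂ) := by
    ext ⟨p, μ⟩ ⟨q, ν⟩
    simp only [bd, of_apply, Matrix.sum_apply, kroneckerMap_apply, single_apply, diagonal_apply]
    rw [Finset.sum_eq_single μ, Finset.sum_eq_single ν]
    · simp
    · intro b _ hb; simp [hb]
    · simp
    · intro b _ hb; simp [hb]
    · simp
  have hR : bd h * isoM A ι n - isoM A ι n * S' = ∑ μ, ∑ ν,
      (diagonal (fun p => h p μ ν) * iso A n - iso A n * S μ ν :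
        Matrix (Pos A n × Ang A n) (Lat A n) ℂ) ⊗ₖ single μ ν (1 : ℂ) := by
    rw [hbd, hS', Matrix.sum_mul, Matrix.mul_sum, ← Finset.sum_sub_distrib]
    refine Finset.sum_congr rfl fun μ _ => ?_
    rw [Matrix.sum_mul, Matrix.mul_sum, ← Finset.sum_sub_distrib]
    refine Finset.sum_congr rfl fun ν _ => ?_
    rw [isoM, ← mul_kronecker_mul, ← mul_kronecker_mul, Matrix.one_mul, Matrix.mul_one]
    ext x y
    simp only [Matrix.sub_apply, kroneckerMap_apply, sub_mul]
  have hRn : ‖(bd h * isoM A ι n - isoM A ι n * S' :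
      Matrix ((Pos A n × Ang A n) × ι) (Lat A n × ι) ℂ)‖ ≤ ε / 2 := by
    rw [hR]
    have h1 : ∀ μ ν, ‖(diagonal (fun p => h p μ ν) * iso A n - iso A n * S μ ν :
        Matrix (Pos A n × Ang A n) (Lat A n) ℂ) ⊗ₖ single μ ν (1 : ℂ)‖ ≤ ε / (2 * c) :=
      fun μ ν => (norm_kronecker_single_le _ _ _).trans (hS μ ν)
    refine (norm_sum_le _ _).trans ((Finset.sum_le_sum fun μ _ => (norm_sum_le _ _).trans
      (Finset.sum_le_sum fun ν _ => h1 μ ν)).trans ?_)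
    simp only [Finset.sum_const, Finset.card_univ, nsmul_eq_mul]
    have h2 : (Fintype.card ι : ℝ) ^ 2 ≤ c := by rw [hc]; linarith
    have h3 : 0 < ε / (2 * c) := by positivity
    have h4 : c * (ε / (2 * c)) = ε / 2 := by field_simp
    nlinarith
  set R : Matrix ((Pos A n × Ang A n) × ι) (Lat A n × ι) ℂ :=
    bd h * isoM A ι n - isoM A ι n * S' with hRdef
  have hdev : dev h = R - isoM A ι n * ((isoM A ι n)ᴴ * R) := by
    have h1 : (isoM A ι n)ᴴ * R = qz h - S' := by
      rw [hRdef, Matrix.mul_sub, ← Matrix.mul_assoc, ← Matrix.mul_assoc,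
        isoM_conjTranspose_mul_self, Matrix.one_mul, qz]
    rw [h1, hRdef, dev, Matrix.mul_sub]
    abel
  rw [hdev]
  refine (norm_sub_le _ _).trans ?_
  have h1 := norm_isoM_le (A := A) (ι := ι) (n := n)
  have h2 : ‖(isoM A ι n)ᴴ * R‖ ≤ ‖R‖ := by
    refine (l2_opNorm_mul _ _).trans ?_
    rw [l2_opNorm_conjTranspose]
    nlinarith [norm_nonneg (isoM A ι n), norm_nonneg R]
  have h3 : ‖isoM A ι n * ((isoM A ι n)ᴴ * R)‖ ≤ ‖R‖ := by
    refine (l2_opNorm_mul _ _).trans ?_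
    nlinarith [norm_nonneg (isoM A ι n), norm_nonneg ((isoM A ι n)ᴴ * R)]
  linarith

end Quantization

section Index

open Matrix Module
open scoped Matrix.Norms.L2Operator

variable {X Y Z : Type*} [Fintype X] [DecidableEq X] [Fintype Y] [DecidableEq Y]
  [Fintype Z] [DecidableEq Z]

/-- Vectors supported on `P`. -/
def vsupp (P : Set X) : Submodule ℂ (EuclideanSpace ℂ X) where
  carrier := {v | ∀ x, x ∉ P → v x = 0}
  add_mem' := fun {u v} hu hv x hx => by simp [hu x hx, hv x hx]
  zero_mem' := fun x _ => rfl
  smul_mem' := fun c v hv x hx => by simp [hv x hx]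

/-- The positive index of inertia of a matrix on a set of indices. -/
noncomputable def idx (T : Matrix X X ℂ) (P : Set X) : ℕ :=
  posIndex (qform (toEuclideanLin T)) (vsupp P)

/-- The matrix does not couple `P` to its complement. -/
def Decoup (T : Matrix X X ℂ) (P : Set X) : Prop := ∀ x y, T x y ≠ 0 → (x ∈ P ↔ y ∈ P)

theorem toEuclideanLin_apply_apply (T : Matrix X Y ℂ) (v : EuclideanSpace ℂ Y) (x : X) :
    toEuclideanLin T v x = ∑ y, T x y * v y := rfl

theorem Decoup.mapsTo {T : Matrix X X ℂ} {P : Set X} (h : Decoup T P) :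
    ∀ v ∈ vsupp P, toEuclideanLin T v ∈ vsupp P := by
  intro v hv x hx
  rw [toEuclideanLin_apply_apply]
  refine Finset.sum_eq_zero fun y _ => ?_
  by_cases hT : T x y = 0
  · rw [hT, zero_mul]
  · rw [hv y fun hy => hx ((h x y hT).2 hy), mul_zero]

theorem isSymmetric_of_isHermitian {T : Matrix X X ℂ} (hT : T.IsHermitian) :
    (toEuclideanLin T).IsSymmetric := isHermitian_iff_isSymmetric.1 hT

theorem hasSplit_idx {T : Matrix X X ℂ} {P : Set X} {δ : ℝ} (hT : T.IsHermitian)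
    (hP : Decoup T P) (hδ : 0 < δ) (hg : Gap T δ) :
    HasSplit (qform (toEuclideanLin T)) (vsupp P) δ (idx T P) := by
  obtain ⟨d, hd⟩ := exists_hasSplit _ (isSymmetric_of_isHermitian hT) hP.mapsTo
    (fun v _ => hg v)
  rwa [idx, hd.posIndex_eq hδ]

theorem vsupp_union (P Q : Set X) : vsupp (P ∪ Q) = vsupp P ⊔ vsupp Q := by
  classical
  refine le_antisymm (fun v hv => ?_) (sup_le ?_ ?_)
  · refine Submodule.mem_sup.2 ⟨WithLp.toLp 2 fun x => if x ∈ P then v x else 0, ?_,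
      WithLp.toLp 2 fun x => if x ∈ P then 0 else v x, ?_, ?_⟩
    · intro x hx; simp [hx]
    · intro x hx
      by_cases h : x ∈ P
      · simp [h]
      · simpa [h] using hv x (by simp [h, hx])
    · ext x
      by_cases h : x ∈ P <;> simp [h]
  · exact fun v hv x hx => hv x fun h => hx (Or.inl h)
  · exact fun v hv x hx => hv x fun h => hx (Or.inr h)

theorem idx_union {T : Matrix X X ℂ} {P Q : Set X} {δ : ℝ} (hT : T.IsHermitian)
    (hP : Decoup T P) (hQ : Decoup T Q) (hPQ : Disjoint P Q) (hδ : 0 < δ) (hg : Gap T δ) :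
    idx T (P ∪ Q) = idx T P + idx T Q := by
  have hort : ∀ u ∈ vsupp P, ∀ v ∈ vsupp Q, inner ℂ u v = 0 := by
    intro u hu v hv
    rw [PiLp.inner_apply]
    refine Finset.sum_eq_zero fun x _ => ?_
    by_cases hx : x ∈ P
    · rw [hv x (Set.disjoint_left.1 hPQ hx), inner_zero_right]
    · rw [hu x hx, inner_zero_left]
  have h := (hasSplit_idx hT hP hδ hg).sup (hasSplit_idx hT hQ hδ hg) ?_ hort
  · rw [← vsupp_union] at h
    exact h.posIndex_eq hδ
  · intro u hu v hv
    have h1 := hort u hu _ (hQ.mapsTo v hv)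
    have h2 := hort _ (hP.mapsTo u hu) v hv
    have h3 : inner ℂ v (toEuclideanLin T u) = 0 := by rw [← inner_conj_symm, h2, map_zero]
    simp [qform, inner_add_left, inner_add_right, h1, h3]

theorem finrank_vsupp (P : Set X) : finrank ℂ (vsupp P) = P.ncard := by
  classical
  have e : vsupp P ≃ₗ[ℂ] (P → ℂ) :=
    { toFun := fun v x => v.1 x
      map_add' := fun _ _ => rfl
      map_smul' := fun _ _ => rfl
      invFun := fun u => ⟨WithLp.toLp 2 fun x => if h : x ∈ P then u ⟨x, h⟩ else 0,
        fun x hx => by simp [hx]⟩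
      left_inv := fun v => by
        ext x
        by_cases h : x ∈ P
        · simp [h]
        · simp [h, v.2 x h]
      right_inv := fun u => by ext x; simp }
  rw [e.finrank_eq, finrank_fintype_fun_eq_card, ← Nat.card_eq_fintype_card, Nat.card_coe_set_eq]

theorem idx_eq_of_norm_sub_le {S T : Matrix X X ℂ} {P : Set X} {δ ε : ℝ} (hT : T.IsHermitian)
    (hP : Decoup T P) (hg : Gap T δ) (hε : ‖S - T‖ ≤ ε) (hδ : ε < δ) : idx S P = idx T P := by
  have h0 : 0 < δ := ((norm_nonneg _).trans hε).trans_lt hδ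
  refine ((hasSplit_idx hT hP h0 hg).perturb (q' := qform (toEuclideanLin S)) (ε := ε)
    fun v _ => abs_qform_sub_le _ _ ?_).posIndex_eq (by linarith)
  rw [← LinearMap.sub_apply, ← map_sub]
  exact (norm_toEuclideanLin_le _ _).trans (by gcongr)

/-- Extension by zero along an injection. -/
noncomputable def extendLI (φ : Z ↪ X) : EuclideanSpace ℂ Z →ₗᵢ[ℂ] EuclideanSpace ℂ X where
  toFun v := WithLp.toLp 2 (Function.extend φ v 0)
  map_add' u v := by
    ext x
    by_cases h : ∃ z, φ z = x
    · obtain ⟨z, rfl⟩ := h; simp [φ.injective.extend_apply]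
    · simp [Function.extend_apply' _ _ _ h]
  map_smul' c v := by
    ext x
    by_cases h : ∃ z, φ z = x
    · obtain ⟨z, rfl⟩ := h; simp [φ.injective.extend_apply]
    · simp [Function.extend_apply' _ _ _ h]
  norm_map' v := by
    refine (sq_eq_sq₀ (norm_nonneg _) (norm_nonneg _)).1 ?_
    simp only [EuclideanSpace.norm_sq_eq]
    symm
    refine Finset.sum_of_injOn φ φ.injective.injOn (by simp) (fun x _ hx => ?_) (fun z _ => ?_)
    · have : ¬∃ z, φ z = x := fun ⟨z, hz⟩ => hx (by simp [← hz])
      simp [Function.extend_apply' _ _ _ this]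
    · simp [φ.injective.extend_apply]

theorem extendLI_apply (φ : Z ↪ X) (v : EuclideanSpace ℂ Z) (z : Z) :
    extendLI φ v (φ z) = v z := φ.injective.extend_apply _ _ _

theorem extendLI_apply_of_notMem (φ : Z ↪ X) (v : EuclideanSpace ℂ Z) {x : X}
    (hx : x ∉ Set.range φ) : extendLI φ v x = 0 := Function.extend_apply' _ _ _ hx

theorem map_extendLI (φ : Z ↪ X) :
    (⊤ : Submodule ℂ (EuclideanSpace ℂ Z)).map (extendLI φ).toLinearMap =
      vsupp (Set.range φ) := by
  ext v
  constructor
  · rintro ⟨u, -, rfl⟩ x hx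
    exact extendLI_apply_of_notMem φ u hx
  · intro hv
    refine ⟨WithLp.toLp 2 fun z => v (φ z), trivial, ?_⟩
    ext x
    by_cases h : x ∈ Set.range φ
    · obtain ⟨z, rfl⟩ := h; exact extendLI_apply φ _ z
    · rw [hv x h]; exact extendLI_apply_of_notMem φ _ h

theorem toEuclideanLin_extendLI (T : Matrix X X ℂ) (φ : Z ↪ X) (v : EuclideanSpace ℂ Z) (x : X) :
    toEuclideanLin T (extendLI φ v) x = ∑ z, T x (φ z) * v z := by
  rw [toEuclideanLin_apply_apply]
  symm
  refine Finset.sum_of_injOn φ φ.injective.injOn (by simp) (fun x _ hx => ?_) (fun z _ => ?_)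
  · rw [extendLI_apply_of_notMem, mul_zero]
    simpa using hx
  · rw [extendLI_apply]

theorem qform_extendLI (T : Matrix X X ℂ) (φ : Z ↪ X) (v : EuclideanSpace ℂ Z) :
    qform (toEuclideanLin T) (extendLI φ v) = qform (toEuclideanLin (T.submatrix φ φ)) v := by
  unfold qform
  congr 1
  rw [PiLp.inner_apply, PiLp.inner_apply]
  symm
  refine Finset.sum_of_injOn φ φ.injective.injOn (by simp) (fun x _ hx => ?_) (fun z _ => ?_)
  · rw [extendLI_apply_of_notMem φ v (by simpa using hx), inner_zero_left]
  · rw [extendLI_apply, toEuclideanLin_extendLI]; rfl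

theorem hasSplit_submatrix {T : Matrix X X ℂ} {φ : Z ↪ X} {δ : ℝ} (hT : T.IsHermitian)
    (hP : Decoup T (Set.range φ)) (hδ : 0 < δ) (hg : Gap T δ) :
    HasSplit (qform (toEuclideanLin (T.submatrix φ φ))) ⊤ δ (idx T (Set.range φ)) := by
  obtain ⟨d, hd⟩ := exists_hasSplit (toEuclideanLin (T.submatrix φ φ)) (U := ⊤) (δ := δ)
    (isSymmetric_of_isHermitian (hT.submatrix φ)) (fun _ _ => trivial) (fun v _ => by
      have h := hg (extendLI φ v)
      rw [LinearIsometry.norm_map] at h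
      refine h.trans (le_of_eq ?_)
      rw [← (extendLI φ).norm_map (toEuclideanLin (T.submatrix φ φ) v)]
      congr 1
      ext x
      by_cases hx : x ∈ Set.range φ
      · obtain ⟨z, rfl⟩ := hx
        rw [extendLI_apply, toEuclideanLin_extendLI]; rfl
      · rw [extendLI_apply_of_notMem φ _ hx, toEuclideanLin_extendLI]
        refine Finset.sum_eq_zero fun z _ => ?_
        by_contra h
        exact hx ((hP _ _ (left_ne_zero_of_mul h)).2 ⟨z, rfl⟩))
  have h2 := hd.map (q' := qform (toEuclideanLin T)) (extendLI φ)
    (fun v _ => qform_extendLI T φ v)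
  rw [map_extendLI] at h2
  rwa [idx, h2.posIndex_eq hδ]

theorem idx_eq_of_submatrix_eq {T : Matrix X X ℂ} {S : Matrix Y Y ℂ} {φ : Z ↪ X} {ψ : Z ↪ Y}
    {δ : ℝ} (hT : T.IsHermitian) (hP : Decoup T (Set.range φ)) (hδ : 0 < δ) (hg : Gap T δ)
    (h : S.submatrix ψ ψ = T.submatrix φ φ) : idx S (Set.range ψ) = idx T (Set.range φ) := by
  have h1 := hasSplit_submatrix hT hP hδ hg
  rw [← h] at h1
  have h2 := h1.map (q' := qform (toEuclideanLin S)) (extendLI ψ)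
    (fun v _ => qform_extendLI S ψ v)
  rw [map_extendLI] at h2
  exact h2.posIndex_eq hδ

theorem idx_image_eq {T : Matrix X X ℂ} {S : Matrix Y Y ℂ} {P : Set Y} {φ : Y → X}
    {δ : ℝ} (hT : T.IsHermitian) (hP : Decoup T (φ '' P)) (hδ : 0 < δ) (hg : Gap T δ)
    (hφ : Set.InjOn φ P) (h : ∀ y ∈ P, ∀ y' ∈ P, S y y' = T (φ y) (φ y')) :
    idx S P = idx T (φ '' P) := by
  classical
  have h1 : Set.range (⟨fun y : P => φ y, hφ.injective⟩ : P ↪ X) = φ '' P := by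
    rw [Set.image_eq_range]; rfl
  have h2 : Set.range (Function.Embedding.subtype (· ∈ P)) = P := Subtype.range_coe
  rw [← h1] at hP
  have := idx_eq_of_submatrix_eq (S := S) (ψ := Function.Embedding.subtype (· ∈ P)) hT hP hδ hg
    (by ext y y'; exact h y y.2 y' y'.2)
  rwa [h1, h2] at this

theorem idx_neg {T : Matrix X X ℂ} {P : Set X} {δ : ℝ} (hT : T.IsHermitian)
    (hP : Decoup T P) (hδ : 0 < δ) (hg : Gap T δ) : idx T P + idx (-T) P = P.ncard := by
  have h1 := hasSplit_idx hT hP hδ hg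
  have h2 := h1.le
  have h3 := (h1.neg.congr (q' := qform (toEuclideanLin (-T))) fun v _ => by
    simp [qform]).posIndex_eq hδ
  rw [finrank_vsupp] at h2 h3
  rw [idx, idx] at *
  omega

theorem idx_eq_ncard_of_diagonal {T : Matrix X X ℂ} {P : Set X} {d : X → ℝ}
    (hd : ∀ x, d x = 1 ∨ d x = -1) (hT : ∀ x ∈ P, ∀ y ∈ P, T x y = if x = y then (d x : ℂ) else 0) :
    idx T P = {x ∈ P | d x = 1}.ncard := by
  have hq : ∀ v ∈ vsupp P, qform (toEuclideanLin T) v = ∑ x, d x * ‖v x‖ ^ 2 := by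
    intro v hv
    rw [qform, PiLp.inner_apply, Complex.re_sum]
    refine Finset.sum_congr rfl fun x _ => ?_
    by_cases hx : x ∈ P
    · have h1 : toEuclideanLin T v x = d x * v x := by
        rw [toEuclideanLin_apply_apply, Finset.sum_eq_single x]
        · rw [hT x hx x hx, if_pos rfl]
        · intro y _ hy
          by_cases hyP : y ∈ P
          · rw [hT x hx y hyP, if_neg hy.symm, zero_mul]
          · rw [hv y hyP, mul_zero]
        · simp
      rw [h1, RCLike.inner_apply, mul_assoc, Complex.mul_conj, Complex.normSq_eq_norm_sq,
        ← Complex.ofReal_mul, Complex.ofReal_re]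
    · rw [hv x hx]; simp
  have hsub : ∀ Q ⊆ P, vsupp Q ≤ vsupp P := fun Q hQ v hv x hx => hv x fun h => hx (hQ h)
  have h : HasSplit (qform (toEuclideanLin T)) (vsupp P) 1 {x ∈ P | d x = 1}.ncard := by
    refine ⟨vsupp {x ∈ P | d x = 1}, vsupp {x ∈ P | d x = -1}, hsub _ fun x hx => hx.1,
      hsub _ fun x hx => hx.1, fun v hv => ?_, fun v hv => ?_, finrank_vsupp _, ?_⟩
    · rw [hq v (hsub _ (fun x hx => hx.1) hv), one_mul, EuclideanSpace.norm_sq_eq]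
      refine Finset.sum_le_sum fun x _ => ?_
      by_cases hx : x ∈ {x ∈ P | d x = 1}
      · rw [hx.2, one_mul]
      · rw [hv x hx]; simp
    · rw [hq v (hsub _ (fun x hx => hx.1) hv), one_mul, EuclideanSpace.norm_sq_eq,
        ← Finset.sum_neg_distrib]
      refine Finset.sum_le_sum fun x _ => ?_
      by_cases hx : x ∈ {x ∈ P | d x = -1}
      · rw [hx.2]; linarith
      · rw [hv x hx]; simp
    · rw [finrank_vsupp, finrank_vsupp, finrank_vsupp, ← Set.ncard_union_eq]
      · congr 1
        ext x
        have := hd x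
        simp only [Set.mem_union, Set.mem_setOf_eq]
        tauto
      · rw [Set.disjoint_left]
        rintro x ⟨-, h1⟩ ⟨-, h2⟩
        rw [h1] at h2; norm_num at h2
  exact h.posIndex_eq one_pos

theorem idx_congr_homotopy {T₀ T₁ : Matrix X X ℂ} {P : Set X} {δ : ℝ} (h₀ : T₀.IsHermitian)
    (h₁ : T₁.IsHermitian) (hP₀ : Decoup T₀ P) (hP₁ : Decoup T₁ P) (hδ : 0 < δ)
    (hg : ∀ t : ℝ, 0 ≤ t → t ≤ 1 → Gap (((1 - t : ℝ) : ℂ) • T₀ + (t : ℂ) • T₁) δ) :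
    idx T₀ P = idx T₁ P :=
  exists_hasSplit_of_homotopy _ _ (isSymmetric_of_isHermitian h₀) (isSymmetric_of_isHermitian h₁)
    hP₀.mapsTo hP₁.mapsTo hδ fun t ht0 ht1 v _ => by
      have := hg t ht0 ht1 v
      rwa [map_add, _root_.map_smul, _root_.map_smul] at this

end Index

section Symbol

open Matrix Filter Topology
open scoped Matrix.Norms.L2Operator

variable {X : Type*} [Fintype X] [DecidableEq X]

theorem Decoup.inter {T : Matrix X X ℂ} {P Q : Set X} (hP : Decoup T P) (hQ : Decoup T Q) :
    Decoup T (P ∩ Q) := fun x y h => and_congr (hP x y h) (hQ x y h)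

theorem Decoup.compl {T : Matrix X X ℂ} {P : Set X} (hP : Decoup T P) : Decoup T Pᶜ :=
  fun x y h => not_congr (hP x y h)

theorem idx_congr {S T : Matrix X X ℂ} {P : Set X} (h : ∀ x ∈ P, ∀ y ∈ P, S x y = T x y) :
    idx S P = idx T P := by
  have hq : ∀ v ∈ vsupp P, qform (toEuclideanLin S) v = qform (toEuclideanLin T) v := by
    intro v hv
    rw [qform, qform, PiLp.inner_apply, PiLp.inner_apply]
    congr 1
    refine Finset.sum_congr rfl fun x _ => ?_
    by_cases hx : x ∈ P
    · congr 1
      rw [toEuclideanLin_apply_apply, toEuclideanLin_apply_apply]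
      refine Finset.sum_congr rfl fun y _ => ?_
      by_cases hy : y ∈ P
      · rw [h x hx y hy]
      · rw [hv y hy, mul_zero, mul_zero]
    · rw [hv x hx, inner_zero_left, inner_zero_left]
  unfold idx posIndex
  congr 1
  ext d
  constructor
  · rintro ⟨E, hE, hp, hd⟩
    exact ⟨E, hE, fun v hv h0 => hq v (hE hv) ▸ hp v hv h0, hd⟩
  · rintro ⟨E, hE, hp, hd⟩
    exact ⟨E, hE, fun v hv h0 => (hq v (hE hv)).symm ▸ hp v hv h0, hd⟩

theorem idx_split {T : Matrix X X ℂ} {P Q : Set X} {δ : ℝ} (hT : T.IsHermitian)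
    (hP : Decoup T P) (hQ : Decoup T Q) (hδ : 0 < δ) (hg : Gap T δ) :
    idx T P = idx T (P ∩ Q) + idx T (P ∩ Qᶜ) := by
  rw [← idx_union hT (hP.inter hQ) (hP.inter hQ.compl) _ hδ hg, ← Set.inter_union_distrib_left,
    Set.union_compl_self, Set.inter_univ]
  exact Set.disjoint_left.2 fun x h1 h2 => h2.2 h1.2

/-- The faithful character of `ℤ/4`. -/
noncomputable def ic (t : ZMod 4) : ℂ := ZMod.stdAddChar t

theorem ic_add (s t : ZMod 4) : ic (s + t) = ic s * ic t := AddChar.map_add_eq_mul _ _ _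

theorem ic_zero : ic 0 = 1 := AddChar.map_zero_eq_one _

theorem ic_eq_one {t : ZMod 4} (h : ic t = 1) : t = 0 :=
  ZMod.injective_stdAddChar (h.trans ic_zero.symm)

theorem norm_ic (t : ZMod 4) : ‖ic t‖ = 1 := by
  rw [ic, ZMod.stdAddChar_apply, Circle.norm_coe]

variable {A ι : Type*} [Fintype A] [DecidableEq A] [Fintype ι] [DecidableEq ι] {n : ℕ}

/-- The total degree. -/
def gr (e : A → ZMod 4) (w : ι → ZMod 4) (x : Lat A n × ι) : ZMod 4 :=
  ∑ i, e i * ((x.1 i : ℕ) : ZMod 4) + w x.2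

/-- The action of the generator with weights `e`. -/
noncomputable def rot (e : A → ZMod 4) : OnePoint (A → ℂ) → OnePoint (A → ℂ) :=
  OnePoint.map fun z i => ic (e i) * z i

/-- Equivariant Hermitian matrix-valued functions with a spectral gap. -/
structure IsSymbol (e : A → ZMod 4) (w : ι → ZMod 4) (H : OnePoint (A → ℂ) → Matrix ι ι ℂ)
    (δ : ℝ) : Prop where
  cont : Continuous H
  herm : ∀ x, (H x).IsHermitian
  pos : 0 < δ
  gap : ∀ x, Gap (H x) δ
  eqv : ∀ x μ ν, H (rot e x) μ ν = ic (w μ - w ν) * H x μ ν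

/-- The operator attached to a symbol. -/
noncomputable def qs (H : OnePoint (A → ℂ) → Matrix ι ι ℂ) (n : ℕ) :
    Matrix (Lat A n × ι) (Lat A n × ι) ℂ :=
  qz fun p : Pos A n × Ang A n => H (spt p)

theorem iso_apply (p : Pos A n × Ang A n) (a : Lat A n) :
    iso A n p a = ((bw n : ℂ) ^ Fintype.card A)⁻¹ * (if InBox p.1 a then 1 else 0) *
      pair (-p.2) (red a) := rfl

theorem inBox_of_iso_ne_zero {p : Pos A n × Ang A n} {a : Lat A n} (h : iso A n p a ≠ 0) :
    InBox p.1 a := by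
  by_contra h'
  exact h (by rw [iso_apply, if_neg h', mul_zero, zero_mul])

theorem qz_apply_of_const {h : Pos A n × Ang A n → Matrix ι ι ℂ} {a b : Lat A n} {μ ν : ι} {c : ℂ}
    (hc : ∀ x ξ, InBox x a → InBox x b → h (x, ξ) μ ν = c) :
    qz h (a, μ) (b, ν) = if a = b then c else 0 := by
  have h1 : qz h (a, μ) (b, ν) = (∑ p, starRingEnd ℂ (iso A n p a) * iso A n p b) * c := by
    rw [qz_apply, Finset.sum_mul]
    refine Finset.sum_congr rfl fun p _ => ?_
    by_cases h0 : starRingEnd ℂ (iso A n p a) * iso A n p b = 0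
    · rw [h0, zero_mul, zero_mul]
    · rw [← hc p.1 p.2 (inBox_of_iso_ne_zero fun h' => h0 (by rw [h']; simp))
        (inBox_of_iso_ne_zero (right_ne_zero_of_mul h0))]
  have h2 := congrFun (congrFun (iso_conjTranspose_mul_self (A := A) (n := n)) a) b
  rw [mul_apply, one_apply] at h2
  simp only [conjTranspose_apply, RCLike.star_def] at h2
  rw [h1, h2]
  split_ifs <;> simp

theorem iso_add (x : Pos A n) (ξ η : Ang A n) (a : Lat A n) :
    iso A n (x, ξ + η) a = pair (-η) (red a) * iso A n (x, ξ) a := by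
  rw [iso_apply, iso_apply]
  simp only [neg_add, pair_add_left]
  ring

theorem qz_eq_zero_of_twist {h : Pos A n × Ang A n → Matrix ι ι ℂ} {a b : Lat A n} {μ ν : ι} {c : ℂ}
    (η : Ang A n) (hc : ∀ x ξ, InBox x a → InBox x b → h (x, ξ + η) μ ν = c * h (x, ξ) μ ν)
    (hne : c * pair η (red a - red b) ≠ 1) : qz h (a, μ) (b, ν) = 0 := by
  have key : qz h (a, μ) (b, ν) = c * pair η (red a - red b) * qz h (a, μ) (b, ν) := by
    rw [qz_apply, Fintype.sum_prod_type, Finset.mul_sum]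
    refine Finset.sum_congr rfl fun x _ => ?_
    conv_lhs => rw [← Equiv.sum_comp (Equiv.addRight η)]
    rw [Finset.mul_sum]
    refine Finset.sum_congr rfl fun ξ _ => ?_
    simp only [Equiv.coe_addRight]
    by_cases ha : InBox x a
    · by_cases hb : InBox x b
      · rw [hc x ξ ha hb, iso_add, iso_add, map_mul, conj_pair, neg_neg, sub_eq_add_neg,
          pair_add_right, pair_neg_right]
        ring
      · have : ∀ ξ, iso A n (x, ξ) b = 0 := fun ξ => by rw [iso_apply, if_neg hb]; simp
        simp [this]
    · have : ∀ ξ, iso A n (x, ξ) a = 0 := fun ξ => by rw [iso_apply, if_neg ha]; simp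
      simp [this]
  by_contra h0
  exact hne (mul_right_cancel₀ h0 (by rw [← key, one_mul]))

theorem toCircle_mul_natCast (k n : ℕ) :
    ZMod.toCircle ((k * (n + 1) : ℕ) : ZMod (bw n)) = ZMod.toCircle ((k : ℕ) : ZMod 4) := by
  apply Subtype.ext
  rw [ZMod.toCircle_natCast, ZMod.toCircle_natCast]
  congr 1
  unfold bw
  push_cast
  have : ((n : ℂ) + 1) ≠ 0 := by exact_mod_cast n.succ_ne_zero
  field_simp

/-- The discrete angle of the generator. -/
def rang (e : A → ZMod 4) (n : ℕ) : Ang A n := fun i => (((e i).val * (n + 1) : ℕ) : ZMod (bw n))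

theorem spt_add_rang (e : A → ZMod 4) (x : Pos A n) (ξ : Ang A n) :
    spt (x, ξ + rang e n) = rot e (spt (x, ξ)) := by
  have h1 : ∀ i, (ZMod.toCircle ((ξ + rang e n) i) : ℂ) = ic (e i) * ZMod.toCircle (ξ i) := by
    intro i
    rw [Pi.add_apply, AddChar.map_add_eq_mul, rang, toCircle_mul_natCast, ZMod.natCast_zmod_val,
      Circle.coe_mul, ic, ZMod.stdAddChar_apply, mul_comm]
  by_cases hs : ∀ i, ((x i : ℕ) : ℝ) / lw n < 3 / 4
  · rw [spt, spt, pol_of_lt (s := fun i => ((x i : ℕ) : ℝ) / lw n) hs,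
      pol_of_lt (s := fun i => ((x i : ℕ) : ℝ) / lw n) hs, rot, OnePoint.map_some]
    congr 1
    funext i
    rw [h1]
    ring
  · push Not at hs
    obtain ⟨i, hi⟩ := hs
    rw [spt, spt, pol_of_le (s := fun i => ((x i : ℕ) : ℝ) / lw n) hi,
      pol_of_le (s := fun i => ((x i : ℕ) : ℝ) / lw n) hi]
    rfl

theorem pair_rang (e : A → ZMod 4) (a b : Lat A n) (w w' : ZMod 4) :
    ic (w - w') * pair (rang e n) (red a - red b) =
      ic ((∑ i, e i * ((a i : ℕ) : ZMod 4) + w) - (∑ i, e i * ((b i : ℕ) : ZMod 4) + w')) := by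
  have h1 : ∀ c : Lat A n, pair (rang e n) (red c) = ic (∑ i, e i * ((c i : ℕ) : ZMod 4)) := by
    intro c
    have h2 : ∀ s : Finset A, ZMod.toCircle (∑ i ∈ s, rang e n i * red c i) =
        ZMod.toCircle (∑ i ∈ s, e i * ((c i : ℕ) : ZMod 4)) := by
      intro s
      induction s using Finset.induction_on with
      | empty => simp
      | insert a s ha ih =>
        rw [Finset.sum_insert ha, Finset.sum_insert ha, AddChar.map_add_eq_mul,
          AddChar.map_add_eq_mul, ih]
        congr 1
        rw [rang, red, ← Nat.cast_mul, mul_right_comm, toCircle_mul_natCast, Nat.cast_mul,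
          ZMod.natCast_zmod_val]
    rw [pair, ic, ZMod.stdAddChar_apply, ZMod.stdAddChar_apply, h2]
  have h3 : pair (rang e n) (red a - red b) * ic (∑ i, e i * ((b i : ℕ) : ZMod 4)) =
      ic (∑ i, e i * ((a i : ℕ) : ZMod 4)) := by
    rw [← h1, ← h1, ← pair_add_right, sub_add_cancel]
  have h4 : ic (∑ i, e i * ((b i : ℕ) : ZMod 4)) ≠ 0 := fun h => by
    have := norm_ic (∑ i, e i * ((b i : ℕ) : ZMod 4)); rw [h, norm_zero] at this
    exact zero_ne_one this
  apply mul_right_cancel₀ h4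
  rw [mul_assoc, h3, ← ic_add, ← ic_add]
  congr 1
  ring

theorem IsSymbol.decoup_gr {e : A → ZMod 4} {w : ι → ZMod 4}
    {H : OnePoint (A → ℂ) → Matrix ι ι ℂ} {δ : ℝ} (hH : IsSymbol e w H δ) (n : ℕ) (χ : ZMod 4) :
    Decoup (qs H n) {x | gr e w x = χ} := by
  rintro ⟨a, μ⟩ ⟨b, ν⟩ hne
  have : gr e w (a, μ) = gr e w (b, ν) := by
    by_contra hgr
    refine hne (qz_eq_zero_of_twist (c := ic (w μ - w ν)) (rang e n) (fun x ξ _ _ => ?_) ?_)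
    · rw [spt_add_rang, hH.eqv]
    · rw [pair_rang]
      exact fun h => hgr (sub_eq_zero.1 (ic_eq_one h))
  simp only [Set.mem_setOf_eq, this]

theorem div_lw_le_of_lt (hn : 3 ≤ n) {x : ℕ} (hx : x < bw n) : (x : ℝ) / lw n ≤ 1 / 4 := by
  have h1 : (0 : ℝ) < lw n := by exact_mod_cast lw_pos n
  have h2 := bw_div_lw n
  have h3 : (x : ℝ) / lw n ≤ bw n / lw n := by gcongr
  rw [h2] at h3
  refine h3.trans ?_
  have : (3 : ℝ) ≤ n := by exact_mod_cast hn
  exact one_div_le_one_div_of_le (by norm_num) (by linarith)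

theorem spt_add_single (hn : 3 ≤ n) {x : Pos A n} (i : A) (hx : (x i : ℕ) < bw n) (ξ : Ang A n)
    (t : ZMod (bw n)) : spt (x, ξ + Pi.single i t) = spt (x, ξ) := by
  by_cases hs : ∀ i, ((x i : ℕ) : ℝ) / lw n < 3 / 4
  · rw [spt, spt, pol_of_lt (s := fun i => ((x i : ℕ) : ℝ) / lw n) hs,
      pol_of_lt (s := fun i => ((x i : ℕ) : ℝ) / lw n) hs]
    congr 1
    funext k
    by_cases hk : k = i
    · subst hk
      simp only [rad_of_le (div_lw_le_of_lt hn hx), Complex.ofReal_zero, zero_mul]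
    · simp [hk]
  · push Not at hs
    obtain ⟨k, hk⟩ := hs
    rw [spt, spt, pol_of_le (s := fun i => ((x i : ℕ) : ℝ) / lw n) hk,
      pol_of_le (s := fun i => ((x i : ℕ) : ℝ) / lw n) hk]

theorem qs_apply_eq_zero (hn : 3 ≤ n) (H : OnePoint (A → ℂ) → Matrix ι ι ℂ) {a b : Lat A n}
    {i : A} (ha : a i = 0) (hb : b i ≠ 0) (μ ν : ι) : qs H n (a, μ) (b, ν) = 0 := by
  by_cases hd : ((b i : ℕ) : ZMod (bw n)) = 0
  · rw [qs, qz_apply_of_const (c := 0), ite_self]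
    intro x ξ hxa hxb
    exfalso
    rw [ZMod.natCast_eq_zero_iff] at hd
    have h1 := Nat.le_of_dvd (Nat.pos_of_ne_zero fun h => hb (Fin.ext h)) hd
    have h2 := (hxa i).2
    have h3 := (hxb i).1
    rw [ha] at h2
    simp only [Fin.val_zero, zero_add] at h2
    omega
  · refine qz_eq_zero_of_twist (c := 1) (Pi.single i 1) (fun x ξ hxa _ => ?_) ?_
    · have h2 := (hxa i).2
      rw [ha, Fin.val_zero, zero_add] at h2
      rw [spt_add_single hn i h2, one_mul]
    · rw [one_mul, pair, Finset.sum_eq_single i (fun k _ hk => by simp [hk]) (by simp)]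
      simp only [Pi.single_eq_same, one_mul, Pi.sub_apply, red, ha, Fin.val_zero, Nat.cast_zero,
        zero_sub]
      intro h
      have := ZMod.injective_stdAddChar (h.trans (AddChar.map_zero_eq_one _).symm)
      exact hd (neg_eq_zero.1 this)

theorem IsSymbol.isHermitian_qs {e : A → ZMod 4} {w : ι → ZMod 4}
    {H : OnePoint (A → ℂ) → Matrix ι ι ℂ} {δ : ℝ} (hH : IsSymbol e w H δ) (n : ℕ) :
    (qs H n).IsHermitian := isHermitian_qz fun _ => hH.herm _

theorem IsSymbol.decoup_zero {e : A → ZMod 4} {w : ι → ZMod 4}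
    {H : OnePoint (A → ℂ) → Matrix ι ι ℂ} {δ : ℝ} (hH : IsSymbol e w H δ) (hn : 3 ≤ n) (i : A) :
    Decoup (qs H n) {x | x.1 i = 0} := by
  rintro ⟨a, μ⟩ ⟨b, ν⟩ hne
  constructor
  · intro ha
    by_contra hb
    exact hne (qs_apply_eq_zero hn H ha hb μ ν)
  · intro hb
    by_contra ha
    refine hne ?_
    rw [← (hH.isHermitian_qs n).apply (a, μ) (b, ν), qs_apply_eq_zero hn H hb ha, star_zero]

theorem spt_eq_infty {x : Pos A n} {i : A} (hx : lw n ≤ x i) (ξ : Ang A n) :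
    spt (x, ξ) = OnePoint.infty := by
  have h1 : (0 : ℝ) < lw n := by exact_mod_cast lw_pos n
  refine pol_of_le (i := i) ?_ _
  have h2 : (lw n : ℝ) ≤ (x i : ℕ) := by exact_mod_cast hx
  rw [le_div_iff₀ h1]
  simp only
  linarith

theorem qs_apply_last (H : OnePoint (A → ℂ) → Matrix ι ι ℂ) {a b : Lat A n}
    {i : A} (h : a i = Fin.last _ ∨ b i = Fin.last _) (μ ν : ι) :
    qs H n (a, μ) (b, ν) = if a = b then H OnePoint.infty μ ν else 0 := by
  refine qz_apply_of_const fun x ξ ha hb => ?_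
  rw [spt_eq_infty (i := i)]
  rcases h with h | h
  · have := (ha i).1; rwa [h] at this
  · have := (hb i).1; rwa [h] at this

theorem decoup_last (H : OnePoint (A → ℂ) → Matrix ι ι ℂ) (n : ℕ) (i : A) :
    Decoup (qs H n) {x | x.1 i = Fin.last _} := by
  rintro ⟨a, μ⟩ ⟨b, ν⟩ hne
  by_cases h : a i = Fin.last _ ∨ b i = Fin.last _
  · rw [qs_apply_last H h] at hne
    have : a = b := by
      by_contra h'; simp [h'] at hne
    simp [this]
  · push Not at h
    simp [h.1, h.2]

theorem IsSymbol.eventually_gap {e : A → ZMod 4} {w : ι → ZMod 4}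
    {H : OnePoint (A → ℂ) → Matrix ι ι ℂ} {δ : ℝ} (hH : IsSymbol e w H δ) :
    ∀ᶠ n in atTop, Gap (qs H n) (δ / 2) := by
  filter_upwards [eventually_norm_dev_le hH.cont (half_pos hH.pos)] with n hn
  have := gap_qz hH.pos.le (fun p => hH.gap (spt p)) hn
  rwa [sub_half] at this

end Symbol

section Koszul

open Matrix Filter Topology
open scoped Matrix.Norms.L2Operator

variable {A ι : Type*} [Fintype A] [DecidableEq A] [Fintype ι] [DecidableEq ι] {n : ℕ}

/-- Truncated successor. -/
def tsucc {N : ℕ} (k : Fin N) : Fin N := if h : (k : ℕ) + 1 < N then ⟨k + 1, h⟩ else k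

theorem val_tsucc {N : ℕ} {k : Fin N} (h : (k : ℕ) + 1 < N) : (tsucc k : ℕ) = k + 1 := by
  rw [tsucc, dif_pos h]

/-- Truncated shift in one coordinate. -/
def shift {N : ℕ} (i : A) (x : A → Fin N) : A → Fin N := Function.update x i (tsucc (x i))

theorem shift_same {N : ℕ} (i : A) (x : A → Fin N) : shift i x i = tsucc (x i) := by
  simp [shift]

theorem shift_ne {N : ℕ} {i k : A} (h : k ≠ i) (x : A → Fin N) : shift i x k = x k := by
  simp [shift, h]

theorem shift_injOn {N : ℕ} {i : A} {x y : A → Fin N} (hx : (x i : ℕ) + 1 < N)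
    (hy : (y i : ℕ) + 1 < N) (h : shift i x = shift i y) : x = y := by
  funext k
  have hk := congrFun h k
  by_cases hki : k = i
  · subst hki
    rw [shift_same, shift_same] at hk
    have := congrArg Fin.val hk
    rw [val_tsucc hx, val_tsucc hy] at this
    exact Fin.ext (by omega)
  · rwa [shift_ne hki, shift_ne hki] at hk

theorem inBox_shift {i : A} {x : Pos A n} {a : Lat A n} (ha : (a i : ℕ) + 1 < lw n + 1) :
    InBox x a ↔ (x i : ℕ) + 1 < lw n + bw n ∧ InBox (shift i x) (shift i a) := by
  constructor
  · intro h
    have hi := h i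
    have hx : (x i : ℕ) + 1 < lw n + bw n := by omega
    refine ⟨hx, fun k => ?_⟩
    by_cases hk : k = i
    · subst hk
      rw [shift_same, shift_same, val_tsucc hx, val_tsucc ha]
      omega
    · rw [shift_ne hk, shift_ne hk]; exact h k
  · rintro ⟨hx, h⟩ k
    have hk := h k
    by_cases hki : k = i
    · subst hki
      rw [shift_same, shift_same, val_tsucc hx, val_tsucc ha] at hk
      omega
    · rwa [shift_ne hki, shift_ne hki] at hk

theorem red_shift {i : A} {a : Lat A n} (ha : (a i : ℕ) + 1 < lw n + 1) :
    red (shift i a) = red a + Pi.single i 1 := by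
  funext k
  by_cases hk : k = i
  · subst hk
    simp [red, shift_same, val_tsucc ha]
  · simp [red, shift_ne hk, hk]

theorem qz_shift (h : Pos A n × Ang A n → Matrix ι ι ℂ) {i : A} {a b : Lat A n}
    (ha : (a i : ℕ) + 1 < lw n + 1) (hb : (b i : ℕ) + 1 < lw n + 1) (μ ν : ι) :
    qz h (shift i a, μ) (shift i b, ν) =
      qz (fun p => h (shift i p.1, p.2)) (a, μ) (b, ν) := by
  have hterm : ∀ (x : Pos A n) (ξ : Ang A n), InBox x a → InBox x b →
      starRingEnd ℂ (iso A n (x, ξ) a) * iso A n (x, ξ) b =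
        starRingEnd ℂ (iso A n (shift i x, ξ) (shift i a)) *
          iso A n (shift i x, ξ) (shift i b) := by
    intro x ξ hxa hxb
    have h1 := ((inBox_shift ha).1 hxa).2
    have h2 := ((inBox_shift hb).1 hxb).2
    simp only [iso_apply, if_pos hxa, if_pos hxb, if_pos h1, if_pos h2, red_shift ha,
      red_shift hb, pair_add_right, map_mul, conj_pair, neg_neg]
    have h3 : pair ξ (Pi.single i 1 : Ang A n) * pair (-ξ) (Pi.single i 1 : Ang A n) = 1 := by
      rw [← pair_add_left, add_neg_cancel, pair_zero_left]
    linear_combination (-(starRingEnd ℂ) ((bw n : ℂ) ^ Fintype.card A)⁻¹ * (starRingEnd ℂ) 1 *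
      pair ξ (red a) * (((bw n : ℂ) ^ Fintype.card A)⁻¹ * 1 * pair (-ξ) (red b))) * h3
  have hz : ∀ (x : Pos A n) (ξ : Ang A n) (c d : Lat A n),
      starRingEnd ℂ (iso A n (x, ξ) c) * iso A n (x, ξ) d ≠ 0 → InBox x c ∧ InBox x d := by
    intro x ξ c d h0
    exact ⟨inBox_of_iso_ne_zero fun h' => h0 (by rw [h']; simp),
      inBox_of_iso_ne_zero (right_ne_zero_of_mul h0)⟩
  rw [qz_apply, qz_apply]
  symm
  refine Finset.sum_bij_ne_zero (fun p _ _ => (shift i p.1, p.2)) (fun _ _ _ => Finset.mem_univ _)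
    ?_ ?_ ?_
  · rintro ⟨x, ξ⟩ _ h1 ⟨y, η⟩ _ h2 heq
    have hx := (hz x ξ a b (left_ne_zero_of_mul h1)).1
    have hy := (hz y η a b (left_ne_zero_of_mul h2)).1
    obtain ⟨e1, e2⟩ := Prod.mk.injEq _ _ _ _ ▸ heq
    exact Prod.ext (shift_injOn ((inBox_shift ha).1 hx).1 ((inBox_shift ha).1 hy).1 e1) e2
  · rintro ⟨y, ξ⟩ _ h0
    obtain ⟨hya, hyb⟩ := hz y ξ _ _ (left_ne_zero_of_mul h0)
    have hyi := hya i
    rw [shift_same, val_tsucc ha] at hyi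
    set x : Pos A n := Function.update y i ⟨y i - 1, by omega⟩ with hx
    have hxi : (x i : ℕ) = y i - 1 := by simp [hx]
    have hlt : (x i : ℕ) + 1 < lw n + bw n := by have := (y i).2; omega
    have hsx : shift i x = y := by
      funext k
      by_cases hk : k = i
      · subst hk
        rw [shift_same]
        exact Fin.ext (by rw [val_tsucc hlt]; omega)
      · rw [shift_ne hk]; simp [hx, hk]
    have hxa : InBox x a := (inBox_shift ha).2 ⟨hlt, by rwa [hsx]⟩
    have hxb : InBox x b := (inBox_shift hb).2 ⟨hlt, by rwa [hsx]⟩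
    refine ⟨(x, ξ), Finset.mem_univ _, ?_, by simp [hsx]⟩
    rw [hterm x ξ hxa hxb]
    simpa only [hsx] using h0
  · rintro ⟨x, ξ⟩ _ h0
    obtain ⟨hxa, hxb⟩ := hz x ξ a b (left_ne_zero_of_mul h0)
    simp only [hterm x ξ hxa hxb]

theorem qz_sub (h₀ h₁ : Pos A n × Ang A n → Matrix ι ι ℂ) :
    qz h₀ - qz h₁ = qz fun p => h₀ p - h₁ p := by
  have := qz_smul_add h₀ h₁ 1 (-1)
  simp only [one_smul, neg_smul] at this
  simp only [sub_eq_add_neg, this]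

theorem eventually_norm_shift_sub_le {H : OnePoint (A → ℂ) → Matrix ι ι ℂ} (hH : Continuous H)
    {ε : ℝ} (hε : 0 < ε) : ∀ᶠ n in atTop, ∀ i,
      ‖qz (fun p : Pos A n × Ang A n => H (spt (shift i p.1, p.2))) - qs H n‖ ≤ ε := by
  obtain ⟨δ, hδ, hm⟩ := exists_pol_modulus hH hε
  obtain ⟨n₀, hn₀⟩ := exists_nat_one_div_lt hδ
  filter_upwards [eventually_ge_atTop n₀] with n hn i
  rw [qs, qz_sub]
  refine norm_qz_le hε.le fun p => ?_
  rw [← dist_eq_norm]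
  have hlw : (0 : ℝ) < lw n := by exact_mod_cast lw_pos n
  refine (hm _ _ (fun k => pos_div_mem _ ?_) (fun k => pos_div_mem _ ?_) (fun k => ?_) _).le
  · exact (Fin.is_lt _).le
  · exact (Fin.is_lt _).le
  · have h1 : |(((shift i p.1 k : Fin _) : ℕ) : ℝ) - ((p.1 k : Fin _) : ℕ)| ≤ 1 := by
      by_cases hk : k = i
      · subst hk
        rw [shift_same, tsucc]
        split_ifs with h
        · simp
        · simp
      · rw [shift_ne hk]; simp
    rw [← sub_div, abs_div, abs_of_pos hlw]
    refine lt_of_le_of_lt ?_ hn₀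
    have h2 : ((n₀ : ℝ) + 1) ≤ lw n := by
      have : n₀ + 1 ≤ lw n := by unfold lw bw; nlinarith
      exact_mod_cast this
    rw [div_le_div_iff₀ hlw (by positivity)]
    nlinarith [abs_nonneg ((((shift i p.1 k : Fin _) : ℕ) : ℝ) - ((p.1 k : Fin _) : ℕ))]

/-- The part of degree `χ` with vanishing modes in the directions of `I`. -/
def cell (e : A → ZMod 4) (w : ι → ZMod 4) (I : Finset A) (χ : ZMod 4) (n : ℕ) :
    Set (Lat A n × ι) := {x | gr e w x = χ} ∩ {x | ∀ i ∈ I, x.1 i = 0}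

theorem IsSymbol.decoup_cell {e : A → ZMod 4} {w : ι → ZMod 4}
    {H : OnePoint (A → ℂ) → Matrix ι ι ℂ} {δ : ℝ} (hH : IsSymbol e w H δ) (hn : 3 ≤ n)
    (I : Finset A) (χ : ZMod 4) : Decoup (qs H n) (cell e w I χ n) :=
  (hH.decoup_gr n χ).inter fun x y h =>
    forall₂_congr fun i _ => hH.decoup_zero hn i x y h

theorem gr_shift (e : A → ZMod 4) (w : ι → ZMod 4) {i : A} {a : Lat A n}
    (ha : (a i : ℕ) + 1 < lw n + 1) (μ : ι) :
    gr e w (shift i a, μ) = gr e w (a, μ) + e i := by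
  have h : ∀ k, e k * ((shift i a k : ℕ) : ZMod 4) =
      e k * ((a k : ℕ) : ZMod 4) + (if k = i then e i else 0) := by
    intro k
    by_cases hk : k = i
    · subst hk
      rw [shift_same, val_tsucc ha, if_pos rfl]
      push_cast; ring
    · rw [shift_ne hk, if_neg hk, add_zero]
  simp only [gr, h, Finset.sum_add_distrib, Finset.sum_ite_eq', Finset.mem_univ, if_true]
  ring

theorem ne_last_iff {i : A} {a : Lat A n} : a i ≠ Fin.last _ ↔ (a i : ℕ) + 1 < lw n + 1 := by
  rw [← Fin.lt_last_iff_ne_last, Fin.lt_def, Fin.val_last]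
  omega

theorem image_shift_cell (e : A → ZMod 4) (w : ι → ZMod 4) {I : Finset A} {i : A} (hi : i ∉ I)
    (χ : ZMod 4) (n : ℕ) :
    (fun x : Lat A n × ι => (shift i x.1, x.2)) ''
      (cell e w I (χ - e i) n ∩ {x | x.1 i = Fin.last _}ᶜ) =
        cell e w I χ n ∩ {x | x.1 i = 0}ᶜ := by
  ext ⟨c, μ⟩
  constructor
  · rintro ⟨⟨a, ν⟩, ⟨⟨hgr, hI⟩, hl⟩, h⟩
    obtain ⟨rfl, rfl⟩ := Prod.mk.injEq _ _ _ _ ▸ h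
    have ha := ne_last_iff.1 hl
    refine ⟨⟨?_, fun k hk => ?_⟩, ?_⟩
    · change gr e w _ = _
      rw [gr_shift e w ha, hgr, sub_add_cancel]
    · have hki : k ≠ i := fun h => hi (h ▸ hk)
      change shift i a k = 0
      rw [shift_ne hki]
      exact hI k hk
    · intro h0
      have h1 := congrArg Fin.val (show shift i a i = 0 from h0)
      rw [shift_same, val_tsucc ha, Fin.val_zero] at h1
      omega
  · rintro ⟨⟨hgr, hI⟩, hc⟩
    have hc' : (c i : ℕ) ≠ 0 := fun h => hc (Fin.ext h)
    have hlt := (c i).2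
    set a : Lat A n := Function.update c i ⟨c i - 1, by omega⟩ with hadef
    have hai : (a i : ℕ) = c i - 1 := by simp [hadef]
    have ha : (a i : ℕ) + 1 < lw n + 1 := by omega
    have hsa : shift i a = c := by
      funext k
      by_cases hk : k = i
      · subst hk
        rw [shift_same]
        exact Fin.ext (by rw [val_tsucc ha]; omega)
      · rw [shift_ne hk]; simp [hadef, hk]
    refine ⟨(a, μ), ⟨⟨?_, fun k hk => ?_⟩, ne_last_iff.2 ha⟩, Prod.ext hsa rfl⟩
    · have := gr_shift e w ha μ
      rw [hsa] at this
      change gr e w _ = _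
      rw [← (show gr e w (c, μ) = χ from hgr), this, add_sub_cancel_right]
    · have hki : k ≠ i := fun h => hi (h ▸ hk)
      change a k = 0
      simp only [hadef, Function.update_of_ne hki]
      exact hI k hk

theorem IsSymbol.eventually_idx_shift {e : A → ZMod 4} {w : ι → ZMod 4}
    {H : OnePoint (A → ℂ) → Matrix ι ι ℂ} {δ : ℝ} (hH : IsSymbol e w H δ) :
    ∀ᶠ n in atTop, ∀ (I : Finset A) (i : A), i ∉ I → ∀ χ,
      idx (qs H n) (cell e w I χ n ∩ {x | x.1 i = 0}ᶜ) =
        idx (qs H n) (cell e w I (χ - e i) n ∩ {x | x.1 i = Fin.last _}ᶜ) := by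
  filter_upwards [hH.eventually_gap, eventually_ge_atTop 3,
    eventually_norm_shift_sub_le hH.cont (ε := δ / 4) (by linarith [hH.pos])] with n hg hn hs
  intro I i hi χ
  have hherm := hH.isHermitian_qs n
  have hd1 : Decoup (qs H n) (cell e w I χ n ∩ {x | x.1 i = 0}ᶜ) :=
    (hH.decoup_cell hn I χ).inter (hH.decoup_zero hn i).compl
  have hd2 : Decoup (qs H n) (cell e w I (χ - e i) n ∩ {x | x.1 i = Fin.last _}ᶜ) :=
    (hH.decoup_cell hn I _).inter (decoup_last H n i).compl
  have hpos := half_pos hH.pos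
  rw [← idx_eq_of_norm_sub_le hherm hd2 hg (hs i) (by linarith [hH.pos]),
    ← image_shift_cell e w hi χ n]
  rw [← image_shift_cell e w hi χ n] at hd1
  symm
  refine idx_image_eq hherm hd1 hpos hg ?_ ?_
  · rintro ⟨a, μ⟩ ⟨-, ha⟩ ⟨b, ν⟩ ⟨-, hb⟩ h
    obtain ⟨h1, h2⟩ := Prod.mk.injEq _ _ _ _ ▸ h
    exact Prod.ext (shift_injOn (ne_last_iff.1 ha) (ne_last_iff.1 hb) h1) h2
  · rintro ⟨a, μ⟩ ⟨-, ha⟩ ⟨b, ν⟩ ⟨-, hb⟩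
    have := qz_shift (fun p : Pos A n × Ang A n => H (spt p)) (ne_last_iff.1 ha)
      (ne_last_iff.1 hb) μ ν
    exact this.symm

/-- The symbol with constant value at infinity. -/
def atInfty (H : OnePoint (A → ℂ) → Matrix ι ι ℂ) : OnePoint (A → ℂ) → Matrix ι ι ℂ :=
  fun _ => H OnePoint.infty

theorem IsSymbol.atInfty {e : A → ZMod 4} {w : ι → ZMod 4}
    {H : OnePoint (A → ℂ) → Matrix ι ι ℂ} {δ : ℝ} (hH : IsSymbol e w H δ) :
    IsSymbol e w (atInfty H) δ where
  cont := continuous_const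
  herm _ := hH.herm _
  pos := hH.pos
  gap _ := hH.gap _
  eqv _ μ ν := hH.eqv OnePoint.infty μ ν

/-- The relative index of a symbol. -/
noncomputable def al (e : A → ZMod 4) (w : ι → ZMod 4) (H : OnePoint (A → ℂ) → Matrix ι ι ℂ)
    (I : Finset A) (χ : ZMod 4) (n : ℕ) : ℤ :=
  idx (qs H n) (cell e w I χ n) - idx (qs (atInfty H) n) (cell e w I χ n)

theorem cell_insert (e : A → ZMod 4) (w : ι → ZMod 4) (I : Finset A) (i : A) (χ : ZMod 4) (n : ℕ) :
    cell e w (insert i I) χ n = cell e w I χ n ∩ {x | x.1 i = 0} := by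
  ext x
  simp only [cell, Finset.mem_insert, Set.mem_inter_iff, Set.mem_setOf_eq, forall_eq_or_imp]
  tauto

theorem IsSymbol.eventually_al_insert {e : A → ZMod 4} {w : ι → ZMod 4}
    {H : OnePoint (A → ℂ) → Matrix ι ι ℂ} {δ : ℝ} (hH : IsSymbol e w H δ) :
    ∀ᶠ n in atTop, ∀ (I : Finset A) (i : A), i ∉ I → ∀ χ,
      al e w H (insert i I) χ n = al e w H I χ n - al e w H I (χ - e i) n := by
  filter_upwards [hH.eventually_gap, hH.atInfty.eventually_gap, eventually_ge_atTop 3,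
    hH.eventually_idx_shift, hH.atInfty.eventually_idx_shift] with n hg hg' hn hs hs' I i hi χ
  have hpos := half_pos hH.pos
  have h1 := idx_split (hH.isHermitian_qs n) (hH.decoup_cell hn I χ) (hH.decoup_zero hn i) hpos hg
  have h2 := idx_split (hH.isHermitian_qs n) (hH.decoup_cell hn I (χ - e i))
    (decoup_last H n i) hpos hg
  have h1' := idx_split (hH.atInfty.isHermitian_qs n) (hH.atInfty.decoup_cell hn I χ)
    (hH.atInfty.decoup_zero hn i) hpos hg'
  have h2' := idx_split (hH.atInfty.isHermitian_qs n) (hH.atInfty.decoup_cell hn I (χ - e i))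
    (decoup_last (BorsukUlam.atInfty H) n i) hpos hg'
  have h3 := hs I i hi χ
  have h3' := hs' I i hi χ
  have h4 : idx (qs H n) (cell e w I (χ - e i) n ∩ {x | x.1 i = Fin.last _}) =
      idx (qs (BorsukUlam.atInfty H) n) (cell e w I (χ - e i) n ∩ {x | x.1 i = Fin.last _}) := by
    refine idx_congr ?_
    rintro ⟨a, μ⟩ ⟨-, ha⟩ ⟨b, ν⟩ -
    rw [qs_apply_last H (Or.inl ha), qs_apply_last _ (Or.inl ha)]
    rfl
  simp only [al, cell_insert]
  omega

/-- The character-valued relative index. -/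
noncomputable def alHat (e : A → ZMod 4) (w : ι → ZMod 4) (H : OnePoint (A → ℂ) → Matrix ι ι ℂ)
    (I : Finset A) (n : ℕ) : ℂ := ∑ χ, (al e w H I χ n : ℂ) * ic χ

theorem IsSymbol.eventually_alHat {e : A → ZMod 4} {w : ι → ZMod 4}
    {H : OnePoint (A → ℂ) → Matrix ι ι ℂ} {δ : ℝ} (hH : IsSymbol e w H δ) :
    ∀ᶠ n in atTop, ∀ I : Finset A,
      alHat e w H I n = (∏ i ∈ I, (1 - ic (e i))) * alHat e w H ∅ n := by
  filter_upwards [hH.eventually_al_insert] with n hn I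
  induction I using Finset.induction_on with
  | empty => simp
  | insert i I hi ih =>
    rw [Finset.prod_insert hi, mul_assoc, ← ih]
    simp only [alHat, hn I i hi]
    have h1 : ∑ χ, (al e w H I (χ - e i) n : ℂ) * ic χ =
        ic (e i) * ∑ χ, (al e w H I χ n : ℂ) * ic χ := by
      rw [← Equiv.sum_comp (Equiv.addRight (e i)), Finset.mul_sum]
      refine Finset.sum_congr rfl fun χ _ => ?_
      simp only [Equiv.coe_addRight, add_sub_cancel_right, ic_add]
      ring
    push_cast
    simp only [sub_mul, Finset.sum_sub_distrib, h1, one_mul]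

end Koszul

section Restriction

open Matrix Filter Topology
open scoped Matrix.Norms.L2Operator

variable {A A₁ A₂ ι : Type*} [Fintype A] [DecidableEq A] [Fintype A₁] [DecidableEq A₁]
  [Fintype A₂] [DecidableEq A₂] [Fintype ι] [DecidableEq ι] {n : ℕ}

theorem continuous_map_of_isClosedEmbedding {X Y : Type*} [TopologicalSpace X] [TopologicalSpace Y]
    [T2Space X] [T2Space Y] {f : X → Y} (hf : IsClosedEmbedding f) :
    Continuous (OnePoint.map f) :=
  OnePoint.continuous_map hf.continuous (by
    rw [coclosedCompact_eq_cocompact, coclosedCompact_eq_cocompact]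
    exact hf.tendsto_cocompact)

/-- Extension of a point of a coordinate subspace by zero. -/
noncomputable def ext (A₁ A₂ : Type*) : OnePoint (A₂ → ℂ) → OnePoint (A₁ ⊕ A₂ → ℂ) :=
  OnePoint.map fun z => Sum.elim 0 z

theorem continuous_ext : Continuous (ext A₁ A₂) := by
  refine continuous_map_of_isClosedEmbedding ?_
  have h1 : Continuous fun z : A₂ → ℂ => (Sum.elim 0 z : A₁ ⊕ A₂ → ℂ) :=
    continuous_pi fun i => by
      rcases i with i | i
      · exact continuous_const
      · exact continuous_apply i
  have h2 : Continuous fun z : A₁ ⊕ A₂ → ℂ => fun i => z (Sum.inr i) :=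
    continuous_pi fun i => continuous_apply _
  exact (Function.LeftInverse.isClosedEmbedding (fun z => by funext i; rfl) h2 h1)

theorem rot_ext (e : A₁ ⊕ A₂ → ZMod 4) (x : OnePoint (A₂ → ℂ)) :
    rot e (ext A₁ A₂ x) = ext A₁ A₂ (rot (fun i => e (Sum.inr i)) x) := by
  cases x with
  | infty => rfl
  | coe z =>
    simp only [rot, ext, OnePoint.map_some]
    congr 1
    funext i
    rcases i with i | i <;> simp

theorem IsSymbol.ext {e : A₁ ⊕ A₂ → ZMod 4} {w : ι → ZMod 4}
    {H : OnePoint (A₁ ⊕ A₂ → ℂ) → Matrix ι ι ℂ} {δ : ℝ} (hH : IsSymbol e w H δ) :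
    IsSymbol (fun i => e (Sum.inr i)) w (H ∘ ext A₁ A₂) δ where
  cont := hH.cont.comp continuous_ext
  herm _ := hH.herm _
  pos := hH.pos
  gap _ := hH.gap _
  eqv x μ ν := by
    rw [Function.comp_apply, ← rot_ext, hH.eqv]
    rfl

/-- Splitting positions and angles. -/
def splitEquiv (A₁ A₂ : Type*) (n : ℕ) : (Pos A₁ n × Ang A₁ n) × (Pos A₂ n × Ang A₂ n) ≃
    Pos (A₁ ⊕ A₂) n × Ang (A₁ ⊕ A₂) n where
  toFun p := (Sum.elim p.1.1 p.2.1, Sum.elim p.1.2 p.2.2)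
  invFun q := ((fun i => q.1 (Sum.inl i), fun i => q.2 (Sum.inl i)),
    (fun i => q.1 (Sum.inr i), fun i => q.2 (Sum.inr i)))
  left_inv _ := rfl
  right_inv q := by
    refine Prod.ext ?_ ?_ <;> funext i <;> rcases i with i | i <;> rfl

theorem splitEquiv_apply (p : Pos A₁ n × Ang A₁ n) (q : Pos A₂ n × Ang A₂ n) :
    splitEquiv A₁ A₂ n (p, q) = (Sum.elim p.1 q.1, Sum.elim p.2 q.2) := rfl

theorem iso_split (p : Pos A₁ n × Ang A₁ n) (q : Pos A₂ n × Ang A₂ n) (a : Lat A₁ n)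
    (b : Lat A₂ n) :
    iso (A₁ ⊕ A₂) n (splitEquiv A₁ A₂ n (p, q)) (Sum.elim a b) = iso A₁ n p a * iso A₂ n q b := by
  have h1 : InBox (splitEquiv A₁ A₂ n (p, q)).1 (Sum.elim a b : Lat (A₁ ⊕ A₂) n) ↔
      InBox p.1 a ∧ InBox q.1 b := by
    simp [InBox, splitEquiv_apply]
  have h2 : pair (-(splitEquiv A₁ A₂ n (p, q)).2) (red (Sum.elim a b : Lat (A₁ ⊕ A₂) n)) =
      pair (-p.2) (red a) * pair (-q.2) (red b) := by
    simp [pair, splitEquiv_apply, red, AddChar.map_add_eq_mul, mul_comm]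
  rw [iso_apply, iso_apply, iso_apply, h2, Fintype.card_sum, pow_add]
  by_cases h3 : InBox p.1 a <;> by_cases h4 : InBox q.1 b <;> simp [h1, h3, h4] <;> ring

theorem spt_split (hn : 3 ≤ n) {p : Pos A₁ n × Ang A₁ n} (q : Pos A₂ n × Ang A₂ n)
    (hp : InBox p.1 0) : spt (splitEquiv A₁ A₂ n (p, q)) = ext A₁ A₂ (spt q) := by
  have hp' : ∀ i, ((p.1 i : ℕ) : ℝ) / lw n ≤ 1 / 4 := fun i =>
    div_lw_le_of_lt hn (by simpa using (hp i).2)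
  by_cases hs : ∀ i, ((q.1 i : ℕ) : ℝ) / lw n < 3 / 4
  · have hs' : ∀ i, (((splitEquiv A₁ A₂ n (p, q)).1 i : ℕ) : ℝ) / lw n < 3 / 4 := by
      rintro (i | i)
      · exact (hp' i).trans_lt (by norm_num)
      · exact hs i
    rw [spt, spt, pol_of_lt (s := fun i => ((q.1 i : ℕ) : ℝ) / lw n) hs,
      pol_of_lt (s := fun i => (((splitEquiv A₁ A₂ n (p, q)).1 i : ℕ) : ℝ) / lw n) hs', ext,
      OnePoint.map_some]
    congr 1
    funext i
    rcases i with i | i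
    · change ((rad (((p.1 i : ℕ) : ℝ) / lw n) : ℝ) : ℂ) * _ = 0
      rw [rad_of_le (hp' i)]; simp
    · rfl
  · push Not at hs
    obtain ⟨i, hi⟩ := hs
    rw [spt, spt, pol_of_le (s := fun i => ((q.1 i : ℕ) : ℝ) / lw n) hi,
      pol_of_le (s := fun i => (((splitEquiv A₁ A₂ n (p, q)).1 i : ℕ) : ℝ) / lw n)
        (i := Sum.inr i) hi]
    rfl

theorem qs_ext (hn : 3 ≤ n) (H : OnePoint (A₁ ⊕ A₂ → ℂ) → Matrix ι ι ℂ) (a b : Lat A₂ n)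
    (μ ν : ι) : qs H n ((Sum.elim 0 a : Lat (A₁ ⊕ A₂) n), μ) ((Sum.elim 0 b : Lat (A₁ ⊕ A₂) n), ν) =
      qs (H ∘ ext A₁ A₂) n (a, μ) (b, ν) := by
  have h2 := congrFun (congrFun (iso_conjTranspose_mul_self (A := A₁) (n := n)) 0) 0
  rw [mul_apply, one_apply_eq] at h2
  simp only [conjTranspose_apply, RCLike.star_def] at h2
  rw [qs, qs, qz_apply, qz_apply, ← Equiv.sum_comp (splitEquiv A₁ A₂ n), Fintype.sum_prod_type]
  conv_rhs => rw [← one_mul (Finset.sum _ _), ← h2, Finset.sum_mul]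
  refine Finset.sum_congr rfl fun p _ => ?_
  rw [Finset.mul_sum]
  refine Finset.sum_congr rfl fun q _ => ?_
  rw [iso_split, iso_split, map_mul]
  by_cases h0 : iso A₁ n p 0 = 0
  · simp [h0]
  · rw [spt_split hn q (inBox_of_iso_ne_zero h0)]
    simp only [Function.comp_apply]
    ring

theorem image_cell_ext (e : A₁ ⊕ A₂ → ZMod 4) (w : ι → ZMod 4) (χ : ZMod 4) (n : ℕ) :
    (fun x : Lat A₂ n × ι => ((Sum.elim 0 x.1 : Lat (A₁ ⊕ A₂) n), x.2)) ''
      cell (fun i => e (Sum.inr i)) w ∅ χ n = cell e w (Finset.univ.map .inl) χ n := by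
  have hgr : ∀ (a : Lat A₂ n) (μ : ι), gr e w ((Sum.elim 0 a : Lat (A₁ ⊕ A₂) n), μ) =
      gr (fun i => e (Sum.inr i)) w (a, μ) := by
    intro a μ
    simp [gr]
  ext ⟨c, μ⟩
  constructor
  · rintro ⟨⟨a, ν⟩, ⟨h, -⟩, heq⟩
    obtain ⟨rfl, rfl⟩ := Prod.mk.injEq _ _ _ _ ▸ heq
    refine ⟨?_, ?_⟩
    · change gr e w _ = _
      rw [hgr]; exact h
    · intro i hi
      obtain ⟨k, -, rfl⟩ := Finset.mem_map.1 hi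
      rfl
  · rintro ⟨h, hI⟩
    have hc : c = (Sum.elim 0 fun i => c (Sum.inr i) : Lat (A₁ ⊕ A₂) n) := by
      funext i
      rcases i with i | i
      · exact hI _ (Finset.mem_map.2 ⟨i, Finset.mem_univ _, rfl⟩)
      · rfl
    refine ⟨(fun i => c (Sum.inr i), μ), ⟨?_, by simp⟩, Prod.ext hc.symm rfl⟩
    change gr _ w _ = _
    rw [← hgr, ← hc]
    exact h

theorem IsSymbol.eventually_idx_ext {e : A₁ ⊕ A₂ → ZMod 4} {w : ι → ZMod 4}
    {H : OnePoint (A₁ ⊕ A₂ → ℂ) → Matrix ι ι ℂ} {δ : ℝ} (hH : IsSymbol e w H δ) :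
    ∀ᶠ n in atTop, ∀ χ, idx (qs H n) (cell e w (Finset.univ.map .inl) χ n) =
      idx (qs (H ∘ BorsukUlam.ext A₁ A₂) n) (cell (fun i => e (Sum.inr i)) w ∅ χ n) := by
  filter_upwards [hH.eventually_gap, eventually_ge_atTop 3] with n hg hn χ
  have hd := hH.decoup_cell hn (Finset.univ.map .inl) χ
  rw [← image_cell_ext] at hd ⊢
  symm
  refine idx_image_eq (hH.isHermitian_qs n) hd (half_pos hH.pos) hg ?_ ?_
  · rintro ⟨a, μ⟩ - ⟨b, ν⟩ - h
    obtain ⟨h1, h2⟩ := Prod.mk.injEq _ _ _ _ ▸ h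
    refine Prod.ext (funext fun i => congrFun h1 (Sum.inr i)) h2
  · rintro ⟨a, μ⟩ - ⟨b, ν⟩ -
    exact (qs_ext hn H a b μ ν).symm

theorem IsSymbol.eventually_al_ext {e : A₁ ⊕ A₂ → ZMod 4} {w : ι → ZMod 4}
    {H : OnePoint (A₁ ⊕ A₂ → ℂ) → Matrix ι ι ℂ} {δ : ℝ} (hH : IsSymbol e w H δ) :
    ∀ᶠ n in atTop, ∀ χ, al e w H (Finset.univ.map .inl) χ n =
      al (fun i => e (Sum.inr i)) w (H ∘ BorsukUlam.ext A₁ A₂) ∅ χ n := by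
  filter_upwards [hH.eventually_idx_ext, hH.atInfty.eventually_idx_ext] with n h1 h2 χ
  rw [al, al, h1, h2]
  rfl

theorem spt_eq_zero (hn : 3 ≤ n) {x : Pos A n} (hx : InBox x 0) (ξ : Ang A n) :
    spt (x, ξ) = ((0 : A → ℂ) : OnePoint (A → ℂ)) := by
  have hp' : ∀ i, ((x i : ℕ) : ℝ) / lw n ≤ 1 / 4 := fun i =>
    div_lw_le_of_lt hn (by simpa using (hx i).2)
  rw [spt, pol_of_lt (s := fun i => ((x i : ℕ) : ℝ) / lw n)
    fun i => (hp' i).trans_lt (by norm_num)]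
  congr 1
  funext i
  simp only [rad_of_le (hp' i)]
  simp

theorem idx_cell_univ (e : A → ZMod 4) (w : ι → ZMod 4)
    {H : OnePoint (A → ℂ) → Matrix ι ι ℂ} (hn : 3 ≤ n) {d : ι → ℝ} (hd : ∀ μ, d μ = 1 ∨ d μ = -1)
    (hH : H ((0 : A → ℂ) : OnePoint (A → ℂ)) = diagonal fun μ => (d μ : ℂ)) (χ : ZMod 4) :
    idx (qs H n) (cell e w Finset.univ χ n) = {μ | w μ = χ ∧ d μ = 1}.ncard := by
  have hz : ∀ x ∈ cell e w Finset.univ χ n, x.1 = 0 := fun x hx =>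
    funext fun i => hx.2 i (Finset.mem_univ i)
  rw [idx_eq_ncard_of_diagonal (d := fun x => d x.2) (fun x => hd x.2)]
  · rw [← Set.ncard_image_of_injective {μ | w μ = χ ∧ d μ = 1}
      (f := fun μ => ((0 : Lat A n), μ)) (fun μ ν h => (Prod.mk.injEq _ _ _ _ ▸ h).2)]
    congr 1
    ext ⟨a, μ⟩
    constructor
    · rintro ⟨h, h1⟩
      have ha : a = 0 := hz _ h
      subst ha
      refine ⟨μ, ⟨?_, h1⟩, rfl⟩
      have : gr e w ((0 : Lat A n), μ) = χ := h.1
      simpa [gr] using this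
    · rintro ⟨ν, ⟨h1, h2⟩, heq⟩
      obtain ⟨rfl, rfl⟩ := Prod.mk.injEq _ _ _ _ ▸ heq
      refine ⟨⟨?_, fun i _ => rfl⟩, h2⟩
      change gr e w _ = _
      simpa [gr] using h1
  · rintro ⟨a, μ⟩ ha ⟨b, ν⟩ hb
    have ha' : a = 0 := hz _ ha
    have hb' : b = 0 := hz _ hb
    subst ha' hb'
    rw [qs, qz_apply_of_const (c := H ((0 : A → ℂ) : OnePoint (A → ℂ)) μ ν), if_pos rfl, hH,
      diagonal_apply]
    · simp
    · intro x ξ hx _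
      rw [spt_eq_zero hn hx]

theorem al_univ (e : A → ZMod 4) (w : ι → ZMod 4)
    {H : OnePoint (A → ℂ) → Matrix ι ι ℂ} (hn : 3 ≤ n) {d : ι → ℝ} (hd : ∀ μ, d μ = 1 ∨ d μ = -1)
    (hH : H ((0 : A → ℂ) : OnePoint (A → ℂ)) = diagonal fun μ => (d μ : ℂ))
    (hH' : H OnePoint.infty = -diagonal fun μ => (d μ : ℂ)) (χ : ZMod 4) :
    (al e w H Finset.univ χ n : ℝ) = ∑ μ, if w μ = χ then d μ else 0 := by
  have h1 := idx_cell_univ e w hn hd hH χ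
  have h2 := idx_cell_univ e w (H := BorsukUlam.atInfty H) hn (d := fun μ => -d μ)
    (fun μ => by have := hd μ; rcases this with h | h <;> simp [h])
    (by simp [BorsukUlam.atInfty, hH', ← diagonal_neg]) χ
  have hc : ∀ p : ι → Prop, ∀ [DecidablePred p], ({μ | p μ}.ncard : ℝ) = ∑ μ, if p μ then 1 else 0 := by
    intro p _
    rw [Finset.sum_boole, Set.ncard_eq_toFinset_card', Set.toFinset_setOf]
  rw [al, h1, h2]
  push_cast
  classical
  rw [hc, hc, ← Finset.sum_sub_distrib]
  refine Finset.sum_congr rfl fun μ _ => ?_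
  by_cases hw : w μ = χ
  · rcases hd μ with h | h <;> simp [hw, h] <;> norm_num
  · simp [hw]

theorem alHat_univ (e : A → ZMod 4) (w : ι → ZMod 4)
    {H : OnePoint (A → ℂ) → Matrix ι ι ℂ} (hn : 3 ≤ n) {d : ι → ℝ} (hd : ∀ μ, d μ = 1 ∨ d μ = -1)
    (hH : H ((0 : A → ℂ) : OnePoint (A → ℂ)) = diagonal fun μ => (d μ : ℂ))
    (hH' : H OnePoint.infty = -diagonal fun μ => (d μ : ℂ)) :
    alHat e w H Finset.univ n = ∑ μ, (d μ : ℂ) * ic (w μ) := by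
  have h : ∀ χ, (al e w H Finset.univ χ n : ℂ) = ∑ μ, if w μ = χ then (d μ : ℂ) else 0 := by
    intro χ
    have := congrArg (fun r : ℝ => (r : ℂ)) (al_univ e w hn hd hH hH' χ)
    simp only [Complex.ofReal_intCast, Complex.ofReal_sum] at this
    rw [this]
    refine Finset.sum_congr rfl fun μ _ => ?_
    split_ifs <;> simp
  simp only [alHat, h, Finset.sum_mul]
  rw [Finset.sum_comm]
  refine Finset.sum_congr rfl fun μ _ => ?_
  simp

end Restriction

section Invariance

open Matrix Filter Topology
open scoped Matrix.Norms.L2Operator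

variable {X : Type*} [Fintype X] [DecidableEq X]

theorem idx_empty {T : Matrix X X ℂ} {δ : ℝ} (hT : T.IsHermitian) (hδ : 0 < δ) (hg : Gap T δ) :
    idx T ∅ = 0 := by
  have hd : Decoup T ∅ := fun _ _ _ => Iff.rfl
  have := idx_union hT hd hd (Set.disjoint_empty _) hδ hg
  rw [Set.union_empty] at this
  omega

theorem Decoup.biUnion {T : Matrix X X ℂ} {κ : Type*} {s : Finset κ} {P : κ → Set X}
    (hP : ∀ i ∈ s, Decoup T (P i)) : Decoup T (⋃ i ∈ s, P i) := by
  intro x y h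
  simp only [Set.mem_iUnion]
  exact exists_congr fun i => exists_congr fun hi => hP i hi x y h

theorem idx_biUnion {T : Matrix X X ℂ} {δ : ℝ} (hT : T.IsHermitian) (hδ : 0 < δ) (hg : Gap T δ)
    {κ : Type*} [DecidableEq κ] (s : Finset κ) {P : κ → Set X} (hP : ∀ i, Decoup T (P i))
    (hd : Pairwise fun i j => Disjoint (P i) (P j)) :
    idx T (⋃ i ∈ s, P i) = ∑ i ∈ s, idx T (P i) := by
  induction s using Finset.induction_on with
  | empty => simpa using idx_empty hT hδ hg
  | insert i s hi ih =>
    rw [Finset.set_biUnion_insert, idx_union hT (hP i) (Decoup.biUnion fun j _ => hP j) _ hδ hg,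
      Finset.sum_insert hi, ih]
    rw [Set.disjoint_iUnion₂_right]
    exact fun j hj => hd fun h => hi (h ▸ hj)

variable {A ι : Type*} [Fintype A] [DecidableEq A] [Fintype ι] [DecidableEq ι] {n : ℕ}

theorem IsSymbol.eventually_idx_eq {e : A → ZMod 4} {w : ι → ZMod 4}
    {H₀ H₁ : OnePoint (A → ℂ) → Matrix ι ι ℂ} {δ : ℝ} (h₀ : IsSymbol e w H₀ δ)
    (h₁ : IsSymbol e w H₁ δ) (hg : ∀ x (t : ℝ), 0 ≤ t → t ≤ 1 →
      Gap (((1 - t : ℝ) : ℂ) • H₀ x + (t : ℂ) • H₁ x) δ) :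
    ∀ᶠ n in atTop, ∀ I χ, idx (qs H₀ n) (cell e w I χ n) = idx (qs H₁ n) (cell e w I χ n) := by
  filter_upwards [eventually_norm_dev_le h₀.cont (half_pos h₀.pos), eventually_ge_atTop 3,
    eventually_norm_dev_le h₁.cont (half_pos h₁.pos)] with n hn₀ hn hn₁ I χ
  refine idx_congr_homotopy (h₀.isHermitian_qs n) (h₁.isHermitian_qs n) (h₀.decoup_cell hn I χ)
    (h₁.decoup_cell hn I χ) (half_pos h₀.pos) fun t ht0 ht1 => ?_
  have hdev : ‖dev (fun p : Pos A n × Ang A n =>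
      ((1 - t : ℝ) : ℂ) • H₀ (spt p) + (t : ℂ) • H₁ (spt p))‖ ≤ δ / 2 := by
    rw [dev_smul_add (fun p => H₀ (spt p)) (fun p => H₁ (spt p))]
    refine (norm_add_le _ _).trans ?_
    rw [norm_smul, norm_smul, Complex.norm_real, Complex.norm_real, Real.norm_of_nonneg ht0,
      Real.norm_of_nonneg (by linarith : (0 : ℝ) ≤ 1 - t)]
    nlinarith [mul_le_mul_of_nonneg_left hn₀ (by linarith : (0 : ℝ) ≤ 1 - t),
      mul_le_mul_of_nonneg_left hn₁ ht0]
  have := gap_qz (h := fun p : Pos A n × Ang A n =>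
    ((1 - t : ℝ) : ℂ) • H₀ (spt p) + (t : ℂ) • H₁ (spt p)) h₀.pos.le
    (fun p => hg (spt p) t ht0 ht1) hdev
  rw [sub_half, qz_smul_add (fun p => H₀ (spt p)) (fun p => H₁ (spt p))] at this
  exact this

theorem IsSymbol.eventually_al_eq {e : A → ZMod 4} {w : ι → ZMod 4}
    {H₀ H₁ : OnePoint (A → ℂ) → Matrix ι ι ℂ} {δ : ℝ} (h₀ : IsSymbol e w H₀ δ)
    (h₁ : IsSymbol e w H₁ δ) (hg : ∀ x (t : ℝ), 0 ≤ t → t ≤ 1 →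
      Gap (((1 - t : ℝ) : ℂ) • H₀ x + (t : ℂ) • H₁ x) δ) :
    ∀ᶠ n in atTop, ∀ I χ, al e w H₀ I χ n = al e w H₁ I χ n := by
  filter_upwards [h₀.eventually_idx_eq h₁ hg,
    h₀.atInfty.eventually_idx_eq h₁.atInfty fun _ => hg _] with n h1 h2 I χ
  rw [al, al, h1, h2]

theorem rot_add (e e' : A → ZMod 4) (x : OnePoint (A → ℂ)) :
    rot (fun i => e i + e' i) x = rot e (rot e' x) := by
  cases x with
  | infty => rfl
  | coe z =>
    simp only [rot, OnePoint.map_some]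
    congr 1
    funext i
    rw [ic_add, mul_assoc]

theorem rot_zero (x : OnePoint (A → ℂ)) : rot (fun _ => 0) x = x := by
  cases x with
  | infty => rfl
  | coe z => simp [rot, ic_zero]

theorem IsSymbol.coarsen {e : A → ZMod 4} {w : ι → ZMod 4}
    {H : OnePoint (A → ℂ) → Matrix ι ι ℂ} {δ : ℝ} (hH : IsSymbol e w H δ) (m : ℕ) :
    IsSymbol (fun i => m * e i) (fun μ => m * w μ) H δ where
  cont := hH.cont
  herm := hH.herm
  pos := hH.pos
  gap := hH.gap
  eqv x μ ν := by
    induction m generalizing x with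
    | zero => simp [rot_zero, ic_zero]
    | succ m ih =>
      simp only [Nat.cast_succ, add_mul, one_mul]
      rw [rot_add, ih, hH.eqv, ← mul_assoc, ← ic_add]
      congr 2
      ring

theorem cell_coarsen (e : A → ZMod 4) (w : ι → ZMod 4) (m : ℕ) (I : Finset A) (ψ : ZMod 4) (n : ℕ) :
    cell (fun i => m * e i) (fun μ => m * w μ) I ψ n =
      ⋃ χ ∈ Finset.univ.filter fun χ : ZMod 4 => m * χ = ψ, cell e w I χ n := by
  have h : ∀ x : Lat A n × ι, gr (fun i => m * e i) (fun μ => m * w μ) x = m * gr e w x := by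
    intro x
    simp only [gr, mul_add, Finset.mul_sum, mul_assoc]
  ext x
  simp [cell, h]

theorem disjoint_cell (e : A → ZMod 4) (w : ι → ZMod 4) (I : Finset A) (n : ℕ) :
    Pairwise fun χ χ' => Disjoint (cell e w I χ n) (cell e w I χ' n) := fun χ χ' hne =>
  Set.disjoint_left.2 fun x (h1 : _ ∧ _) (h2 : _ ∧ _) => by
    have h3 : gr e w x = χ := h1.1
    have h4 : gr e w x = χ' := h2.1
    exact hne (h3.symm.trans h4)

theorem IsSymbol.eventually_al_coarsen {e : A → ZMod 4} {w : ι → ZMod 4}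
    {H : OnePoint (A → ℂ) → Matrix ι ι ℂ} {δ : ℝ} (hH : IsSymbol e w H δ) :
    ∀ᶠ n in atTop, ∀ (m : ℕ) I ψ, al (fun i => m * e i) (fun μ => m * w μ) H I ψ n =
      ∑ χ ∈ Finset.univ.filter fun χ : ZMod 4 => m * χ = ψ, al e w H I χ n := by
  filter_upwards [hH.eventually_gap, hH.atInfty.eventually_gap, eventually_ge_atTop 3]
    with n hg hg' hn m I ψ
  have hpos := half_pos hH.pos
  rw [al, cell_coarsen, idx_biUnion (hH.isHermitian_qs n) hpos hg _
    (fun χ => hH.decoup_cell hn I χ) (disjoint_cell e w I n),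
    idx_biUnion (hH.atInfty.isHermitian_qs n) hpos hg' _
    (fun χ => hH.atInfty.decoup_cell hn I χ) (disjoint_cell e w I n)]
  push_cast
  rw [← Finset.sum_sub_distrib]
  rfl

theorem qs_neg (H : OnePoint (A → ℂ) → Matrix ι ι ℂ) (n : ℕ) : qs (-H) n = -qs H n := by
  have := qz_smul_add (fun p : Pos A n × Ang A n => H (spt p)) (fun p => H (spt p)) (-1) 0
  simpa [qs] using this

theorem IsSymbol.eventually_al_neg {e : A → ZMod 4} {w : ι → ZMod 4}
    {H : OnePoint (A → ℂ) → Matrix ι ι ℂ} {δ : ℝ} (hH : IsSymbol e w H δ) :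
    ∀ᶠ n in atTop, ∀ I χ, al e w (-H) I χ n = -al e w H I χ n := by
  filter_upwards [hH.eventually_gap, hH.atInfty.eventually_gap, eventually_ge_atTop 3]
    with n hg hg' hn I χ
  have hpos := half_pos hH.pos
  have h1 := idx_neg (hH.isHermitian_qs n) (hH.decoup_cell hn I χ) hpos hg
  have h2 := idx_neg (hH.atInfty.isHermitian_qs n) (hH.atInfty.decoup_cell hn I χ) hpos hg'
  rw [← qs_neg] at h1 h2
  have h3 : BorsukUlam.atInfty (-H) = -BorsukUlam.atInfty H := rfl
  rw [al, al, h3]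
  omega

theorem ic_two : ic 2 = -1 := by
  have h4 : ic 2 * ic 2 = 1 := by rw [← ic_add, ← ic_zero]; rfl
  rcases mul_self_eq_one_iff.1 h4 with h | h
  · exact absurd (ic_eq_one h) (by decide)
  · exact h

variable {κ : Type*} [Fintype κ] [DecidableEq κ]

/-- The amplification of a symbol by a diagonal matrix. -/
def amp (H : OnePoint (A → ℂ) → Matrix ι ι ℂ) (d : κ → ℝ) (x : OnePoint (A → ℂ)) :
    Matrix (ι × κ) (ι × κ) ℂ :=
  of fun p q => if p.2 = q.2 then (d p.2 : ℂ) * H x p.1 q.1 else 0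

theorem qs_amp_apply (H : OnePoint (A → ℂ) → Matrix ι ι ℂ) (d : κ → ℝ) (a b : Lat A n) (μ ν : ι)
    (k l : κ) : qs (amp H d) n (a, (μ, k)) (b, (ν, l)) =
      if k = l then (d k : ℂ) * qs H n (a, μ) (b, ν) else 0 := by
  rw [qs, qs, qz_apply, qz_apply]
  simp only [amp, of_apply]
  split_ifs with h
  · rw [Finset.mul_sum]
    exact Finset.sum_congr rfl fun _ _ => by ring
  · simp

theorem idx_qs_amp {H : OnePoint (A → ℂ) → Matrix ι ι ℂ} {d : κ → ℝ} {δ : ℝ}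
    (hT : (qs (amp H d) n).IsHermitian) (hδ : 0 < δ) (hg : Gap (qs (amp H d) n) δ) (k : κ)
    (hk : d k = 1 ∨ d k = -1) :
    Decoup (qs (amp H d) n) {x | x.2.2 = k} ∧ idx (qs (amp H d) n) {x | x.2.2 = k} =
      idx (qs (if d k = 1 then H else -H) n) Set.univ := by
  have hdec : Decoup (qs (amp H d) n) {x | x.2.2 = k} := by
    rintro ⟨a, μ, l⟩ ⟨b, ν, l'⟩ h
    rw [qs_amp_apply] at h
    have : l = l' := by
      by_contra hne
      exact h (if_neg hne)
    simp [this]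
  refine ⟨hdec, ?_⟩
  have himg : (fun x : Lat A n × ι => (x.1, (x.2, k))) '' Set.univ = {x | x.2.2 = k} := by
    ext ⟨a, μ, l⟩
    constructor
    · rintro ⟨⟨b, ν⟩, -, h⟩
      simp only [Prod.mk.injEq] at h
      exact h.2.2.symm
    · intro h
      exact ⟨(a, μ), trivial, by rw [← (show l = k from h)]⟩
  rw [← himg] at hdec ⊢
  symm
  refine idx_image_eq hT hdec hδ hg ?_ ?_
  · rintro ⟨a, μ⟩ - ⟨b, ν⟩ - h
    simp only [Prod.mk.injEq] at h
    exact Prod.ext h.1 h.2.1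
  · rintro ⟨a, μ⟩ - ⟨b, ν⟩ -
    rw [qs_amp_apply, if_pos rfl]
    rcases hk with h | h
    · simp [h]
    · rw [if_neg (by rw [h]; norm_num), qs_neg, h]
      simp

theorem amp_atInfty (H : OnePoint (A → ℂ) → Matrix ι ι ℂ) (d : κ → ℝ) :
    atInfty (amp H d) = amp (atInfty H) d := rfl

theorem eventually_alHat_amp {H : OnePoint (A → ℂ) → Matrix ι ι ℂ} {δ δ' : ℝ}
    (hH : IsSymbol (fun _ => 0) (fun _ => 0) H δ) {d : κ → ℝ} (hd : ∀ k, d k = 1 ∨ d k = -1)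
    {w : ι × κ → ZMod 4} (hw : ∀ p, w p = if d p.2 = 1 then 0 else 2)
    (hK : IsSymbol (fun _ => 0) w (amp H d) δ') :
    ∀ᶠ n in atTop, alHat (fun _ => 0) w (amp H d) ∅ n =
      Fintype.card κ * (al (fun _ => 0) (fun _ => 0) H ∅ 0 n : ℂ) := by
  filter_upwards [hK.eventually_gap, hK.atInfty.eventually_gap, hH.eventually_al_neg]
    with n hg hg' hneg
  have hpos := half_pos hK.pos
  have hcell : ∀ χ, cell (fun _ : A => (0 : ZMod 4)) w ∅ χ n =
      ⋃ k ∈ Finset.univ.filter fun k => (if d k = 1 then (0 : ZMod 4) else 2) = χ,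
        {x : Lat A n × ι × κ | x.2.2 = k} := by
    intro χ
    ext x
    simp [cell, gr, hw]
  have hdisj : Pairwise fun k l : κ => Disjoint {x : Lat A n × ι × κ | x.2.2 = k} {x | x.2.2 = l} :=
    fun k l hne => Set.disjoint_left.2 fun x (h1 : _ = _) (h2 : _ = _) => hne (h1.symm.trans h2)
  have hu : cell (fun _ : A => (0 : ZMod 4)) (fun _ : ι => (0 : ZMod 4)) ∅ 0 n = Set.univ := by
    ext x; simp [cell, gr]
  set α := al (fun _ : A => (0 : ZMod 4)) (fun _ : ι => (0 : ZMod 4)) H ∅ 0 n with hα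
  have hval : ∀ χ, al (fun _ => 0) w (amp H d) ∅ χ n =
      ∑ k ∈ Finset.univ.filter fun k => (if d k = 1 then (0 : ZMod 4) else 2) = χ,
        (if d k = 1 then α else -α) := by
    intro χ
    have h1 := fun k => idx_qs_amp (hK.isHermitian_qs n) hpos hg k (hd k)
    have h2 := fun k => idx_qs_amp (H := atInfty H) (d := d) (hK.atInfty.isHermitian_qs n) hpos
      hg' k (hd k)
    rw [al, hcell, idx_biUnion (hK.isHermitian_qs n) hpos hg _ (fun k => (h1 k).1) hdisj,
      idx_biUnion (hK.atInfty.isHermitian_qs n) hpos hg' _ (fun k => (h2 k).1) hdisj]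
    push_cast
    rw [← Finset.sum_sub_distrib]
    refine Finset.sum_congr rfl fun k _ => ?_
    rw [(h1 k).2, amp_atInfty, (h2 k).2]
    have h3 := hneg ∅ 0
    rw [al, hu] at h3
    split_ifs
    · rw [hα, al, hu]
    · rw [hα, ← h3]; rfl
  simp only [alHat, hval]
  push_cast
  simp only [Finset.sum_mul, Finset.sum_filter]
  rw [Finset.sum_comm]
  have : ∀ k : κ, (∑ χ, (if (if d k = 1 then (0 : ZMod 4) else 2) = χ then
      ((if d k = 1 then (α : ℂ) else -(α : ℂ))) * ic χ else 0)) = α := by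
    intro k
    rw [Finset.sum_ite_eq]
    by_cases h : d k = 1 <;> simp [h, ic_zero, ic_two]
  refine (Finset.sum_congr rfl fun k _ => (Finset.sum_congr rfl fun χ _ => ?_).trans
    (this k)).trans (by simp)
  split_ifs <;> simp

end Invariance

section Quaternionic

open Matrix Filter Topology
open scoped Matrix.Norms.L2Operator ComplexConjugate

variable {X : Type*} [Fintype X] [DecidableEq X]

/-- The antilinear map attached to a matrix. -/
noncomputable def antilin (K : Matrix X X ℂ) :
    EuclideanSpace ℂ X →ₛₗ[starRingEnd ℂ] EuclideanSpace ℂ X where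
  toFun v := WithLp.toLp 2 fun x => ∑ y, K x y * conj (v y)
  map_add' u v := by
    ext x
    simp [mul_add, Finset.sum_add_distrib]
  map_smul' c v := by
    ext x
    simp only [PiLp.smul_apply, smul_eq_mul, map_mul, Finset.mul_sum]
    exact Finset.sum_congr rfl fun y _ => by ring

theorem antilin_apply (K : Matrix X X ℂ) (v : EuclideanSpace ℂ X) (x : X) :
    antilin K v x = ∑ y, K x y * conj (v y) := rfl

theorem even_idx_of_quaternionic {T K : Matrix X X ℂ} {P : Set X} {δ : ℝ} (hT : T.IsHermitian)
    (hP : Decoup T P) (hδ : 0 < δ) (hg : Gap T δ) (hK : K * K.map conj = -1)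
    (hTK : T * K = K * T.map conj) (hKP : Decoup K P) : Even (idx T P) := by
  refine HasSplit.even_of_quaternionic (isSymmetric_of_isHermitian hT) hP.mapsTo hδ
    (fun v _ => hg v) (antilin K) ?_ ?_ ?_ (hasSplit_idx hT hP hδ hg)
  · intro v
    ext x
    have h1 : ∀ z, ∑ y, K x y * conj (K y z) = (-1 : Matrix X X ℂ) x z := by
      intro z
      rw [← hK]
      rfl
    simp only [antilin_apply, map_sum, map_mul, Complex.conj_conj, Finset.mul_sum, ← mul_assoc]
    rw [Finset.sum_comm]
    simp only [← Finset.sum_mul, h1]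
    simp [one_apply]
  · intro v hv x hx
    rw [antilin_apply]
    refine Finset.sum_eq_zero fun y _ => ?_
    by_cases hy : y ∈ P
    · by_cases h0 : K x y = 0
      · rw [h0, zero_mul]
      · exact absurd ((hKP x y h0).2 hy) hx
    · rw [hv y hy, map_zero, mul_zero]
  · intro v
    ext x
    have h1 : ∀ z, ∑ y, T x y * K y z = ∑ y, K x y * conj (T y z) := fun z =>
      congrFun (congrFun hTK x) z
    simp only [antilin_apply, toEuclideanLin_apply_apply, map_sum, map_mul, Finset.mul_sum,
      ← mul_assoc]
    rw [Finset.sum_comm]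
    simp only [← Finset.sum_mul, h1]
    rw [Finset.sum_comm]
    simp only [← Finset.sum_mul]

variable {A ι : Type*} [Fintype A] [DecidableEq A] [Fintype ι] [DecidableEq ι] {n : ℕ}

/-- The antilinear permutation of the coordinates. -/
noncomputable def conjPerm (π : Equiv.Perm A) : OnePoint (A → ℂ) → OnePoint (A → ℂ) :=
  OnePoint.map fun z i => conj (z (π i))

theorem spt_conjPerm (π : Equiv.Perm A) (p : Pos A n × Ang A n) :
    spt (fun i => p.1 (π i), fun i => -p.2 (π i)) = conjPerm π (spt p) := by
  by_cases hs : ∀ i, ((p.1 i : ℕ) : ℝ) / lw n < 3 / 4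
  · rw [spt, spt, pol_of_lt (s := fun i => ((p.1 i : ℕ) : ℝ) / lw n) hs,
      pol_of_lt (s := fun i => ((p.1 (π i) : ℕ) : ℝ) / lw n) fun i => hs (π i), conjPerm,
      OnePoint.map_some]
    congr 1
    funext i
    rw [map_mul, Complex.conj_ofReal, AddChar.map_neg_eq_inv, Circle.coe_inv_eq_conj]
  · push Not at hs
    obtain ⟨i, hi⟩ := hs
    rw [spt, spt, pol_of_le (s := fun i => ((p.1 i : ℕ) : ℝ) / lw n) hi,
      pol_of_le (s := fun i => ((p.1 (π i) : ℕ) : ℝ) / lw n) (i := π.symm i) (by simpa using hi)]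
    rfl

theorem iso_conjPerm (π : Equiv.Perm A) (p : Pos A n × Ang A n) (a : Lat A n) :
    iso A n (fun i => p.1 (π i), fun i => -p.2 (π i)) (fun i => a (π i)) =
      conj (iso A n p a) := by
  have h1 : InBox (fun i => p.1 (π i)) (fun i => a (π i)) ↔ InBox p.1 a :=
    π.forall_congr_left.trans (by simp [InBox])
  have h2 : pair (-fun i => -p.2 (π i)) (red fun i => a (π i)) = conj (pair (-p.2) (red a)) := by
    rw [conj_pair, neg_neg, pair, pair]
    conv_rhs => rw [← Equiv.sum_comp π]
    simp [red]
  rw [iso_apply, iso_apply, h2]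
  simp only [h1, map_mul, map_inv₀, map_pow, map_natCast]
  split_ifs <;> simp

/-- Conjugation of positions and angles by an involution. -/
def conjEquiv (π : Equiv.Perm A) (hπ : ∀ i, π (π i) = i) (n : ℕ) :
    (Pos A n × Ang A n) ≃ (Pos A n × Ang A n) where
  toFun p := (fun i => p.1 (π i), fun i => -p.2 (π i))
  invFun p := (fun i => p.1 (π i), fun i => -p.2 (π i))
  left_inv p := by simp [hπ]
  right_inv p := by simp [hπ]

/-- The matrix of the antilinear structure on the lattice. -/
def latB (π : Equiv.Perm A) (B : Matrix ι ι ℂ) (n : ℕ) : Matrix (Lat A n × ι) (Lat A n × ι) ℂ :=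
  of fun x y => if y.1 = (fun i => x.1 (π i)) then B x.2 y.2 else 0

theorem IsSymbol.eventually_even_idx {e : A → ZMod 4} {w : ι → ZMod 4}
    {H : OnePoint (A → ℂ) → Matrix ι ι ℂ} {δ : ℝ} (hH : IsSymbol e w H δ)
    {π : Equiv.Perm A} (hπ : ∀ i, π (π i) = i) (he : ∀ i, e (π i) = -e i) {B : Matrix ι ι ℂ}
    (hB : B * B.map conj = -1) (hBw : ∀ μ ν, B μ ν ≠ 0 → w μ = -w ν)
    (hBH : ∀ x, H (conjPerm π x) * B = B * (H x).map conj) :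
    ∀ᶠ n in atTop, ∀ χ : ZMod 4, -χ = χ → Even (idx (qs H n) (cell e w ∅ χ n)) := by
  filter_upwards [hH.eventually_gap, eventually_ge_atTop 3] with n hg hn χ hχ
  have hππ : ∀ a b : Lat A n, b = (fun i => a (π i)) ↔ a = fun i => b (π i) := by
    intro a b
    constructor <;> rintro rfl <;> simp [hπ]
  refine even_idx_of_quaternionic (K := latB π B n) (hH.isHermitian_qs n)
    (hH.decoup_cell hn ∅ χ) (half_pos hH.pos) hg ?_ ?_ ?_
  · ext ⟨a, μ⟩ ⟨b, ν⟩
    have h1 := congrFun (congrFun hB μ) ν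
    simp only [mul_apply, Matrix.map_apply] at h1
    simp only [mul_apply, latB, of_apply, Matrix.map_apply, Fintype.sum_prod_type, ite_mul,
      zero_mul]
    rw [Finset.sum_eq_single (fun i => a (π i)) _ (by simp)]
    · simp only [if_true, hπ]
      by_cases hab : b = a
      · subst hab
        simp only [if_true, h1]
        simp [one_apply]
      · simp only [hab, if_false, mul_zero, Finset.sum_const_zero, map_zero, Matrix.neg_apply]
        rw [one_apply_ne fun h => hab (Prod.ext_iff.1 h).1.symm, neg_zero]
    · intro c _ hc
      simp [hc]
  · ext ⟨a, μ⟩ ⟨b, ν⟩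
    simp only [mul_apply, latB, of_apply, Matrix.map_apply, Fintype.sum_prod_type, ite_mul,
      zero_mul, mul_ite, mul_zero, hππ _ b]
    rw [Finset.sum_eq_single (fun i => b (π i)) _ (by simp),
      Finset.sum_eq_single (fun i => a (π i)) _ (by simp)]
    · simp only [if_true, qs, qz_apply, map_sum, map_mul, Complex.conj_conj, Finset.sum_mul,
        Finset.mul_sum]
      rw [Finset.sum_comm]
      conv_rhs => rw [Finset.sum_comm]
      rw [← Equiv.sum_comp (conjEquiv π hπ n)]
      refine Finset.sum_congr rfl fun p _ => ?_
      have h1 : ∀ c : Lat A n, iso A n (conjEquiv π hπ n p) c =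
          conj (iso A n p fun i => c (π i)) := by
        intro c
        rw [← iso_conjPerm π p]
        simp only [hπ]
        rfl
      have h2 : spt (conjEquiv π hπ n p) = conjPerm π (spt p) := spt_conjPerm π p
      have h3 := congrFun (congrFun (hBH (spt p)) μ) ν
      simp only [mul_apply, Matrix.map_apply] at h3
      simp only [h1, h2, hπ, Complex.conj_conj]
      have h4 : ∀ s : ℂ, ∑ ρ, s * H (conjPerm π (spt p)) μ ρ * B ρ ν =
          ∑ ρ, B μ ρ * (s * conj (H (spt p) ρ ν)) := by
        intro s
        simp only [mul_assoc, ← Finset.mul_sum, h3]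
        rw [Finset.mul_sum]
        exact Finset.sum_congr rfl fun ρ _ => by ring
      exact h4 _
    · intro c _ hc
      simp [hc]
    · intro c _ hc
      simp [hc]
  · rintro ⟨a, μ⟩ ⟨b, ν⟩ h
    simp only [latB, of_apply, ne_eq, ite_eq_right_iff, Classical.not_imp] at h
    obtain ⟨rfl, h⟩ := h
    have h1 : gr e w ((fun i => a (π i) : Lat A n), ν) = -gr e w (a, μ) := by
      have h2 := hBw μ ν h
      simp only [gr, neg_add, ← Finset.sum_neg_distrib]
      rw [← Equiv.sum_comp π, h2, neg_neg]
      simp [he, hπ]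
    simp only [cell, Set.mem_inter_iff, Set.mem_setOf_eq, h1]
    rw [neg_eq_iff_eq_neg, hχ]
    simp

theorem IsSymbol.eventually_even_al {e : A → ZMod 4} {w : ι → ZMod 4}
    {H : OnePoint (A → ℂ) → Matrix ι ι ℂ} {δ : ℝ} (hH : IsSymbol e w H δ)
    {π : Equiv.Perm A} (hπ : ∀ i, π (π i) = i) (he : ∀ i, e (π i) = -e i) {B : Matrix ι ι ℂ}
    (hB : B * B.map conj = -1) (hBw : ∀ μ ν, B μ ν ≠ 0 → w μ = -w ν)
    (hBH : ∀ x, H (conjPerm π x) * B = B * (H x).map conj) :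
    ∀ᶠ n in atTop, ∀ χ : ZMod 4, -χ = χ → Even (al e w H ∅ χ n) := by
  filter_upwards [hH.eventually_even_idx hπ he hB hBw hBH,
    hH.atInfty.eventually_even_idx hπ he hB hBw fun _ => hBH OnePoint.infty] with n h1 h2 χ hχ
  exact ((Int.even_coe_nat _).2 (h1 χ hχ)).sub ((Int.even_coe_nat _).2 (h2 χ hχ))

end Quaternionic

section Clifford

open Matrix Filter Topology
open scoped Matrix.Norms.L2Operator ComplexConjugate

/-- Graded Clifford modules over a real representation of `ℤ/4` with quadratic form `Q`. -/
structure CliffMod (F : Type*) [NormedAddCommGroup F] [NormedSpace ℝ F] (σ : F →ₗ[ℝ] F)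
    (ι : Type*) [Fintype ι] [DecidableEq ι] where
  /-- Clifford multiplication. -/
  c : F →ₗ[ℝ] Matrix ι ι ℂ
  /-- The quadratic form. -/
  Q : F → ℝ
  /-- The grading. -/
  d : ι → ℝ
  /-- The weights. -/
  w : ι → ZMod 4
  hd : ∀ μ, d μ = 1 ∨ d μ = -1
  herm : ∀ v, (c v).IsHermitian
  sq : ∀ v, c v * c v = (Q v : ℂ) • (1 : Matrix ι ι ℂ)
  anti : ∀ v μ ν, ((d μ : ℂ) + d ν) * c v μ ν = 0
  cont : Continuous Q
  Q_zero : Q 0 = 0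
  Q_neg : ∀ v, Q (-v) = Q v
  coercive : ∃ δ > 0, ∀ v, δ * ‖v‖ ^ 2 ≤ Q v
  inv : ∀ v, Q (σ v) = Q v
  eqv : ∀ v μ ν, c (σ v) μ ν = ic (w μ - w ν) * c v μ ν

namespace CliffMod

variable {F : Type*} [NormedAddCommGroup F] [NormedSpace ℝ F] [FiniteDimensional ℝ F]
  {σ : F →ₗ[ℝ] F} {ι : Type*} [Fintype ι] [DecidableEq ι] (M : CliffMod F σ ι)

theorem Q_nonneg (v : F) : 0 ≤ M.Q v := by
  obtain ⟨δ, hδ, h⟩ := M.coercive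
  exact (by positivity : 0 ≤ δ * ‖v‖ ^ 2).trans (h v)

theorem Q_pos {v : F} (hv : v ≠ 0) : 0 < M.Q v := by
  obtain ⟨δ, hδ, h⟩ := M.coercive
  have := norm_pos_iff.2 hv
  exact (by positivity : 0 < δ * ‖v‖ ^ 2).trans_le (h v)

/-- Clifford multiplication extended by the grading. -/
noncomputable def cl : F × ℝ →ₗ[ℝ] Matrix ι ι ℂ where
  toFun y := M.c y.1 + (y.2 : ℂ) • diagonal fun μ => (M.d μ : ℂ)
  map_add' y z := by
    simp only [Prod.fst_add, Prod.snd_add, map_add, Complex.ofReal_add, add_smul]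
    abel
  map_smul' t y := by
    simp only [Prod.smul_fst, Prod.smul_snd, _root_.map_smul, smul_eq_mul, Complex.ofReal_mul, mul_smul,
      smul_add, RingHom.id_apply]
    congr 1

theorem cl_apply (y : F × ℝ) : M.cl y = M.c y.1 + (y.2 : ℂ) • diagonal fun μ => (M.d μ : ℂ) := rfl

theorem d_mul_self (μ : ι) : (M.d μ : ℂ) * M.d μ = 1 := by
  rcases M.hd μ with h | h <;> simp [h]

theorem diagonal_mul_add (v : F) : (diagonal fun μ => (M.d μ : ℂ)) * M.c v +
    M.c v * (diagonal fun μ => (M.d μ : ℂ)) = 0 := by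
  ext μ ν
  simp only [Matrix.add_apply, diagonal_mul, mul_diagonal, Matrix.zero_apply]
  linear_combination M.anti v μ ν

theorem diagonal_sq : (diagonal fun μ => (M.d μ : ℂ)) * (diagonal fun μ => (M.d μ : ℂ)) = 1 := by
  rw [diagonal_mul_diagonal]
  simp [d_mul_self]

theorem isHermitian_diagonal_d : (diagonal fun μ => (M.d μ : ℂ)).IsHermitian := by
  rw [isHermitian_diagonal_iff]
  intro μ
  exact Complex.conj_ofReal _

theorem isHermitian_cl (y : F × ℝ) : (M.cl y).IsHermitian := by
  refine (M.herm _).add ?_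
  rw [IsHermitian, conjTranspose_smul, M.isHermitian_diagonal_d.eq, RCLike.star_def,
    Complex.conj_ofReal]

theorem cl_sq (y : F × ℝ) : M.cl y * M.cl y = ((M.Q y.1 + y.2 ^ 2 : ℝ) : ℂ) • 1 := by
  have h : M.cl y * M.cl y = M.c y.1 * M.c y.1 + (y.2 : ℂ) • ((diagonal fun μ => (M.d μ : ℂ)) *
      M.c y.1 + M.c y.1 * (diagonal fun μ => (M.d μ : ℂ))) + ((y.2 : ℂ) ^ 2) •
      ((diagonal fun μ => (M.d μ : ℂ)) * (diagonal fun μ => (M.d μ : ℂ))) := by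
    rw [cl_apply, Matrix.add_mul, Matrix.mul_add, Matrix.mul_add, Matrix.smul_mul, Matrix.smul_mul,
      Matrix.mul_smul, Matrix.mul_smul, smul_smul, smul_add, pow_two]
    abel
  rw [h, diagonal_mul_add, diagonal_sq, sq, smul_zero, add_zero, ← add_smul]
  push_cast
  rfl

theorem gap_cl {y : F × ℝ} {δ : ℝ} (hδ : 0 ≤ δ) (h : δ ^ 2 ≤ M.Q y.1 + y.2 ^ 2) :
    Gap (M.cl y) δ := by
  intro v
  refine le_of_sq_le_sq ?_ (norm_nonneg _)
  have hs := isSymmetric_of_isHermitian (M.isHermitian_cl y)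
  have h1 : ((‖toEuclideanLin (M.cl y) v‖ ^ 2 : ℝ) : ℂ) =
      ((M.Q y.1 + y.2 ^ 2 : ℝ) : ℂ) * ((‖v‖ ^ 2 : ℝ) : ℂ) := by
    have h2 : toEuclideanLin (M.cl y) (toEuclideanLin (M.cl y) v) =
        ((M.Q y.1 + y.2 ^ 2 : ℝ) : ℂ) • v := by
      have h3 : toEuclideanLin (M.cl y * M.cl y) v =
          toEuclideanLin (M.cl y) (toEuclideanLin (M.cl y) v) := by
        simp [toEuclideanLin_apply, mulVec_mulVec]
      rw [← h3, cl_sq]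
      ext μ
      simp [toEuclideanLin_apply, smul_mulVec]
    have h4 := inner_self_eq_norm_sq_to_K (𝕜 := ℂ) (toEuclideanLin (M.cl y) v)
    have h5 := inner_self_eq_norm_sq_to_K (𝕜 := ℂ) v
    rw [hs, h2, inner_smul_right, h5] at h4
    push_cast at h4 ⊢
    exact h4.symm
  rw [← Complex.ofReal_mul, Complex.ofReal_inj] at h1
  rw [mul_pow, h1]
  exact mul_le_mul_of_nonneg_right h (by positivity)

theorem continuous_cl : Continuous M.cl := LinearMap.continuous_of_finiteDimensional _

theorem exists_gap_cl {Z : Type*} [TopologicalSpace Z] [CompactSpace Z] {y : Z → F × ℝ}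
    (hy : Continuous y) (h0 : ∀ z, y z ≠ 0) : ∃ δ > 0, ∀ z, Gap (M.cl (y z)) δ := by
  have hpos : ∀ z, 0 < M.Q (y z).1 + (y z).2 ^ 2 := by
    intro z
    by_cases h : (y z).1 = 0
    · have h2 : (y z).2 ≠ 0 := fun h2 => h0 z (Prod.ext h h2)
      have := M.Q_nonneg (y z).1
      positivity
    · have := M.Q_pos h
      positivity
  have hc : Continuous fun z => M.Q (y z).1 + (y z).2 ^ 2 :=
    (M.cont.comp (continuous_fst.comp hy)).add ((continuous_snd.comp hy).pow 2)
  rcases isEmpty_or_nonempty Z with hZ | hZ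
  · exact ⟨1, one_pos, fun z => hZ.elim z⟩
  obtain ⟨z₀, -, hz₀⟩ := isCompact_univ.exists_isMinOn Set.univ_nonempty hc.continuousOn
  refine ⟨√(M.Q (y z₀).1 + (y z₀).2 ^ 2), Real.sqrt_pos.2 (hpos z₀), fun z => ?_⟩
  refine M.gap_cl (Real.sqrt_nonneg _) ?_
  rw [Real.sq_sqrt (hpos z₀).le]
  exact hz₀ (Set.mem_univ z)

theorem cl_eqv (v : F) (r : ℝ) (μ ν : ι) :
    M.cl (σ v, r) μ ν = ic (M.w μ - M.w ν) * M.cl (v, r) μ ν := by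
  simp only [cl_apply, Matrix.add_apply, Matrix.smul_apply, M.eqv, mul_add, diagonal_apply]
  congr 1
  split_ifs with h
  · rw [h, sub_self, ic_zero, one_mul]
  · simp

/-- Inverse stereographic projection. -/
noncomputable def st (x : OnePoint F) : F × ℝ :=
  x.elim (0, -1) fun v => ((2 / (1 + M.Q v)) • v, (1 - M.Q v) / (1 + M.Q v))

theorem st_infty : M.st OnePoint.infty = (0, -1) := rfl

theorem st_coe (v : F) : M.st v = ((2 / (1 + M.Q v)) • v, (1 - M.Q v) / (1 + M.Q v)) := rfl

theorem continuous_st : Continuous M.st := by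
  have hpos : ∀ v, 0 < 1 + M.Q v := fun v => by linarith [M.Q_nonneg v]
  obtain ⟨δ, hδ, hQ⟩ := M.coercive
  have h1 : Continuous fun v => 1 + M.Q v := continuous_const.add M.cont
  refine continuous_elim_of_decay (C := 4 * (1 + 1 / δ)) ?_ fun v => ?_
  · exact ((continuous_const.div h1 fun v => (hpos v).ne').smul continuous_id).prodMk
      ((continuous_const.sub M.cont).div h1 fun v => (hpos v).ne')
  · have h2 : ‖((2 / (1 + M.Q v)) • v, (1 - M.Q v) / (1 + M.Q v)) - ((0 : F), (-1 : ℝ))‖ ≤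
        2 * (1 + ‖v‖) / (1 + M.Q v) := by
      refine max_le ?_ ?_
      · simp only [Prod.fst_sub, sub_zero, norm_smul, norm_div]
        rw [Real.norm_of_nonneg (hpos v).le, Real.norm_of_nonneg zero_le_two, div_mul_eq_mul_div]
        exact div_le_div_of_nonneg_right (by linarith [norm_nonneg v]) (hpos v).le
      · simp only [Prod.snd_sub]
        have : (1 - M.Q v) / (1 + M.Q v) - -1 = 2 / (1 + M.Q v) := by
          field_simp [(hpos v).ne']
          ring
        rw [this, Real.norm_of_nonneg (div_nonneg zero_le_two (hpos v).le)]
        exact div_le_div_of_nonneg_right (by linarith [norm_nonneg v]) (hpos v).le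
    have h3 : 2 * (1 + ‖v‖) ^ 2 ≤ 4 * (1 + 1 / δ) * (1 + M.Q v) := by
      have h4 : ‖v‖ ^ 2 ≤ 1 / δ * M.Q v := by
        rw [one_div, ← div_eq_inv_mul, le_div_iff₀ hδ]
        linarith [hQ v]
      have h5 : 0 < 1 / δ := by positivity
      nlinarith [sq_nonneg (‖v‖ - 1), M.Q_nonneg v]
    calc _ ≤ 2 * (1 + ‖v‖) / (1 + M.Q v) * (1 + ‖v‖) :=
          mul_le_mul_of_nonneg_right h2 (by positivity)
      _ = 2 * (1 + ‖v‖) ^ 2 / (1 + M.Q v) := by ring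
      _ ≤ _ := by rwa [div_le_iff₀ (hpos v)]

theorem st_ne_zero (x : OnePoint F) : M.st x ≠ 0 := by
  cases x with
  | infty => rw [st_infty]; intro h; simpa using congrArg Prod.snd h
  | coe v =>
    have hpos : 0 < 1 + M.Q v := by linarith [M.Q_nonneg v]
    rw [st_coe]
    intro h
    have h1 := congrArg Prod.fst h
    have h2 := congrArg Prod.snd h
    simp only [Prod.fst_zero, Prod.snd_zero] at h1 h2
    have h3 : v = 0 := by
      rcases smul_eq_zero.1 h1 with h | h
      · exact absurd h (by positivity)
      · exact h
    have h4 : (1 : ℝ) - M.Q v = 0 := by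
      rcases div_eq_zero_iff.1 h2 with h | h
      · exact h
      · exact absurd h hpos.ne'
    rw [h3, M.Q_zero] at h4
    norm_num at h4

theorem st_zero : M.st ((0 : F) : OnePoint F) = (0, 1) := by
  simp [st_coe, M.Q_zero]

theorem st_map (x : OnePoint F) :
    M.st (OnePoint.map σ x) = (σ (M.st x).1, (M.st x).2) := by
  cases x with
  | infty => simp [st_infty]
  | coe v => simp [st_coe, M.inv]

/-- The symbol attached to a Clifford module and a map of spheres. -/
noncomputable def sym {Z : Type*} (g : Z → OnePoint F) (x : Z) : Matrix ι ι ℂ := M.cl (M.st (g x))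

theorem isSymbol_of_eqv {A : Type*} [Fintype A] [DecidableEq A] {e : A → ZMod 4}
    {y : OnePoint (A → ℂ) → F × ℝ} (hy : Continuous y) (h0 : ∀ x, y x ≠ 0)
    (hr : ∀ x, y (rot e x) = (σ (y x).1, (y x).2)) :
    ∃ δ, IsSymbol e M.w (fun x => M.cl (y x)) δ := by
  obtain ⟨δ, hδ, h⟩ := M.exists_gap_cl hy h0
  refine ⟨δ, M.continuous_cl.comp hy, fun x => M.isHermitian_cl _, hδ, h, fun x μ ν => ?_⟩
  rw [hr, M.cl_eqv]

theorem isSymbol_sym {A : Type*} [Fintype A] [DecidableEq A] {e : A → ZMod 4}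
    {g : OnePoint (A → ℂ) → OnePoint F} (hg : Continuous g)
    (hr : ∀ x, g (rot e x) = OnePoint.map σ (g x)) :
    ∃ δ, IsSymbol e M.w (M.sym g) δ :=
  M.isSymbol_of_eqv (M.continuous_st.comp hg) (fun x => M.st_ne_zero _) fun x => by
    simp only [Function.comp_apply, hr, st_map]

theorem sym_of_eq_infty {Z : Type*} {g : Z → OnePoint F} {x : Z} (h : g x = OnePoint.infty) :
    M.sym g x = -diagonal fun μ => (M.d μ : ℂ) := by
  simp [sym, h, st_infty, cl_apply]

theorem sym_of_eq_zero {Z : Type*} {g : Z → OnePoint F} {x : Z} (h : g x = ((0 : F) : OnePoint F)) :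
    M.sym g x = diagonal fun μ => (M.d μ : ℂ) := by
  simp [sym, h, st_zero, cl_apply]

/-- The graded character at the generator. -/
noncomputable def str : ℂ := ∑ μ, (M.d μ : ℂ) * ic (M.w μ)

end CliffMod
end Clifford

section CliffordConstructions

open Matrix Filter Topology
open scoped Matrix.Norms.L2Operator ComplexConjugate Kronecker

namespace CliffMod

variable {F F' : Type*} [NormedAddCommGroup F] [NormedSpace ℝ F] [FiniteDimensional ℝ F]
  [NormedAddCommGroup F'] [NormedSpace ℝ F'] [FiniteDimensional ℝ F']
  {σ : F →ₗ[ℝ] F} {σ' : F' →ₗ[ℝ] F'} {ι ι' : Type*} [Fintype ι] [DecidableEq ι]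
  [Fintype ι'] [DecidableEq ι'] (M : CliffMod F σ ι) (M' : CliffMod F' σ' ι')

theorem inv_pow (m : ℕ) (v : F) : M.Q ((σ ^ m) v) = M.Q v := by
  induction m with
  | zero => simp
  | succ m ih => rw [pow_succ', Module.End.mul_apply, M.inv, ih]

theorem eqv_pow (m : ℕ) (v : F) (μ ν : ι) :
    M.c ((σ ^ m) v) μ ν = ic (m * M.w μ - m * M.w ν) * M.c v μ ν := by
  induction m with
  | zero => simp [ic_zero]
  | succ m ih =>
    rw [pow_succ', Module.End.mul_apply, M.eqv, ih, ← mul_assoc, ← ic_add]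
    congr 2
    push_cast
    ring

/-- Pullback of a Clifford module along an injective map which is equivariant with respect to
the `m`-th power of the action. -/
noncomputable def pull (m : ℕ) (j : F' →ₗ[ℝ] F) (hj : Function.Injective j)
    (h : ∀ v, (σ ^ m) (j v) = j (σ' v)) : CliffMod F' σ' ι where
  c := M.c ∘ₗ j
  Q v := M.Q (j v)
  d := M.d
  w μ := m * M.w μ
  hd := M.hd
  herm v := M.herm _
  sq v := M.sq _
  anti v := M.anti _
  cont := M.cont.comp j.continuous_of_finiteDimensional
  Q_zero := by rw [map_zero, M.Q_zero]
  Q_neg v := by rw [map_neg, M.Q_neg]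
  coercive := by
    obtain ⟨δ, hδ, hQ⟩ := M.coercive
    obtain ⟨K, hK, hK'⟩ := j.exists_antilipschitzWith (LinearMap.ker_eq_bot.2 hj)
    refine ⟨δ / K ^ 2, by positivity, fun v => le_trans ?_ (hQ _)⟩
    have h1 := hK'.le_mul_dist v 0
    rw [map_zero, dist_zero_right, dist_zero_right] at h1
    have h2 : ‖v‖ ^ 2 ≤ (K * ‖j v‖) ^ 2 := pow_le_pow_left₀ (norm_nonneg _) h1 2
    have hK2 : (0 : ℝ) < K ^ 2 := by positivity
    rw [div_mul_eq_mul_div, div_le_iff₀ hK2]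
    nlinarith
  inv v := by rw [← h, M.inv_pow]
  eqv v μ ν := by
    rw [LinearMap.comp_apply, LinearMap.comp_apply, ← h, M.eqv_pow]

/-- The sign action, with weights given by the grading. -/
noncomputable def par : CliffMod F (-LinearMap.id) ι where
  c := M.c
  Q := M.Q
  d := M.d
  w μ := if M.d μ = 1 then 0 else 2
  hd := M.hd
  herm := M.herm
  sq := M.sq
  anti := M.anti
  cont := M.cont
  Q_zero := M.Q_zero
  Q_neg := M.Q_neg
  coercive := M.coercive
  inv v := by
    rw [LinearMap.neg_apply, LinearMap.id_apply, M.Q_neg]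
  eqv v μ ν := by
    have h := M.anti v μ ν
    rcases M.hd μ with h1 | h1 <;> rcases M.hd ν with h2 | h2 <;>
      simp only [h1, h2, LinearMap.neg_apply, LinearMap.id_apply, map_neg, Matrix.neg_apply] at h ⊢ <;>
      norm_num at h ⊢ <;> simp [h, ic_two, show (-2 : ZMod 4) = 2 from rfl]

/-- The graded tensor product of Clifford modules. -/
noncomputable def tensor : CliffMod (F × F') (σ.prodMap σ') (ι × ι') where
  c :=
    { toFun := fun v => M.c v.1 ⊗ₖ (diagonal fun μ => (M'.d μ : ℂ)) + 1 ⊗ₖ M'.c v.2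
      map_add' := fun v v' => by
        simp only [Prod.fst_add, Prod.snd_add, map_add, add_kronecker, kronecker_add]
        abel
      map_smul' := fun t v => by
        simp only [Prod.smul_fst, Prod.smul_snd, _root_.map_smul, smul_kronecker, kronecker_smul, smul_add,
          RingHom.id_apply] }
  Q v := M.Q v.1 + M'.Q v.2
  d μ := M.d μ.1 * M'.d μ.2
  w μ := M.w μ.1 + M'.w μ.2
  hd μ := by
    rcases M.hd μ.1 with h1 | h1 <;> rcases M'.hd μ.2 with h2 | h2 <;> simp [h1, h2]
  herm v := by
    refine IsHermitian.add ?_ ?_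
    · rw [IsHermitian, conjTranspose_kronecker, (M.herm _).eq, M'.isHermitian_diagonal_d.eq]
    · rw [IsHermitian, conjTranspose_kronecker, (M'.herm _).eq, conjTranspose_one]
  sq v := by
    have h := M'.diagonal_mul_add v.2
    simp only [LinearMap.coe_mk, AddHom.coe_mk, Matrix.add_mul, Matrix.mul_add, ← mul_kronecker_mul,
      M.sq, M'.sq, M'.diagonal_sq, one_mul, mul_one, smul_kronecker, kronecker_smul, one_kronecker_one]
    have h1 : M.c v.1 ⊗ₖ (M'.c v.2 * diagonal fun μ => (M'.d μ : ℂ)) +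
        M.c v.1 ⊗ₖ ((diagonal fun μ => (M'.d μ : ℂ)) * M'.c v.2) = 0 := by
      rw [← kronecker_add, add_comm, h, kronecker_zero]
    push_cast
    rw [add_smul]
    refine Eq.trans ?_ (add_zero _)
    rw [← h1]
    abel
  anti v μ ν := by
    have h1 := M.anti v.1 μ.1 ν.1
    have h2 := M'.anti v.2 μ.2 ν.2
    simp only [LinearMap.coe_mk, AddHom.coe_mk, Matrix.add_apply, kroneckerMap_apply,
      diagonal_apply, one_apply, Complex.ofReal_mul]
    by_cases h3 : μ.1 = ν.1 <;> by_cases h4 : μ.2 = ν.2 <;>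
      simp only [h3, h4, if_true, if_false, mul_zero, zero_mul, add_zero, zero_add, one_mul] at h1 h2 ⊢
    · linear_combination (M'.d ν.2 : ℂ) ^ 2 * h1 + M.d ν.1 * h2
    · linear_combination M.d ν.1 * h2
    · linear_combination (M'.d ν.2 : ℂ) ^ 2 * h1
  cont := (M.cont.comp continuous_fst).add (M'.cont.comp continuous_snd)
  Q_zero := by simp [M.Q_zero, M'.Q_zero]
  Q_neg v := by simp [M.Q_neg, M'.Q_neg]
  coercive := by
    obtain ⟨δ, hδ, h⟩ := M.coercive
    obtain ⟨δ', hδ', h'⟩ := M'.coercive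
    refine ⟨min δ δ', lt_min hδ hδ', fun v => ?_⟩
    have h1 := h v.1
    have h2 := h' v.2
    have h3 := M.Q_nonneg v.1
    have h4 := M'.Q_nonneg v.2
    rw [Prod.norm_def]
    rcases max_choice ‖v.1‖ ‖v.2‖ with h5 | h5 <;> rw [h5]
    · have := mul_le_mul_of_nonneg_right (min_le_left δ δ') (sq_nonneg ‖v.1‖)
      linarith
    · have := mul_le_mul_of_nonneg_right (min_le_right δ δ') (sq_nonneg ‖v.2‖)
      linarith
  inv v := by simp [M.inv, M'.inv]
  eqv v μ ν := by
    simp only [LinearMap.coe_mk, AddHom.coe_mk, Matrix.add_apply, kroneckerMap_apply,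
      diagonal_apply, one_apply, LinearMap.prodMap_apply, M.eqv, M'.eqv]
    by_cases h3 : μ.1 = ν.1 <;> by_cases h4 : μ.2 = ν.2 <;>
      simp [h3, h4, ic_zero, mul_add, mul_assoc]

theorem str_tensor : (M.tensor M').str = M.str * M'.str := by
  simp only [str, Fintype.sum_prod_type, Finset.sum_mul_sum]
  refine Finset.sum_congr rfl fun μ _ => Finset.sum_congr rfl fun ν _ => ?_
  simp only [tensor, Complex.ofReal_mul, ic_add]
  ring

theorem str_pull_one {j : F' →ₗ[ℝ] F} (hj : Function.Injective j)
    (h : ∀ v, (σ ^ 1) (j v) = j (σ' v)) : (M.pull 1 j hj h).str = M.str := by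
  simp [str, pull]

/-- The Clifford module over a representation of dimension zero. -/
noncomputable def triv [Subsingleton F] : CliffMod F σ Unit where
  c := 0
  Q _ := 0
  d _ := 1
  w _ := 0
  hd _ := Or.inl rfl
  herm v := by simp
  sq v := by simp
  anti v := by simp
  cont := continuous_const
  Q_zero := rfl
  Q_neg _ := rfl
  coercive := ⟨1, one_pos, fun v => by simp [Subsingleton.elim v 0]⟩
  inv v := rfl
  eqv v μ ν := by simp

theorem str_triv [Subsingleton F] : (triv : CliffMod F σ Unit).str = 1 := by
  simp [str, triv, ic_zero]

/-- Multiplication by a power of the imaginary unit, as a real linear map. -/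
noncomputable def icLin (κ : ZMod 4) : ℂ →ₗ[ℝ] ℂ := LinearMap.mulLeft ℝ (ic κ)

theorem icLin_apply (κ : ZMod 4) (z : ℂ) : icLin κ z = ic κ * z := rfl

theorem ic_neg (t : ZMod 4) : ic (-t) = conj (ic t) := by
  have h1 : ic (-t) * ic t = 1 := by rw [← ic_add, neg_add_cancel, ic_zero]
  have h2 : conj (ic t) * ic t = 1 := by
    rw [← Complex.normSq_eq_conj_mul_self, Complex.normSq_eq_norm_sq, norm_ic]
    norm_num
  have h3 : ic t ≠ 0 := right_ne_zero_of_mul (h1.trans_ne one_ne_zero)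
  exact mul_right_cancel₀ h3 (h1.trans h2.symm)

/-- The exterior algebra of a complex line. -/
noncomputable def line (κ w₀ : ZMod 4) : CliffMod ℂ (icLin κ) (Fin 2) where
  c :=
    { toFun := fun z => !![0, conj z; z, 0]
      map_add' := fun z z' => by ext i j; fin_cases i <;> fin_cases j <;> simp
      map_smul' := fun t z => by ext i j; fin_cases i <;> fin_cases j <;> simp }
  Q := Complex.normSq
  d := ![1, -1]
  w := ![w₀, w₀ + κ]
  hd μ := by fin_cases μ <;> simp
  herm z := by ext i j; fin_cases i <;> fin_cases j <;> simp
  sq z := by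
    ext i j; fin_cases i <;> fin_cases j <;>
      simp [Matrix.mul_apply, Fin.sum_univ_two, ← Complex.mul_conj, mul_comm]
  anti z μ ν := by fin_cases μ <;> fin_cases ν <;> simp
  cont := Complex.continuous_normSq
  Q_zero := by simp
  Q_neg z := Complex.normSq_neg z
  coercive := ⟨1, one_pos, fun z => by rw [one_mul, Complex.normSq_eq_norm_sq]⟩
  inv z := by rw [icLin_apply, Complex.normSq_mul, Complex.normSq_eq_norm_sq (ic κ), norm_ic]; simp
  eqv z μ ν := by
    fin_cases μ <;> fin_cases ν <;> simp [icLin_apply, ← ic_neg]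

theorem str_line (κ w₀ : ZMod 4) : (line κ w₀).str = ic w₀ * (1 - ic κ) := by
  simp [str, line, ic_add]
  ring

end CliffMod
end CliffordConstructions

section Vanishing

open Matrix Filter Topology
open scoped Matrix.Norms.L2Operator ComplexConjugate

section Approximation

variable (A : Type*) [Fintype A] [DecidableEq A]

/-- Continuous functions on the sphere which are continuously differentiable away from infinity. -/
def smoothAlg : StarSubalgebra ℂ C(OnePoint (A → ℂ), ℂ) where
  carrier := {f | ContDiff ℝ 1 fun z : A → ℂ => f (z : OnePoint (A → ℂ))}
  mul_mem' := by
    intro f g hf hg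
    rw [Set.mem_setOf_eq] at hf hg ⊢
    exact hf.mul hg
  add_mem' := by
    intro f g hf hg
    rw [Set.mem_setOf_eq] at hf hg ⊢
    exact hf.add hg
  algebraMap_mem' c := by
    rw [Set.mem_setOf_eq]
    exact contDiff_const
  star_mem' := by
    intro f hf
    rw [Set.mem_setOf_eq] at hf ⊢
    exact Complex.conjCLE.contDiff.comp hf

theorem mem_smoothAlg {f : C(OnePoint (A → ℂ), ℂ)} :
    f ∈ smoothAlg A ↔ ContDiff ℝ 1 fun z : A → ℂ => f (z : OnePoint (A → ℂ)) := Iff.rfl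

theorem topologicalClosure_smoothAlg : (smoothAlg A).topologicalClosure = ⊤ := by
  have h : ContDiff ℝ 1 fun z : A → ℂ => (((1 + ∑ i, ‖z i‖ ^ 2)⁻¹ : ℝ) : ℂ) := by
    refine Complex.ofRealCLM.contDiff.comp (ContDiff.inv ?_ fun z => (one_add_sum_pos z).ne')
    exact contDiff_const.add (ContDiff.sum fun i _ => (contDiff_apply ℝ ℂ i).norm_sq ℝ)
  refine topologicalClosure_eq_top_of_chi_mem _ h fun i => ?_
  exact h.mul (contDiff_apply ℝ ℂ i)

theorem exists_contDiff_near {E : Type*} [NormedAddCommGroup E] [NormedSpace ℝ E]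
    [FiniteDimensional ℝ E] {y : OnePoint (A → ℂ) → E} (hy : Continuous y) {ε : ℝ} (hε : 0 < ε) :
    ∃ y' : OnePoint (A → ℂ) → E, Continuous y' ∧
      (ContDiff ℝ 1 fun z : A → ℂ => y' (z : OnePoint (A → ℂ))) ∧ ∀ x, ‖y x - y' x‖ < ε := by
  set b := Module.finBasis ℝ E
  set C : ℝ := 1 + ∑ k, ‖b k‖ with hC
  have hCpos : 0 < C := by positivity
  have h : ∀ k, ∃ g : C(OnePoint (A → ℂ), ℂ), g ∈ smoothAlg A ∧
      ∀ x, ‖((b.repr (y x) k : ℝ) : ℂ) - g x‖ ≤ ε / (2 * C) := by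
    intro k
    have hk : Continuous fun x => b.repr (y x) k :=
      (LinearMap.continuous_of_finiteDimensional (b.coord k)).comp hy
    set f : C(OnePoint (A → ℂ), ℂ) := ⟨_, Complex.continuous_ofReal.comp hk⟩
    have hmem : f ∈ (smoothAlg A).topologicalClosure :=
      topologicalClosure_smoothAlg A ▸ StarSubalgebra.mem_top
    obtain ⟨g, hg, hgf⟩ := Metric.mem_closure_iff.1 hmem (ε / (2 * C)) (by positivity)
    refine ⟨g, hg, fun x => ?_⟩
    have := (ContinuousMap.dist_apply_le_dist x).trans hgf.le
    rwa [dist_eq_norm] at this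
  choose g hg hgf using h
  refine ⟨fun x => ∑ k, (g k x).re • b k, ?_, ?_, fun x => ?_⟩
  · exact continuous_finset_sum _ fun k _ =>
      (Complex.continuous_re.comp (g k).continuous).smul continuous_const
  · exact ContDiff.sum fun k _ => (Complex.reCLM.contDiff.comp ((mem_smoothAlg A).1 (hg k))).smul contDiff_const
  · conv_lhs => rw [← b.sum_repr (y x), ← Finset.sum_sub_distrib]
    refine (norm_sum_le _ _).trans_lt ?_
    have h1 : ∀ k ∈ Finset.univ, ‖b.repr (y x) k • b k - (g k x).re • b k‖ ≤
        ε / (2 * C) * ‖b k‖ := fun k _ => by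
      rw [← sub_smul, norm_smul]
      refine mul_le_mul_of_nonneg_right (le_trans ?_ (hgf k x)) (norm_nonneg _)
      have := Complex.abs_re_le_norm (((b.repr (y x) k : ℝ) : ℂ) - g k x)
      simpa using this
    refine (Finset.sum_le_sum h1).trans_lt ?_
    rw [← Finset.mul_sum, div_mul_eq_mul_div, div_lt_iff₀ (by positivity)]
    nlinarith

end Approximation

namespace CliffMod

variable {F : Type*} [NormedAddCommGroup F] [NormedSpace ℝ F] [FiniteDimensional ℝ F]
  {σ : F →ₗ[ℝ] F} {ι : Type*} [Fintype ι] [DecidableEq ι]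
  {A : Type*} [Fintype A] [DecidableEq A]

theorem eventually_al_eq_of_homotopy (M : CliffMod F LinearMap.id ι)
    {y₀ y₁ : OnePoint (A → ℂ) → F × ℝ} (h₀ : Continuous y₀) (h₁ : Continuous y₁)
    (h : ∀ x (t : ℝ), 0 ≤ t → t ≤ 1 → (1 - t) • y₀ x + t • y₁ x ≠ 0) :
    ∀ᶠ n in atTop, ∀ χ, al (fun _ => 0) M.w (fun x => M.cl (y₀ x)) ∅ χ n =
      al (fun _ => 0) M.w (fun x => M.cl (y₁ x)) ∅ χ n := by
  obtain ⟨δ, hδ, hg⟩ := M.exists_gap_cl (Z := OnePoint (A → ℂ) × unitInterval)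
    (y := fun z => (1 - (z.2 : ℝ)) • y₀ z.1 + (z.2 : ℝ) • y₁ z.1) (by fun_prop)
    fun z => h z.1 z.2 z.2.2.1 z.2.2.2
  have hs : ∀ y : OnePoint (A → ℂ) → F × ℝ, Continuous y → (∀ x, Gap (M.cl (y x)) δ) →
      IsSymbol (fun _ => 0) M.w (fun x => M.cl (y x)) δ := fun y hy hgy =>
    ⟨M.continuous_cl.comp hy, fun x => M.isHermitian_cl _, hδ, hgy, fun x μ ν => by
      rw [rot_zero]
      exact M.cl_eqv (y x).1 (y x).2 μ ν⟩
  have k₀ := hs y₀ h₀ fun x => by simpa using hg (x, 0)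
  have k₁ := hs y₁ h₁ fun x => by simpa using hg (x, 1)
  filter_upwards [k₀.eventually_al_eq k₁ fun x t ht ht' => by
    have := hg (x, ⟨t, ht, ht'⟩)
    rw [map_add, _root_.map_smul, _root_.map_smul] at this
    exact this] with n hn χ
  exact hn ∅ χ

theorem eventually_al_eq_zero (M : CliffMod F LinearMap.id ι)
    {y : OnePoint (A → ℂ) → F × ℝ} (hy : Continuous y) (h0 : ∀ x, y x ≠ 0)
    (hA : 2 * Fintype.card A < Module.finrank ℝ F) :
    ∀ᶠ n in atTop, ∀ χ, al (fun _ => 0) M.w (fun x => M.cl (y x)) ∅ χ n = 0 := by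
  obtain ⟨x₀, -, hx₀⟩ := isCompact_univ.exists_isMinOn (Set.univ_nonempty (α := OnePoint (A → ℂ)))
    hy.norm.continuousOn
  have hmin : ∀ x, ‖y x₀‖ ≤ ‖y x‖ := fun x => hx₀ (Set.mem_univ x)
  obtain ⟨y', hy', hsm, hnear⟩ := exists_contDiff_near A hy (norm_pos_iff.2 (h0 x₀))
  have hh : ∀ x (t : ℝ), 0 ≤ t → t ≤ 1 → (1 - t) • y x + t • y' x ≠ 0 := by
    intro x t ht ht' h
    have h1 : y x = t • (y x - y' x) := by
      rw [smul_sub, eq_sub_iff_add_eq, ← sub_eq_zero, ← h, sub_smul, one_smul]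
      abel
    have h2 : ‖y x‖ ≤ ‖y x - y' x‖ := by
      conv_lhs => rw [h1, norm_smul, Real.norm_of_nonneg ht]
      exact mul_le_of_le_one_left (norm_nonneg _) ht'
    exact absurd (h2.trans_lt (hnear x)) (not_lt.2 (hmin x))
  have h0' : ∀ x, y' x ≠ 0 := fun x => by simpa using hh x 1 zero_le_one le_rfl
  have hd : Dense (Set.range fun p : ℝ × (A → ℂ) => p.1 • y' (p.2 : OnePoint (A → ℂ)))ᶜ := by
    refine ContDiff.dense_compl_range_of_finrank_lt_finrank
      (contDiff_fst.smul (hsm.comp contDiff_snd)) ?_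
    rw [Module.finrank_prod, Module.finrank_prod, Module.finrank_self, Module.finrank_pi_fintype]
    simp only [Complex.finrank_real_complex, Finset.sum_const, Finset.card_univ, smul_eq_mul]
    omega
  have hproper : (Submodule.span ℝ {y' OnePoint.infty}) ≠ ⊤ := by
    intro h
    have h1 := finrank_span_le_card (R := ℝ) ({y' OnePoint.infty} : Set (F × ℝ))
    rw [h, finrank_top, Module.finrank_prod, Module.finrank_self] at h1
    simp at h1
    omega
  obtain ⟨p, -, hp⟩ := SetLike.exists_of_lt hproper.lt_top
  obtain ⟨q, hq1, hq2⟩ := hd.inter_open_nonempty _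
    (Submodule.closed_of_finiteDimensional (Submodule.span ℝ {y' OnePoint.infty})).isOpen_compl ⟨p, hp⟩
  have hq : ∀ (x : OnePoint (A → ℂ)) (t : ℝ), q ≠ t • y' x := by
    intro x t h
    cases x with
    | infty => exact hq1 (h ▸ Submodule.smul_mem _ _ (Submodule.mem_span_singleton_self _))
    | coe z => exact hq2 ⟨(t, z), h.symm⟩
  have hh' : ∀ x (t : ℝ), 0 ≤ t → t ≤ 1 → (1 - t) • y' x + t • (-q) ≠ 0 := by
    intro x t ht ht' h
    have ht0 : t ≠ 0 := by
      rintro rfl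
      simp [h0' x] at h
    refine hq x (t⁻¹ * (1 - t)) ?_
    rw [smul_neg, ← sub_eq_add_neg, sub_eq_zero] at h
    rw [mul_smul, h, smul_smul, inv_mul_cancel₀ ht0, one_smul]
  filter_upwards [M.eventually_al_eq_of_homotopy hy hy' hh,
    M.eventually_al_eq_of_homotopy hy' continuous_const hh'] with n h1 h2 χ
  rw [h1, h2]
  exact sub_self _

end CliffMod
end Vanishing

section Index

open Matrix Filter Topology
open scoped Matrix.Norms.L2Operator ComplexConjugate

theorem sum_zmod_four {R : Type*} [AddCommMonoid R] (f : ZMod 4 → R) :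
    ∑ χ, f χ = f 0 + f 1 + f 2 + f 3 :=
  Fin.sum_univ_four f

theorem ic_one : ic 1 = Complex.I := by
  have h := ZMod.stdAddChar_coe (N := 4) 1
  rw [Int.cast_one] at h
  rw [ic, h]
  have : 2 * (Real.pi : ℂ) * Complex.I * (1 : ℤ) / (4 : ℕ) = Real.pi / 2 * Complex.I := by
    push_cast; ring
  rw [this, Complex.exp_pi_div_two_mul_I]

theorem ic_three : ic 3 = -Complex.I := by
  rw [show (3 : ZMod 4) = 1 + 2 from rfl, ic_add, ic_one, ic_two, mul_neg_one]

theorem alHat_eq {A ι : Type*} [Fintype A] [DecidableEq A] [Fintype ι] [DecidableEq ι]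
    (e : A → ZMod 4) (w : ι → ZMod 4) (H : OnePoint (A → ℂ) → Matrix ι ι ℂ) (I : Finset A) (n : ℕ) :
    alHat e w H I n = ((al e w H I 0 n - al e w H I 2 n : ℤ) : ℂ) +
      ((al e w H I 1 n - al e w H I 3 n : ℤ) : ℂ) * Complex.I := by
  rw [alHat, sum_zmod_four, ic_zero, ic_one, ic_two, ic_three]
  push_cast
  ring

namespace CliffMod

variable {F : Type*} [NormedAddCommGroup F] [NormedSpace ℝ F] [FiniteDimensional ℝ F]
  {σ : F →ₗ[ℝ] F} {ι : Type*} [Fintype ι] [DecidableEq ι] (M : CliffMod F σ ι)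
  {A : Type*} [Fintype A] [DecidableEq A] {e : A → ZMod 4} {g : OnePoint (A → ℂ) → OnePoint F}

theorem eventually_prod_mul_alHat (hg : Continuous g)
    (hr : ∀ x, g (rot e x) = OnePoint.map σ (g x)) (hinf : g OnePoint.infty = OnePoint.infty)
    (h0 : g ((0 : A → ℂ) : OnePoint (A → ℂ)) = ((0 : F) : OnePoint F)) :
    ∀ᶠ n in atTop, (∏ i, (1 - ic (e i))) * alHat e M.w (M.sym g) ∅ n = M.str := by
  obtain ⟨δ, hH⟩ := M.isSymbol_sym hg hr
  filter_upwards [hH.eventually_alHat, eventually_ge_atTop 3] with n hn h3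
  rw [← hn, alHat_univ e M.w h3 M.hd (M.sym_of_eq_zero h0) (M.sym_of_eq_infty hinf), str]

theorem eventually_al_total (hg : Continuous g)
    (hr : ∀ x, g (rot e x) = OnePoint.map σ (g x)) :
    ∀ᶠ n in atTop, al (fun _ => 0) (fun _ => 0) (M.sym g) ∅ 0 n =
      ∑ χ, al e M.w (M.sym g) ∅ χ n := by
  obtain ⟨δ, hH⟩ := M.isSymbol_sym hg hr
  filter_upwards [hH.eventually_al_coarsen] with n hn
  have := hn 0 ∅ 0
  simpa using this

theorem eventually_al_balance {A₁ A₂ : Type*} [Fintype A₁] [DecidableEq A₁] [Fintype A₂]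
    [DecidableEq A₂] {e : A₁ ⊕ A₂ → ZMod 4} (he₁ : ∀ i, 2 * e (.inl i) = 2)
    (he₂ : ∀ i, 2 * e (.inr i) = 0) {g : OnePoint (A₁ ⊕ A₂ → ℂ) → OnePoint F} (hg : Continuous g)
    (hr : ∀ x, g (rot e x) = OnePoint.map σ (g x))
    (hdim : 2 * Fintype.card A₂ < Module.finrank ℝ (LinearMap.eqLocus (σ ^ 2) LinearMap.id)) :
    ∀ᶠ n in atTop, al e M.w (M.sym g) ∅ 0 n + al e M.w (M.sym g) ∅ 2 n =
      al e M.w (M.sym g) ∅ 1 n + al e M.w (M.sym g) ∅ 3 n := by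
  obtain ⟨δ, hH⟩ := M.isSymbol_sym hg hr
  set p := LinearMap.eqLocus (σ ^ 2) LinearMap.id with hp
  set M' : CliffMod p LinearMap.id ι := M.pull 2 p.subtype p.injective_subtype fun v => v.2 with hM'
  have hfix : ∀ x, (M.st (g (ext A₁ A₂ x))).1 ∈ p := by
    intro x
    have h1 : rot e (rot e (ext A₁ A₂ x)) = ext A₁ A₂ x := by
      have : (fun i => e (Sum.inr i) + e (Sum.inr i) : A₂ → ZMod 4) = fun _ => 0 := by
        funext i; rw [← two_mul, he₂]
      rw [rot_ext, rot_ext, ← rot_add, this, rot_zero]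
    have h2 := congrArg (fun x => (M.st (g x)).1) h1
    simp only [hr, st_map] at h2
    rw [hp, LinearMap.mem_eqLocus, pow_two]
    exact h2
  set y : OnePoint (A₂ → ℂ) → p × ℝ := fun x => (⟨_, hfix x⟩, (M.st (g (ext A₁ A₂ x))).2)
  have hyc : Continuous fun x => M.st (g (ext A₁ A₂ x)) :=
    M.continuous_st.comp (hg.comp continuous_ext)
  have hy : Continuous y := ((continuous_fst.comp hyc).subtype_mk _).prodMk (continuous_snd.comp hyc)
  have hy0 : ∀ x, y x ≠ 0 := fun x h => M.st_ne_zero (g (ext A₁ A₂ x))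
    (Prod.ext (congrArg (fun q : p × ℝ => (q.1 : F)) h) (congrArg (fun q : p × ℝ => q.2) h))
  have hcl : (fun x => M'.cl (y x)) = M.sym g ∘ ext A₁ A₂ := rfl
  have hC := hH.coarsen 2
  filter_upwards [hC.eventually_alHat, hC.eventually_al_ext, hH.eventually_al_coarsen,
    M'.eventually_al_eq_zero hy hy0 hdim] with n h1 h2 h3 h4
  have he₂' : (fun i => ((2 : ℕ) : ZMod 4) * e (Sum.inr i) : A₂ → ZMod 4) = fun _ => 0 :=
    funext he₂
  have h5 : alHat (fun i => ((2 : ℕ) : ZMod 4) * e i) (fun μ => ((2 : ℕ) : ZMod 4) * M.w μ) (M.sym g)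
      (Finset.univ.map .inl) n = 0 := by
    refine Finset.sum_eq_zero fun χ _ => ?_
    rw [h2, he₂', ← hcl]
    rw [hM'] at h4 ⊢
    rw [show al (fun _ => 0) (fun μ => ((2 : ℕ) : ZMod 4) * M.w μ) _ ∅ χ n = 0 from h4 χ]
    simp
  rw [h1] at h5
  have h6 : ∏ i ∈ Finset.univ.map (.inl : A₁ ↪ A₁ ⊕ A₂), (1 - ic (((2 : ℕ) : ZMod 4) * e i)) ≠ 0 := by
    rw [Finset.prod_map]
    refine Finset.prod_ne_zero_iff.2 fun i _ => ?_
    have : ((2 : ℕ) : ZMod 4) * e (Function.Embedding.inl i) = 2 := he₁ i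
    rw [this, ic_two]
    norm_num
  have h7 := (mul_eq_zero.1 h5).resolve_left h6
  rw [alHat_eq] at h7
  have h8 := h3 2 ∅ 0
  have h9 := h3 2 ∅ 2
  rw [show (Finset.univ.filter fun χ : ZMod 4 => ((2 : ℕ) : ZMod 4) * χ = 0) = {0, 2} by decide,
    Finset.sum_pair (by decide)] at h8
  rw [show (Finset.univ.filter fun χ : ZMod 4 => ((2 : ℕ) : ZMod 4) * χ = 2) = {1, 3} by decide,
    Finset.sum_pair (by decide)] at h9
  have h10 := congrArg Complex.re h7
  simp at h10
  have h11 : al (fun i => ((2 : ℕ) : ZMod 4) * e i) (fun μ => ((2 : ℕ) : ZMod 4) * M.w μ) (M.sym g) ∅ 0 n =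
      al (fun i => ((2 : ℕ) : ZMod 4) * e i) (fun μ => ((2 : ℕ) : ZMod 4) * M.w μ) (M.sym g) ∅ 2 n := by
    exact_mod_cast sub_eq_zero.1 h10
  rw [← h8, ← h9, h11]

end CliffMod
end Index

section Smash

open Filter Topology

variable {V V' F F' : Type*}

/-- The collapse of a product of one-point compactifications onto the smash product. -/
def collapse (p : OnePoint F × OnePoint F') : OnePoint (F × F') :=
  p.1.elim OnePoint.infty fun a => p.2.elim OnePoint.infty fun b => ((a, b) : F × F')

theorem collapse_infty_left (b : OnePoint F') :
    collapse ((OnePoint.infty : OnePoint F), b) = OnePoint.infty := rfl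

theorem collapse_infty_right (a : OnePoint F) :
    collapse (a, (OnePoint.infty : OnePoint F')) = OnePoint.infty := by
  cases a <;> rfl

theorem collapse_coe (a : F) (b : F') :
    collapse ((a : OnePoint F), (b : OnePoint F')) = ((a, b) : F × F') := rfl

/-- The smash product of two pointed maps of one-point compactifications. -/
def smash (f : OnePoint V → OnePoint F) (f' : OnePoint V' → OnePoint F') (x : OnePoint (V × V')) :
    OnePoint (F × F') :=
  x.elim OnePoint.infty fun p => collapse (f p.1, f' p.2)

theorem smash_infty (f : OnePoint V → OnePoint F) (f' : OnePoint V' → OnePoint F') :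
    smash f f' OnePoint.infty = OnePoint.infty := rfl

theorem smash_coe (f : OnePoint V → OnePoint F) (f' : OnePoint V' → OnePoint F') (p : V × V') :
    smash f f' p = collapse (f p.1, f' p.2) := rfl

theorem smash_map {τ : V → V} {τ' : V' → V'} {σ : F → F} {σ' : F' → F'}
    {f : OnePoint V → OnePoint F} {f' : OnePoint V' → OnePoint F'}
    (h : ∀ x, f (OnePoint.map τ x) = OnePoint.map σ (f x))
    (h' : ∀ x, f' (OnePoint.map τ' x) = OnePoint.map σ' (f' x)) (x : OnePoint (V × V')) :
    smash f f' (OnePoint.map (Prod.map τ τ') x) = OnePoint.map (Prod.map σ σ') (smash f f' x) := by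
  cases x with
  | infty => rfl
  | coe p =>
    rw [OnePoint.map_some, smash_coe, smash_coe, Prod.map_fst, Prod.map_snd, ← OnePoint.map_some τ,
      ← OnePoint.map_some τ', h, h']
    cases f p.1 <;> cases f' p.2 <;> rfl

variable [TopologicalSpace V] [TopologicalSpace V'] [TopologicalSpace F] [TopologicalSpace F']
  [T2Space V] [T2Space V'] [T2Space F] [T2Space F'] [LocallyCompactSpace V]
  [LocallyCompactSpace V'] [LocallyCompactSpace F] [LocallyCompactSpace F']

theorem continuous_collapse : Continuous (collapse : OnePoint F × OnePoint F' → _) := by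
  have hpre : ∀ s : Set (OnePoint (F × F')), OnePoint.infty ∉ s → collapse ⁻¹' s =
      Prod.map ((↑) : F → OnePoint F) ((↑) : F' → OnePoint F') '' ((↑) ⁻¹' s) := by
    intro s hs
    ext ⟨a, b⟩
    constructor
    · intro h
      cases a with
      | infty => exact absurd h hs
      | coe a =>
        cases b with
        | infty => exact absurd h hs
        | coe b => exact ⟨(a, b), h, rfl⟩
    · rintro ⟨⟨a', b'⟩, h, hab⟩
      rw [Prod.map_apply, Prod.mk.injEq] at hab
      rw [Set.mem_preimage, ← hab.1, ← hab.2]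
      exact h
  rw [continuous_def]
  intro s hs
  rw [OnePoint.isOpen_def] at hs
  by_cases h : OnePoint.infty ∈ s
  · rw [← isClosed_compl_iff, ← Set.preimage_compl, hpre _ (Set.notMem_compl_iff.2 h)]
    exact ((hs.1 h).image
      (OnePoint.continuous_coe.prodMap OnePoint.continuous_coe)).isClosed
  · rw [hpre _ h]
    exact (OnePoint.isOpenEmbedding_coe.prodMap OnePoint.isOpenEmbedding_coe).isOpenMap _ hs.2

theorem surjective_collapse : Function.Surjective (collapse : OnePoint F × OnePoint F' → _) := by
  intro x
  cases x with
  | infty => exact ⟨(OnePoint.infty, OnePoint.infty), rfl⟩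
  | coe p => exact ⟨(p.1, p.2), rfl⟩

theorem continuous_smash {f : OnePoint V → OnePoint F} {f' : OnePoint V' → OnePoint F'}
    (hf : Continuous f) (hf' : Continuous f') (h : f OnePoint.infty = OnePoint.infty)
    (h' : f' OnePoint.infty = OnePoint.infty) : Continuous (smash f f') := by
  have hq : IsQuotientMap (collapse : OnePoint V × OnePoint V' → _) :=
    (continuous_collapse.isClosedMap).isQuotientMap continuous_collapse surjective_collapse
  rw [hq.continuous_iff]
  have : smash f f' ∘ collapse = collapse ∘ Prod.map f f' := by
    funext ⟨a, b⟩
    cases a with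
    | infty => simp [collapse_infty_left, smash_infty, h]
    | coe a =>
      cases b with
      | infty => simp [collapse_infty_right, smash_infty, h']
      | coe b => rfl
  rw [this]
  exact continuous_collapse.comp (hf.prodMap hf')

end Smash

section Divisibility

open Matrix Filter Topology
open scoped Matrix.Norms.L2Operator ComplexConjugate Kronecker

theorem continuous_map_linearEquiv {V F : Type*} [NormedAddCommGroup V] [NormedSpace ℝ V]
    [FiniteDimensional ℝ V] [NormedAddCommGroup F] [NormedSpace ℝ F] (L : V ≃ₗ[ℝ] F) :
    Continuous (OnePoint.map L) := by
  have : FiniteDimensional ℝ F := L.finiteDimensional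
  exact continuous_map_of_isClosedEmbedding L.toContinuousLinearEquiv.toHomeomorph.isClosedEmbedding

/-- Sum and difference of the two blocks of coordinates. -/
noncomputable def sumDiff (A : Type*) : (A ⊕ A → ℂ) ≃ₗ[ℝ] (A → ℂ) × (A → ℂ) where
  toFun x := (fun i => x (.inr i) + x (.inl i), fun i => x (.inr i) - x (.inl i))
  invFun p := Sum.elim (fun i => (p.1 i - p.2 i) / 2) fun i => (p.1 i + p.2 i) / 2
  left_inv x := by
    funext i
    rcases i with i | i <;> simp
  right_inv p := by
    ext i <;> simp <;> ring
  map_add' x y := by ext i <;> simp <;> ring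
  map_smul' t x := by ext i <;> simp <;> ring

/-- Mean and half difference. -/
noncomputable def meanDiff (F : Type*) [AddCommGroup F] [Module ℝ F] : (F × F) ≃ₗ[ℝ] F × F where
  toFun p := ((1 / 2 : ℝ) • (p.1 + p.2), (1 / 2 : ℝ) • (p.1 - p.2))
  invFun p := (p.1 + p.2, p.1 - p.2)
  left_inv p := by ext <;> simp <;> module
  right_inv p := by ext <;> simp <;> module
  map_add' p q := by ext <;> simp <;> module
  map_smul' t p := by ext <;> simp <;> module

namespace CliffMod

variable {F : Type*} [NormedAddCommGroup F] [NormedSpace ℝ F] [FiniteDimensional ℝ F]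
  {σ : F →ₗ[ℝ] F} {ι : Type*} [Fintype ι] [DecidableEq ι] (M : CliffMod F σ ι)
  {A : Type*} [Fintype A] [DecidableEq A] {g : OnePoint (A → ℂ) → OnePoint F}

/-- The external square of a map of spheres, in diagonal and antidiagonal coordinates. -/
noncomputable def square (g : OnePoint (A → ℂ) → OnePoint F) (x : OnePoint (A ⊕ A → ℂ)) :
    OnePoint (F × F) :=
  OnePoint.map (meanDiff F) (smash g g (OnePoint.map (sumDiff A) x))

theorem continuous_square (hg : Continuous g) (hinf : g OnePoint.infty = OnePoint.infty) :
    Continuous (square g) :=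
  (continuous_map_linearEquiv _).comp
    ((continuous_smash hg hg hinf hinf).comp (continuous_map_linearEquiv _))

theorem square_infty : square g OnePoint.infty = OnePoint.infty := rfl

theorem square_rot (x : OnePoint (A ⊕ A → ℂ)) :
    square g (rot (Sum.elim (fun _ => 2) fun _ => 0) x) =
      OnePoint.map ((LinearMap.id : F →ₗ[ℝ] F).prodMap (-LinearMap.id)) (square g x) := by
  cases x with
  | infty => rfl
  | coe z =>
    have h1 : (sumDiff A) (fun i => ic (Sum.elim (fun _ => 2) (fun _ => 0) i) * z i) =
        ((sumDiff A z).2, (sumDiff A z).1) := by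
      ext i <;> simp [sumDiff, ic_two, ic_zero] <;> ring
    rw [square, square, rot, OnePoint.map_some, OnePoint.map_some, OnePoint.map_some, h1,
      smash_coe, smash_coe]
    cases g ((sumDiff A z).1) with
    | infty => simp [collapse_infty_right, collapse_infty_left]
    | coe a =>
      cases g ((sumDiff A z).2) with
      | infty => simp [collapse_infty_right, collapse_infty_left]
      | coe b =>
        simp only [collapse_coe, OnePoint.map_some]
        congr 1
        ext <;> simp [meanDiff] <;> module

theorem square_ext (hinf : g OnePoint.infty = OnePoint.infty) (x : OnePoint (A → ℂ)) :
    square g (ext A A x) = OnePoint.map (fun v => (v, 0)) (g x) := by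
  cases x with
  | infty => rw [hinf]; rfl
  | coe z =>
    have h1 : (sumDiff A) (Sum.elim 0 z) = (z, z) := by
      ext i <;> simp [sumDiff]
    rw [square, ext, OnePoint.map_some, OnePoint.map_some, h1, smash_coe]
    cases g z with
    | infty => rfl
    | coe a =>
      simp only [collapse_coe, OnePoint.map_some]
      congr 1
      ext <;> simp [meanDiff] <;> module

/-- Forget the group action. -/
noncomputable def forget : CliffMod F LinearMap.id ι :=
  M.pull 0 LinearMap.id Function.injective_id fun _ => rfl

theorem forget_w : M.forget.w = fun _ => 0 := by
  funext μ
  simp [forget, pull]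

/-- The Clifford module governing external squares. -/
noncomputable def double : CliffMod (F × F) (LinearMap.id.prodMap (-LinearMap.id)) (ι × ι) :=
  M.forget.tensor M.par

theorem double_w (p : ι × ι) : M.double.w p = if M.d p.2 = 1 then 0 else 2 := by
  change M.forget.w p.1 + M.par.w p.2 = _
  rw [forget_w, zero_add]
  rfl

theorem double_sym_ext (hinf : g OnePoint.infty = OnePoint.infty) :
    M.double.sym (square g) ∘ ext A A = amp (M.sym g) M.d := by
  have hcl : ∀ v r, M.double.cl ((v, 0), r) = M.cl (v, r) ⊗ₖ (diagonal fun μ => (M.d μ : ℂ)) := by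
    intro v r
    rw [cl_apply, cl_apply, add_kronecker, smul_kronecker, diagonal_kronecker_diagonal]
    change (M.c v ⊗ₖ (diagonal fun μ => (M.d μ : ℂ)) + 1 ⊗ₖ M.c 0) + (r : ℂ) •
      (diagonal fun μ : ι × ι => ((M.d μ.1 * M.d μ.2 : ℝ) : ℂ)) = _
    simp
  funext x
  have hst : M.double.st (OnePoint.map (fun v => (v, 0)) (g x)) =
      (((M.st (g x)).1, 0), (M.st (g x)).2) := by
    cases g x with
    | infty => rfl
    | coe v =>
      have hQ : M.double.Q (v, 0) = M.Q v := by
        change M.Q v + M.Q 0 = M.Q v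
        rw [M.Q_zero, add_zero]
      rw [OnePoint.map_some, st_coe, st_coe, hQ]
      simp
  ext ⟨μ, μ'⟩ ⟨ν, ν'⟩
  rw [Function.comp_apply, sym, square_ext hinf, hst, hcl]
  simp only [kroneckerMap_apply, diagonal_apply, amp, of_apply, sym]
  split_ifs <;> simp [mul_comm]

theorem eventually_double (hg : Continuous g) (hinf : g OnePoint.infty = OnePoint.infty) :
    ∀ᶠ n in atTop, ∃ β : ℤ, 2 ^ Fintype.card A * β =
      Fintype.card ι * al (fun _ => 0) (fun _ => 0) (M.sym g) ∅ 0 n ∧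
      2 ∣ al (fun _ => 0) (fun _ => 0) (M.double.sym (square g)) ∅ 0 n - β := by
  obtain ⟨δ, hH⟩ := M.forget.isSymbol_sym (e := fun _ => 0) hg fun x => by
    rw [rot_zero]; cases g x <;> rfl
  rw [forget_w] at hH
  change IsSymbol _ _ (M.sym g) δ at hH
  have hsq := continuous_square hg hinf
  obtain ⟨δ', hK⟩ := M.double.isSymbol_sym hsq square_rot
  have hK' := hK.ext
  rw [double_sym_ext M hinf] at hK'
  filter_upwards [hK.eventually_alHat, hK.eventually_al_ext,
    eventually_alHat_amp hH M.hd M.double_w hK', M.double.eventually_al_total hsq square_rot]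
    with n h1 h2 h3 h4
  rw [double_sym_ext M hinf] at h2
  have h5 : alHat (Sum.elim (fun _ => 2) fun _ => 0 : A ⊕ A → ZMod 4) M.double.w
      (M.double.sym (square g)) (Finset.univ.map .inl) n =
      Fintype.card ι * (al (fun _ => 0) (fun _ => 0) (M.sym g) ∅ 0 n : ℂ) := by
    rw [← h3, alHat, alHat]
    simp only [h2, Sum.elim_inr]
  rw [h1, Finset.prod_map] at h5
  have h6 : ∏ i : A, (1 - ic ((Sum.elim (fun _ => 2) fun _ => 0 : A ⊕ A → ZMod 4)
      (Function.Embedding.inl i))) = 2 ^ Fintype.card A := by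
    simp [ic_two]
    norm_num
  rw [h6, alHat_eq] at h5
  rw [h4, sum_zmod_four]
  generalize al (Sum.elim (fun _ => 2) fun _ => 0 : A ⊕ A → ZMod 4) M.double.w
      (M.double.sym (square g)) ∅ 0 n = β₀ at h5 ⊢
  generalize al (Sum.elim (fun _ => 2) fun _ => 0 : A ⊕ A → ZMod 4) M.double.w
      (M.double.sym (square g)) ∅ 1 n = β₁ at h5 ⊢
  generalize al (Sum.elim (fun _ => 2) fun _ => 0 : A ⊕ A → ZMod 4) M.double.w
      (M.double.sym (square g)) ∅ 2 n = β₂ at h5 ⊢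
  generalize al (Sum.elim (fun _ => 2) fun _ => 0 : A ⊕ A → ZMod 4) M.double.w
      (M.double.sym (square g)) ∅ 3 n = β₃ at h5 ⊢
  generalize al (fun _ => 0) (fun _ => 0) (M.sym g) ∅ 0 n = α at h5 ⊢
  have h7 : ((2 : ℂ) ^ Fintype.card A) = ((2 ^ Fintype.card A : ℝ) : ℂ) := by push_cast; rfl
  have h8 : ((Fintype.card ι : ℂ) * (α : ℂ)) = ((Fintype.card ι * α : ℝ) : ℂ) := by push_cast; rfl
  rw [h7, h8] at h5
  have hre := congrArg Complex.re h5
  have him := congrArg Complex.im h5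
  rw [Complex.re_ofReal_mul] at hre
  rw [Complex.im_ofReal_mul] at him
  simp at hre him
  have h9 : β₁ = β₃ := by
    have : (β₁ : ℝ) - β₃ = 0 := by simpa using him
    exact_mod_cast sub_eq_zero.1 this
  refine ⟨β₀ - β₂, by exact_mod_cast hre, β₂ + β₁, ?_⟩
  rw [h9]
  ring

theorem eventually_two_pow_dvd {N : ℕ} (hι : Fintype.card ι = 2 ^ N) (hN : N < Fintype.card A)
    (hg : Continuous g) (hinf : g OnePoint.infty = OnePoint.infty) :
    ∀ᶠ n in atTop, 2 ^ (Fintype.card A - N + 1) ∣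
      al (fun _ => 0) (fun _ => 0) (M.sym g) ∅ 0 n := by
  filter_upwards [M.eventually_double hg hinf,
    M.double.eventually_double (continuous_square hg hinf) square_infty] with n h1 h2
  have key : ∀ (a N : ℕ) (α β : ℤ), N < a → 2 ^ a * β = ((2 ^ N : ℕ) : ℤ) * α →
      α = 2 ^ (a - N) * β := by
    intro a N α β h h'
    push_cast at h'
    rw [show a = N + (a - N) by omega, pow_add, mul_assoc] at h'
    have := mul_left_cancel₀ (by positivity) h'
    exact this.symm
  obtain ⟨β, hβ, hd⟩ := h1
  obtain ⟨γ, hγ, -⟩ := h2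
  rw [hι] at hβ
  rw [Fintype.card_prod, hι, ← pow_add, Fintype.card_sum] at hγ
  have h3 := key _ _ _ _ hN hβ
  have h4 := key _ _ _ _ (by omega) hγ
  have h5 : (2 : ℤ) ∣ β := by
    have h6 : (2 : ℤ) ∣ al (fun _ => 0) (fun _ => 0) (M.double.sym (square g)) ∅ 0 n := by
      rw [h4]
      exact (dvd_pow_self 2 (by omega)).mul_right _
    exact (dvd_sub_right h6).1 hd
  rw [h3, pow_succ]
  exact mul_dvd_mul_left _ h5

end CliffMod
end Divisibility

section Representations

open Matrix Filter Topology
open scoped Matrix.Norms.L2Operator ComplexConjugate Kronecker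

section RepIso

variable {V V' W W' U : Type*} [AddCommGroup V] [Module ℝ V] [AddCommGroup V'] [Module ℝ V']
  [AddCommGroup W] [Module ℝ W] [AddCommGroup W'] [Module ℝ W'] [AddCommGroup U] [Module ℝ U]

/-- Isomorphism of real vector spaces with an endomorphism. -/
def RepIso (σ : V →ₗ[ℝ] V) (τ : W →ₗ[ℝ] W) : Prop := ∃ L : V ≃ₗ[ℝ] W, ∀ v, L (σ v) = τ (L v)

variable {σ : V →ₗ[ℝ] V} {σ' : V' →ₗ[ℝ] V'} {τ : W →ₗ[ℝ] W} {τ' : W' →ₗ[ℝ] W'} {υ : U →ₗ[ℝ] U}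

theorem RepIso.refl (σ : V →ₗ[ℝ] V) : RepIso σ σ := ⟨.refl ℝ V, fun _ => rfl⟩

theorem RepIso.symm : RepIso σ τ → RepIso τ σ := fun ⟨L, h⟩ => ⟨L.symm, fun v => by
  rw [L.symm_apply_eq, h, L.apply_symm_apply]⟩

theorem RepIso.trans : RepIso σ τ → RepIso τ υ → RepIso σ υ := fun ⟨L, h⟩ ⟨L', h'⟩ =>
  ⟨L.trans L', fun v => by simp [h, h']⟩

theorem RepIso.prod : RepIso σ τ → RepIso σ' τ' → RepIso (σ.prodMap σ') (τ.prodMap τ') :=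
  fun ⟨L, h⟩ ⟨L', h'⟩ => ⟨L.prodCongr L', fun v => by simp [h, h']⟩

theorem RepIso.prodProdProdComm :
    RepIso ((σ.prodMap σ').prodMap (τ.prodMap τ')) ((σ.prodMap τ).prodMap (σ'.prodMap τ')) :=
  ⟨.prodProdProdComm ℝ V V' W W', fun _ => rfl⟩

theorem RepIso.compLeft (h : RepIso σ τ) (k : Type*) : RepIso (σ.compLeft k) (τ.compLeft k) :=
  let ⟨L, hL⟩ := h
  ⟨.piCongrRight fun _ => L, fun v => by ext; simp [hL]⟩

theorem repIso_compLeft_prod (σ : V →ₗ[ℝ] V) (τ : W →ₗ[ℝ] W) (k : Type*) :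
    RepIso ((σ.compLeft k).prodMap (τ.compLeft k)) ((σ.prodMap τ).compLeft k) :=
  ⟨{ toFun := fun p i => (p.1 i, p.2 i)
     invFun := fun x => (fun i => (x i).1, fun i => (x i).2)
     left_inv := fun _ => rfl
     right_inv := fun _ => rfl
     map_add' := fun _ _ => rfl
     map_smul' := fun _ _ => rfl }, fun _ => rfl⟩

theorem repIso_compLeft_add (σ : V →ₗ[ℝ] V) (k l : ℕ) :
    RepIso (σ.compLeft (Fin (k + l))) ((σ.compLeft (Fin k)).prodMap (σ.compLeft (Fin l))) :=
  ⟨(LinearEquiv.funCongrLeft ℝ V finSumFinEquiv).trans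
    (LinearEquiv.sumArrowLequivProdArrow (Fin k) (Fin l) ℝ V), fun _ => rfl⟩

theorem repIso_compLeft_one (σ : V →ₗ[ℝ] V) : RepIso (σ.compLeft (Fin 1)) σ :=
  ⟨LinearEquiv.funUnique (Fin 1) ℝ V, fun _ => rfl⟩

theorem repIso_compLeft_two_mul (σ : V →ₗ[ℝ] V) (k : ℕ) :
    RepIso (σ.compLeft (Fin (2 * k))) ((σ.prodMap σ).compLeft (Fin k)) := by
  rw [two_mul]
  exact (repIso_compLeft_add σ k k).trans (repIso_compLeft_prod σ σ (Fin k))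

theorem repIso_neg_prod_neg :
    RepIso ((-LinearMap.id : ℝ →ₗ[ℝ] ℝ).prodMap (-LinearMap.id : ℝ →ₗ[ℝ] ℝ)) (CliffMod.icLin 2) :=
  ⟨Complex.equivRealProdLm.symm, fun v => by
    rw [CliffMod.icLin_apply, ic_two, neg_one_mul, ← map_neg]
    rfl⟩

end RepIso

namespace CliffMod

variable {F F' : Type*} [NormedAddCommGroup F] [NormedSpace ℝ F] [FiniteDimensional ℝ F]
  [NormedAddCommGroup F'] [NormedSpace ℝ F'] [FiniteDimensional ℝ F']
  {σ : F →ₗ[ℝ] F} {σ' : F' →ₗ[ℝ] F'} {ι ι' : Type*} [Fintype ι] [DecidableEq ι]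
  [Fintype ι'] [DecidableEq ι'] {M : CliffMod F σ ι} {M' : CliffMod F' σ' ι'}

/-- Existence of an antilinear structure with square `q`, compatible with the involution `θ`. -/
def HasQuat (M : CliffMod F σ ι) (θ : F →ₗ[ℝ] F) (q : ℝ) (B : Matrix ι ι ℂ) : Prop :=
  B * B.map conj = (q : ℂ) • 1 ∧ (∀ μ ν, B μ ν ≠ 0 → M.w μ = -M.w ν) ∧
    (∀ μ ν, B μ ν ≠ 0 → M.d μ = M.d ν) ∧ (∀ v, M.c (θ v) * B = B * (M.c v).map conj) ∧
    ∀ v, M.Q (θ v) = M.Q v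

theorem HasQuat.grading_mul {θ : F →ₗ[ℝ] F} {q : ℝ} {B : Matrix ι ι ℂ} (h : M.HasQuat θ q B) :
    (diagonal fun μ => (M.d μ : ℂ)) * B = B * (diagonal fun μ => (M.d μ : ℂ)).map conj := by
  ext μ ν
  rw [diagonal_map (by simp), diagonal_mul, mul_diagonal]
  by_cases h0 : B μ ν = 0
  · simp [h0]
  · simp [h.2.2.1 μ ν h0, mul_comm]

theorem map_conj_kronecker (S : Matrix ι ι ℂ) (T : Matrix ι' ι' ℂ) :
    (S ⊗ₖ T).map conj = S.map conj ⊗ₖ T.map conj := by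
  ext
  simp

theorem HasQuat.tensor {θ : F →ₗ[ℝ] F} {θ' : F' →ₗ[ℝ] F'} {q q' : ℝ} {B : Matrix ι ι ℂ}
    {B' : Matrix ι' ι' ℂ} (h : M.HasQuat θ q B) (h' : M'.HasQuat θ' q' B') :
    (M.tensor M').HasQuat (θ.prodMap θ') (q * q') (B ⊗ₖ B') := by
  refine ⟨?_, ?_, ?_, fun v => ?_, fun v => ?_⟩
  · rw [map_conj_kronecker, ← mul_kronecker_mul, h.1, h'.1, smul_kronecker, kronecker_smul,
      one_kronecker_one, smul_smul]
    push_cast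
    rfl
  · rintro ⟨μ, μ'⟩ ⟨ν, ν'⟩ hB
    rw [kroneckerMap_apply] at hB
    change M.w μ + M'.w μ' = -(M.w ν + M'.w ν')
    rw [h.2.1 _ _ (left_ne_zero_of_mul hB), h'.2.1 _ _ (right_ne_zero_of_mul hB), neg_add]
  · rintro ⟨μ, μ'⟩ ⟨ν, ν'⟩ hB
    rw [kroneckerMap_apply] at hB
    change M.d μ * M'.d μ' = M.d ν * M'.d ν'
    rw [h.2.2.1 _ _ (left_ne_zero_of_mul hB), h'.2.2.1 _ _ (right_ne_zero_of_mul hB)]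
  · change (M.c (θ v.1) ⊗ₖ (diagonal fun μ => (M'.d μ : ℂ)) + 1 ⊗ₖ M'.c (θ' v.2)) * _ =
      _ * (M.c v.1 ⊗ₖ (diagonal fun μ => (M'.d μ : ℂ)) + 1 ⊗ₖ M'.c v.2).map conj
    rw [Matrix.map_add _ (by simp), map_conj_kronecker, map_conj_kronecker, Matrix.add_mul,
      Matrix.mul_add, ← mul_kronecker_mul, ← mul_kronecker_mul, ← mul_kronecker_mul,
      ← mul_kronecker_mul, h.2.2.2.1, h'.grading_mul, h'.2.2.2.1, Matrix.map_one _ (by simp) (by simp),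
      one_mul, mul_one]
  · change M.Q (θ v.1) + M'.Q (θ' v.2) = M.Q v.1 + M'.Q v.2
    rw [h.2.2.2.2, h'.2.2.2.2]

theorem hasQuat_block (κ : ZMod 4) {r : ℝ} (hr : r = 1 ∨ r = -1) :
    ∃ B, ((line κ 0).tensor (line κ (-κ))).HasQuat (r • LinearMap.id) (-1) B := by
  refine ⟨of fun μ ν => if μ = (1, 1) ∧ ν = (0, 0) then 1 else if μ = (0, 0) ∧ ν = (1, 1) then -1 else
    if μ = (0, 1) ∧ ν = (1, 0) then -(r : ℂ) else if μ = (1, 0) ∧ ν = (0, 1) then (r : ℂ) else 0,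
    ?_, ?_, ?_, fun v => ?_, fun v => ?_⟩
  · ext ⟨a, b⟩ ⟨a', b'⟩
    fin_cases a <;> fin_cases b <;> fin_cases a' <;> fin_cases b' <;>
      rcases hr with rfl | rfl <;>
      simp [Matrix.mul_apply, Fintype.sum_prod_type, Fin.sum_univ_two]
  · rintro ⟨a, b⟩ ⟨a', b'⟩
    fin_cases a <;> fin_cases b <;> fin_cases a' <;> fin_cases b' <;> simp [tensor, line]
  · rintro ⟨a, b⟩ ⟨a', b'⟩
    fin_cases a <;> fin_cases b <;> fin_cases a' <;> fin_cases b' <;> simp [tensor, line]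
  · ext ⟨a, b⟩ ⟨a', b'⟩
    fin_cases a <;> fin_cases b <;> fin_cases a' <;> fin_cases b' <;>
      rcases hr with rfl | rfl <;>
      simp [Matrix.mul_apply, Fintype.sum_prod_type, Fin.sum_univ_two, tensor, line]
  · rcases hr with rfl | rfl
    · simp
    · rw [LinearMap.smul_apply, LinearMap.id_apply, neg_one_smul ℝ v, Q_neg]

theorem HasQuat.pull {r q : ℝ} {B : Matrix ι ι ℂ} (h : M.HasQuat (r • LinearMap.id) q B)
    {j : F' →ₗ[ℝ] F} (hj : Function.Injective j) (hσ : ∀ v, (σ ^ 1) (j v) = j (σ' v)) :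
    (M.pull 1 j hj hσ).HasQuat (r • LinearMap.id) q B := by
  refine ⟨h.1, fun μ ν hB => ?_, h.2.2.1, fun v => ?_, fun v => ?_⟩
  · simpa [CliffMod.pull] using h.2.1 μ ν hB
  · have := h.2.2.2.1 (j v)
    simpa [CliffMod.pull] using this
  · have := h.2.2.2.2 (j v)
    simpa [CliffMod.pull] using this

/-- Existence of a Clifford module of dimension `2 ^ N` with graded character `s`. -/
def HasMod (σ : F →ₗ[ℝ] F) (N : ℕ) (s : ℂ) : Prop :=
  ∃ (ι : Type) (_ : Fintype ι) (_ : DecidableEq ι) (M : CliffMod F σ ι),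
    Fintype.card ι = 2 ^ N ∧ M.str = s

/-- Existence of a Clifford module with antilinear structure of dimension `2 ^ N` with graded
character `s`. -/
def HasQMod (σ : F →ₗ[ℝ] F) (r : ℝ) (N : ℕ) (s : ℂ) (q : ℝ) : Prop :=
  ∃ (ι : Type) (_ : Fintype ι) (_ : DecidableEq ι) (M : CliffMod F σ ι),
    Fintype.card ι = 2 ^ N ∧ M.str = s ∧ ∃ B, M.HasQuat (r • LinearMap.id) q B

theorem HasMod.prod {N N' : ℕ} {s s' : ℂ} : HasMod σ N s → HasMod σ' N' s' →
    HasMod (σ.prodMap σ') (N + N') (s * s') := by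
  rintro ⟨ι, _, _, M, h, rfl⟩ ⟨ι', _, _, M', h', rfl⟩
  exact ⟨ι × ι', inferInstance, inferInstance, M.tensor M', by rw [Fintype.card_prod, h, h', pow_add],
    M.str_tensor M'⟩

theorem smul_id_prodMap (r : ℝ) : (r • LinearMap.id : F →ₗ[ℝ] F).prodMap
    (r • LinearMap.id : F' →ₗ[ℝ] F') = r • LinearMap.id := by
  ext <;> simp

theorem HasQMod.prod {r : ℝ} {N N' : ℕ} {s s' : ℂ} {q q' : ℝ} : HasQMod σ r N s q →
    HasQMod σ' r N' s' q' → HasQMod (σ.prodMap σ') r (N + N') (s * s') (q * q') := by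
  rintro ⟨ι, _, _, M, h, rfl, B, hB⟩ ⟨ι', _, _, M', h', rfl, B', hB'⟩
  have hBB := hB.tensor hB'
  rw [smul_id_prodMap] at hBB
  exact ⟨ι × ι', inferInstance, inferInstance, M.tensor M', by rw [Fintype.card_prod, h, h', pow_add],
    M.str_tensor M', B ⊗ₖ B', hBB⟩

theorem HasMod.congr {N : ℕ} {s : ℂ} (h : HasMod σ N s) (hσ : RepIso σ' σ) : HasMod σ' N s := by
  obtain ⟨ι, _, _, M, h, rfl⟩ := h
  obtain ⟨L, hL⟩ := hσ
  exact ⟨ι, inferInstance, inferInstance, M.pull 1 L.toLinearMap L.injective fun v => by simp [hL], h,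
    M.str_pull_one _ _⟩

theorem HasQMod.congr {r : ℝ} {N : ℕ} {s : ℂ} {q : ℝ} (h : HasQMod σ r N s q) (hσ : RepIso σ' σ) :
    HasQMod σ' r N s q := by
  obtain ⟨ι, _, _, M, h, rfl, B, hB⟩ := h
  obtain ⟨L, hL⟩ := hσ
  exact ⟨ι, inferInstance, inferInstance, M.pull 1 L.toLinearMap L.injective fun v => by simp [hL], h,
    M.str_pull_one _ _, B, hB.pull _ _⟩

theorem HasMod.compLeft {N : ℕ} {s : ℂ} (h : HasMod σ N s) (k : ℕ) :
    HasMod (σ.compLeft (Fin k)) (k * N) (s ^ k) := by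
  induction k with
  | zero => exact ⟨Unit, inferInstance, inferInstance, triv, by simp, by rw [str_triv, pow_zero]⟩
  | succ k ih =>
    rw [Nat.succ_mul, pow_succ]
    exact (ih.prod h).congr
      ((repIso_compLeft_add σ k 1).trans ((RepIso.refl _).prod (repIso_compLeft_one σ)))

theorem HasQMod.compLeft {r : ℝ} {N : ℕ} {s : ℂ} {q : ℝ} (h : HasQMod σ r N s q) (k : ℕ) :
    HasQMod (σ.compLeft (Fin k)) r (k * N) (s ^ k) (q ^ k) := by
  induction k with
  | zero =>
    refine ⟨Unit, inferInstance, inferInstance, triv, by simp, by rw [str_triv, pow_zero], 1, ?_⟩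
    refine ⟨?_, fun _ _ _ => by simp [triv], fun _ _ _ => rfl, fun v => ?_, fun _ => rfl⟩
    · rw [Matrix.map_one _ (by simp) (by simp)]
      simp
    · simp [triv]
  | succ k ih =>
    rw [Nat.succ_mul, pow_succ, pow_succ]
    exact (ih.prod h).congr
      ((repIso_compLeft_add σ k 1).trans ((RepIso.refl _).prod (repIso_compLeft_one σ)))

theorem hasMod_icLin (κ : ZMod 4) : HasMod (icLin κ) 1 (1 - ic κ) :=
  ⟨Fin 2, inferInstance, inferInstance, line κ 0, by simp, by rw [str_line, ic_zero, one_mul]⟩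

theorem hasQMod_icLin (κ : ZMod 4) {r : ℝ} (hr : r = 1 ∨ r = -1) :
    HasQMod ((icLin κ).prodMap (icLin κ)) r 2 ((1 - ic κ) * (ic (-κ) * (1 - ic κ))) (-1) :=
  ⟨Fin 2 × Fin 2, inferInstance, inferInstance, (line κ 0).tensor (line κ (-κ)), by simp,
    by rw [str_tensor, str_line, str_line, ic_zero, one_mul], hasQuat_block κ hr⟩

end CliffMod

/-- The representation on `ℂ ^ n × ℝ ^ m`. -/
noncomputable def rep (n m : ℕ) : (Fin n → ℂ) × (Fin m → ℝ) →ₗ[ℝ] (Fin n → ℂ) × (Fin m → ℝ) :=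
  ((CliffMod.icLin 1).compLeft (Fin n)).prodMap ((-LinearMap.id : ℝ →ₗ[ℝ] ℝ).compLeft (Fin m))

theorem repIso_rep_add (n m n' m' : ℕ) :
    RepIso (rep (n + n') (m + m')) ((rep n m).prodMap (rep n' m')) :=
  ((repIso_compLeft_add _ n n').prod (repIso_compLeft_add _ m m')).trans RepIso.prodProdProdComm

theorem repIso_rep_two_mul (n m : ℕ) : RepIso (rep n (2 * m))
    (((CliffMod.icLin 1).compLeft (Fin n)).prodMap ((CliffMod.icLin 2).compLeft (Fin m))) :=
  (RepIso.refl _).prod ((repIso_compLeft_two_mul _ m).trans (repIso_neg_prod_neg.compLeft _))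

theorem hasQMod_rep (a b : ℕ) {r : ℝ} (hr : r = 1 ∨ r = -1) :
    CliffMod.HasQMod (rep (2 * a) (2 * (2 * b))) r (2 * (a + b)) ((-2) ^ a * (-4) ^ b)
      ((-1) ^ (a + b)) := by
  have h1 := (CliffMod.hasQMod_icLin 1 hr).compLeft a
  have h2 := (CliffMod.hasQMod_icLin 2 hr).compLeft b
  have h3 : (1 - ic 1) * (ic (-1) * (1 - ic 1)) = -2 := by
    rw [show (-1 : ZMod 4) = 3 from rfl, ic_one, ic_three]
    linear_combination (2 - Complex.I) * Complex.I_mul_I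
  have h4 : (1 - ic 2) * (ic (-2) * (1 - ic 2)) = -4 := by
    rw [show (-2 : ZMod 4) = 2 from rfl, ic_two]
    norm_num
  rw [h3] at h1
  rw [h4] at h2
  have h5 := (h1.prod h2).congr ((repIso_rep_two_mul (2 * a) (2 * b)).trans
    ((repIso_compLeft_two_mul _ a).prod (repIso_compLeft_two_mul _ b)))
  rwa [← add_mul, mul_comm (a + b) 2, ← pow_add] at h5

end Representations

section EquivariantMaps

open Filter Topology

variable {V V' F F' W : Type*} [NormedAddCommGroup V] [NormedSpace ℝ V] [FiniteDimensional ℝ V]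
  [NormedAddCommGroup V'] [NormedSpace ℝ V'] [FiniteDimensional ℝ V']
  [NormedAddCommGroup F] [NormedSpace ℝ F] [FiniteDimensional ℝ F]
  [NormedAddCommGroup F'] [NormedSpace ℝ F'] [FiniteDimensional ℝ F']
  [NormedAddCommGroup W] [NormedSpace ℝ W] [FiniteDimensional ℝ W]
  {σ : V →ₗ[ℝ] V} {σ' : V' →ₗ[ℝ] V'} {τ : F →ₗ[ℝ] F} {τ' : F' →ₗ[ℝ] F'} {υ : W →ₗ[ℝ] W}

/-- Existence of an equivariant map of one-point compactifications fixing `0` and `∞`. -/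
def HasMap (σ : V →ₗ[ℝ] V) (τ : F →ₗ[ℝ] F) : Prop :=
  ∃ f : OnePoint V → OnePoint F, Continuous f ∧ f OnePoint.infty = OnePoint.infty ∧
    f ((0 : V) : OnePoint V) = ((0 : F) : OnePoint F) ∧
    ∀ x, f (OnePoint.map σ x) = OnePoint.map τ (f x)

theorem hasMap_of_injective (L : V →ₗ[ℝ] F) (hL : Function.Injective L)
    (h : ∀ v, L (σ v) = τ (L v)) : HasMap σ τ := by
  refine ⟨OnePoint.map L, continuous_map_of_isClosedEmbedding
    (LinearMap.isClosedEmbedding_of_injective (LinearMap.ker_eq_bot.2 hL)), rfl, ?_, fun x => ?_⟩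
  · rw [OnePoint.map_some, map_zero]
  · cases x with
    | infty => rfl
    | coe v => simp only [OnePoint.map_some, h]

theorem RepIso.hasMap (h : RepIso σ τ) : HasMap σ τ :=
  let ⟨L, hL⟩ := h
  hasMap_of_injective L.toLinearMap L.injective hL

theorem HasMap.trans : HasMap σ τ → HasMap τ υ → HasMap σ υ :=
  fun ⟨f, h1, h2, h3, h4⟩ ⟨g, k1, k2, k3, k4⟩ =>
    ⟨g ∘ f, k1.comp h1, by rw [Function.comp_apply, h2, k2], by rw [Function.comp_apply, h3, k3],
      fun x => by rw [Function.comp_apply, h4, k4, Function.comp_apply]⟩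

theorem HasMap.smash : HasMap σ τ → HasMap σ' τ' → HasMap (σ.prodMap σ') (τ.prodMap τ') :=
  fun ⟨f, h1, h2, h3, h4⟩ ⟨g, k1, k2, k3, k4⟩ =>
    ⟨BorsukUlam.smash f g, continuous_smash h1 k1 h2 k2, rfl, by
      rw [smash_coe, Prod.fst_zero, Prod.snd_zero, h3, k3]
      rfl, smash_map h4 k4⟩

theorem HasMap.rep_add {n m n' m' p q p' q' : ℕ} (h : HasMap (rep n m) (rep p q))
    (h' : HasMap (rep n' m') (rep p' q')) :
    HasMap (rep (n + n') (m + m')) (rep (p + p') (q + q')) :=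
  ((repIso_rep_add n m n' m').hasMap.trans (h.smash h')).trans
    (repIso_rep_add p q p' q').symm.hasMap

theorem hasMap_rep_self (n m : ℕ) : HasMap (rep n m) (rep n m) := (RepIso.refl _).hasMap

theorem hasMap_rep_zero (n m : ℕ) : HasMap (rep 0 0) (rep n m) :=
  hasMap_of_injective 0 (fun _ _ _ => Subsingleton.elim _ _) fun v => by simp

/-- The diagonal representation with the given weights. -/
noncomputable def rotLin {A : Type*} (e : A → ZMod 4) : (A → ℂ) →ₗ[ℝ] (A → ℂ) :=
  LinearMap.pi fun i => (CliffMod.icLin (e i)).comp (LinearMap.proj i)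

theorem map_rotLin {A : Type*} (e : A → ZMod 4) : OnePoint.map (rotLin e) = rot e := rfl

theorem repIso_rotLin (n m : ℕ) : RepIso
    (rotLin (Sum.elim (fun _ => 1) (fun _ => 2) : Fin n ⊕ Fin m → ZMod 4)) (rep n (2 * m)) := by
  refine RepIso.trans ?_ (repIso_rep_two_mul n m).symm
  exact ⟨LinearEquiv.sumArrowLequivProdArrow _ _ ℝ ℂ, fun _ => rfl⟩

theorem two_mul_le_finrank_eqLocus (n m : ℕ) : 2 * m ≤ Module.finrank ℝ (LinearMap.eqLocus
    ((((CliffMod.icLin 1).compLeft (Fin n)).prodMap ((CliffMod.icLin 2).compLeft (Fin m))) ^ 2)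
    LinearMap.id) := by
  have h := LinearMap.finrank_le_finrank_of_injective (R := ℝ) (M := Fin m → ℂ)
    (f := (LinearMap.inr ℝ (Fin n → ℂ) (Fin m → ℂ)).codRestrict (LinearMap.eqLocus
    ((((CliffMod.icLin 1).compLeft (Fin n)).prodMap ((CliffMod.icLin 2).compLeft (Fin m))) ^ 2)
    LinearMap.id) ?_) ?_
  · rwa [Module.finrank_pi_fintype, Finset.sum_const, Complex.finrank_real_complex, smul_eq_mul,
      Finset.card_univ, Fintype.card_fin, mul_comm] at h
  · intro v
    rw [LinearMap.mem_eqLocus, pow_two]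
    ext i <;> simp [CliffMod.icLin_apply, ic_two]
  · intro v w hvw
    simpa using congrArg Subtype.val hvw

theorem add_two_le_of_hasMap {n₀ n₁ m₀ m₁ : ℕ}
    (h : HasMap (rep n₀ (2 * m₀)) (rep n₁ (2 * m₁))) (hm : m₀ < m₁) (hk : n₁ + m₁ < n₀ + m₀) :
    n₀ + 2 * m₀ + 2 ≤ n₁ + 2 * m₁ := by
  obtain ⟨ι, _, _, M, hι, hs⟩ :=
    ((CliffMod.hasMod_icLin 1).compLeft n₁).prod ((CliffMod.hasMod_icLin 2).compLeft m₁)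
  obtain ⟨g, hg, hinf, h0, hr⟩ :=
    ((repIso_rotLin n₀ m₀).hasMap.trans h).trans (repIso_rep_two_mul n₁ m₁).hasMap
  rw [map_rotLin] at hr
  rw [mul_one, mul_one] at hι
  obtain ⟨n, h1, h2, h3, h4⟩ := ((M.eventually_prod_mul_alHat hg hr hinf h0).and
    ((M.eventually_al_total hg hr).and ((M.eventually_al_balance (by simp)
      (by intro i; simp only [Sum.elim_inr]; rfl) hg hr
      (by rw [Fintype.card_fin]; exact (by omega : 2 * m₀ < 2 * m₁).trans_le
            (two_mul_le_finrank_eqLocus n₁ m₁))).and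
    (M.eventually_two_pow_dvd hι (by simpa using hk) hg hinf)))).exists
  rw [h2, sum_zmod_four] at h4
  rw [alHat_eq, hs, Fintype.prod_sum_type] at h1
  generalize al _ M.w (M.sym g) ∅ 0 n = α₀ at *
  generalize al _ M.w (M.sym g) ∅ 1 n = α₁ at *
  generalize al _ M.w (M.sym g) ∅ 2 n = α₂ at *
  generalize al _ M.w (M.sym g) ∅ 3 n = α₃ at *
  simp only [Sum.elim_inl, Sum.elim_inr, Finset.prod_const, Finset.card_univ, Fintype.card_fin,
    ic_one, ic_two] at h1
  have h5 : (4 : ℤ) ∣ α₀ + α₁ + α₂ + α₃ := by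
    refine Dvd.dvd.trans ?_ h4
    rw [show (4 : ℤ) = 2 ^ 2 by norm_num]
    refine pow_dvd_pow _ ?_
    simp only [Fintype.card_sum, Fintype.card_fin]
    omega
  obtain ⟨a, ha⟩ : (2 : ℤ) ∣ α₀ - α₂ := by omega
  obtain ⟨b, hb⟩ : (2 : ℤ) ∣ α₁ - α₃ := by omega
  rw [ha, hb] at h1
  have h6 := congrArg Complex.normSq h1
  have h7 : Complex.normSq (1 - Complex.I) = 2 := by norm_num [Complex.normSq_apply]
  have h8 : Complex.normSq (1 - -1) = 4 := by norm_num [Complex.normSq_apply]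
  have h9 : Complex.normSq (((2 * a : ℤ) : ℂ) + ((2 * b : ℤ) : ℂ) * Complex.I) =
      ((2 ^ 2 * (a ^ 2 + b ^ 2) : ℤ) : ℝ) := by
    simp [Complex.normSq_apply]
    ring
  rw [map_mul, map_mul, map_mul, map_pow, map_pow, map_pow, map_pow, h7, h8, h9] at h6
  have h10 : (2 : ℤ) ^ (n₀ + 2 * m₀ + 2) * (a ^ 2 + b ^ 2) = 2 ^ (n₁ + 2 * m₁) := by
    have : (2 : ℤ) ^ n₀ * 4 ^ m₀ * (2 ^ 2 * (a ^ 2 + b ^ 2)) = 2 ^ n₁ * 4 ^ m₁ := by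
      exact_mod_cast h6
    rw [pow_add, pow_add, pow_add, pow_mul, pow_mul, show (2 : ℤ) ^ 2 = 4 by norm_num]
    rw [show (2 : ℤ) ^ 2 = 4 by norm_num] at this
    linarith
  have h11 : (2 : ℤ) ^ (n₀ + 2 * m₀ + 2) ∣ 2 ^ (n₁ + 2 * m₁) := ⟨_, h10.symm⟩
  have h12 : 2 ^ (n₀ + 2 * m₀ + 2) ∣ 2 ^ (n₁ + 2 * m₁) := by exact_mod_cast h11
  exact (Nat.pow_dvd_pow_iff_le_right (by norm_num)).1 h12

end EquivariantMaps

section QuaternionicObstruction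

open Matrix Filter Topology
open scoped Matrix.Norms.L2Operator ComplexConjugate

theorem CliffMod.HasQuat.sym_mul {F : Type*} [NormedAddCommGroup F] [NormedSpace ℝ F]
    [FiniteDimensional ℝ F] {σ : F →ₗ[ℝ] F} {ι : Type*} [Fintype ι] [DecidableEq ι]
    {M : CliffMod F σ ι} {θ : F →ₗ[ℝ] F} {q : ℝ} {B : Matrix ι ι ℂ} (h : M.HasQuat θ q B)
    {Z : Type*} {g : Z → OnePoint F} {x y : Z} (hxy : g y = OnePoint.map θ (g x)) :
    M.sym g y * B = B * (M.sym g x).map conj := by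
  have h1 : M.st (g y) = (θ (M.st (g x)).1, (M.st (g x)).2) := by
    rw [hxy]
    cases g x with
    | infty =>
      rw [OnePoint.map_infty, st_infty]
      simp
    | coe v =>
      rw [OnePoint.map_some, st_coe, st_coe, h.2.2.2.2]
      simp
  rw [CliffMod.sym, CliffMod.sym, h1, cl_apply, cl_apply, Matrix.map_add _ (by simp),
    Matrix.add_mul, Matrix.mul_add, h.2.2.2.1, Matrix.smul_mul, h.grading_mul,
    Matrix.map_smulₛₗ conj (σ := conj) _ (by simp), Matrix.mul_smul, Complex.conj_ofReal]

/-- Decomposition of the complexification of a representation into complex lines. -/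
noncomputable def complexify (n m : ℕ) : ((Fin n ⊕ Fin n) ⊕ Fin m → ℂ) ≃ₗ[ℝ]
    ((Fin n → ℂ) × (Fin m → ℝ)) × ((Fin n → ℂ) × (Fin m → ℝ)) where
  toFun u := ((fun i => (u (.inl (.inl i)) + conj (u (.inl (.inr i)))) / 2, fun j => (u (.inr j)).re),
    (fun i => (u (.inl (.inl i)) - conj (u (.inl (.inr i)))) * (-Complex.I / 2),
      fun j => (u (.inr j)).im))
  invFun p := Sum.elim (Sum.elim (fun i => p.1.1 i + Complex.I * p.2.1 i)
    (fun i => conj (p.1.1 i) + Complex.I * conj (p.2.1 i))) (fun j => ⟨p.1.2 j, p.2.2 j⟩)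
  map_add' u v := by
    ext i <;> simp <;> ring
  map_smul' r u := by
    ext i <;> simp <;> ring
  left_inv u := by
    ext ((i | i) | j)
    · simp only [Sum.elim_inl]
      linear_combination (-(u (.inl (.inl i)) - conj (u (.inl (.inr i)))) / 2) * Complex.I_mul_I
    · simp only [Sum.elim_inl, Sum.elim_inr, map_div₀, map_add, map_mul, map_neg, map_sub,
        Complex.conj_conj, Complex.conj_I, map_ofNat]
      linear_combination ((conj (u (.inl (.inl i))) - u (.inl (.inr i))) / 2) * Complex.I_mul_I
    · rfl
  right_inv p := by
    refine Prod.ext (Prod.ext (funext fun i => ?_) rfl) (Prod.ext (funext fun i => ?_) rfl)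
    · simp only [Sum.elim_inl, Sum.elim_inr, map_add, map_mul, Complex.conj_conj, Complex.conj_I]
      ring
    · simp only [Sum.elim_inl, Sum.elim_inr, map_add, map_mul, Complex.conj_conj, Complex.conj_I]
      linear_combination (-p.2.1 i) * Complex.I_mul_I

/-- The weights of the complexification. -/
def weight (n m : ℕ) : (Fin n ⊕ Fin n) ⊕ Fin m → ZMod 4 :=
  Sum.elim (Sum.elim (fun _ => 1) fun _ => -1) fun _ => 2

theorem ic_neg_one : ic (-1) = -Complex.I := by
  rw [show (-1 : ZMod 4) = 3 from rfl, ic_three]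

theorem complexify_rotLin (n m : ℕ) (u : (Fin n ⊕ Fin n) ⊕ Fin m → ℂ) :
    complexify n m (rotLin (weight n m) u) = ((rep n m).prodMap (rep n m)) (complexify n m u) := by
  refine Prod.ext (Prod.ext (funext fun i => ?_) (funext fun i => ?_))
    (Prod.ext (funext fun i => ?_) (funext fun i => ?_)) <;>
  simp [complexify, rotLin, weight, rep, CliffMod.icLin_apply, ic_one, ic_two, ic_neg_one] <;> ring

/-- The permutation exchanging conjugate weights. -/
def swapPerm (n m : ℕ) : Equiv.Perm ((Fin n ⊕ Fin n) ⊕ Fin m) :=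
  (Equiv.sumComm _ _).sumCongr (Equiv.refl _)

theorem complexify_conj (n m : ℕ) (u : (Fin n ⊕ Fin n) ⊕ Fin m → ℂ) :
    complexify n m (fun i => conj (u (swapPerm n m i))) =
      Prod.map id (fun v => -v) (complexify n m u) := by
  refine Prod.ext (Prod.ext (funext fun i => ?_) (funext fun i => ?_))
    (Prod.ext (funext fun i => ?_) (funext fun i => ?_)) <;>
  simp [complexify, swapPerm] <;> ring

theorem add_le_finrank_eqLocus (n m n' m' : ℕ) : m + m' ≤ Module.finrank ℝ (LinearMap.eqLocus
    (((rep n m).prodMap (rep n' m')) ^ 2) LinearMap.id) := by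
  have h := LinearMap.finrank_le_finrank_of_injective (R := ℝ) (M := (Fin m → ℝ) × (Fin m' → ℝ))
    (f := ((LinearMap.inr ℝ (Fin n → ℂ) (Fin m → ℝ)).prodMap
      (LinearMap.inr ℝ (Fin n' → ℂ) (Fin m' → ℝ))).codRestrict (LinearMap.eqLocus
    (((rep n m).prodMap (rep n' m')) ^ 2) LinearMap.id) ?_) ?_
  · simpa using h
  · intro v
    rw [LinearMap.mem_eqLocus, pow_two]
    ext i <;> simp [rep]
  · intro v w hvw
    have := congrArg Subtype.val hvw
    simpa [Prod.ext_iff] using this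

theorem not_hasMap_rep {n₀ m₀ n₁ m₁ a b t : ℕ} (hn₀ : n₀ = 2 * (a + 4 * t + 3))
    (hm₀ : m₀ = 2 * (2 * b)) (hn₁ : n₁ = 2 * a) (hm₁ : m₁ = 2 * (2 * (b + 2 * t + 2))) :
    ¬ HasMap (rep n₀ m₀) (rep n₁ m₁) := by
  have H₁ := hasQMod_rep a (b + 2 * t + 2) (r := 1) (Or.inl rfl)
  have H₂ := hasQMod_rep (a + 4 * t + 3) b (r := -1) (Or.inr rfl)
  rw [← hn₁, ← hm₁] at H₁
  rw [← hn₀, ← hm₀] at H₂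
  rintro ⟨f, hf, hfinf, hf0, hfr⟩
  obtain ⟨ι₁, _, _, M₁, hι₁, hs₁, B₁, hB₁⟩ := H₁
  obtain ⟨ι₂, _, _, M₂, hι₂, hs₂, B₂, hB₂⟩ := H₂
  have hB := hB₁.tensor hB₂
  have hs := M₁.str_tensor M₂
  have hι : Fintype.card (ι₁ × ι₂) = 2 ^ (2 * (a + (b + 2 * t + 2)) + 2 * (a + 4 * t + 3 + b)) := by
    rw [Fintype.card_prod, hι₁, hι₂, pow_add]
  rw [hs₁, hs₂] at hs
  set M := M₁.tensor M₂
  set g : OnePoint ((Fin n₀ ⊕ Fin n₀) ⊕ Fin m₀ → ℂ) → _ :=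
    smash f id ∘ OnePoint.map (complexify n₀ m₀) with hgdef
  have hg : Continuous g := (continuous_smash hf continuous_id hfinf rfl).comp
    (continuous_map_linearEquiv _)
  have hinf : g OnePoint.infty = OnePoint.infty := rfl
  have h0 : g ((0 : (Fin n₀ ⊕ Fin n₀) ⊕ Fin m₀ → ℂ) : OnePoint _) =
      ((0 : ((Fin n₁ → ℂ) × (Fin m₁ → ℝ)) × ((Fin n₀ → ℂ) × (Fin m₀ → ℝ))) : OnePoint _) := by
    rw [hgdef, Function.comp_apply, OnePoint.map_some, map_zero, smash_coe, Prod.fst_zero, hf0]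
    rfl
  have hr : ∀ x, g (rot (weight n₀ m₀) x) = OnePoint.map ((rep n₁ m₁).prodMap (rep n₀ m₀)) (g x) := by
    intro x
    refine Eq.trans ?_ (smash_map (f' := id) (τ' := rep n₀ m₀) hfr (fun _ => rfl) _)
    rw [hgdef, Function.comp_apply, ← map_rotLin]
    cases x with
    | infty => rfl
    | coe u =>
      simp only [OnePoint.map_some, complexify_rotLin]
      rfl
  have hc : ∀ x, g (conjPerm (swapPerm n₀ m₀) x) = OnePoint.map
      (((1 : ℝ) • LinearMap.id : (Fin n₁ → ℂ) × (Fin m₁ → ℝ) →ₗ[ℝ] _).prodMap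
        ((-1 : ℝ) • LinearMap.id : (Fin n₀ → ℂ) × (Fin m₀ → ℝ) →ₗ[ℝ] _)) (g x) := by
    intro x
    have hθ : ⇑(((1 : ℝ) • LinearMap.id :
        (Fin n₁ → ℂ) × (Fin m₁ → ℝ) →ₗ[ℝ] _).prodMap
        ((-1 : ℝ) • LinearMap.id : (Fin n₀ → ℂ) × (Fin m₀ → ℝ) →ₗ[ℝ] _)) =
        Prod.map id fun v => -v := by
      ext v <;> simp
    rw [hθ]
    refine Eq.trans ?_ (smash_map (f' := id) (τ := id) (τ' := fun v => -v)
      (fun x => by simp [OnePoint.map_id]) (fun _ => rfl) _)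
    rw [hgdef, Function.comp_apply, conjPerm]
    cases x with
    | infty => rfl
    | coe u => simp only [OnePoint.map_some, complexify_conj]
  obtain ⟨δ, hδ⟩ := M.isSymbol_sym hg hr
  have hcard : Fintype.card ((Fin n₀ ⊕ Fin n₀) ⊕ Fin m₀) = n₀ + n₀ + m₀ := by simp
  have hq : (((-1) ^ (a + (b + 2 * t + 2)) * (-1) ^ (a + 4 * t + 3 + b) : ℝ) : ℂ) •
      (1 : Matrix (ι₁ × ι₂) (ι₁ × ι₂) ℂ) = -1 := by
    rw [← pow_add, Odd.neg_one_pow ⟨a + b + 3 * t + 2, by ring⟩]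
    simp
  obtain ⟨n, h1, h2, h3, h4, h5⟩ := ((M.eventually_prod_mul_alHat hg hr hinf h0).and
    ((M.eventually_al_total hg hr).and ((M.eventually_al_balance
      (by rintro (i | i) <;> rfl) (by intro i; rfl) hg hr
      (by
        rw [Fintype.card_fin]
        refine lt_of_lt_of_le ?_ (add_le_finrank_eqLocus _ _ _ _)
        omega)).and
    ((M.eventually_two_pow_dvd hι (by rw [hcard]; omega) hg hinf).and
    (hδ.eventually_even_al (π := swapPerm n₀ m₀) (by rintro ((i | i) | i) <;> rfl)
      (by rintro ((i | i) | i) <;> rfl) (hB.1.trans hq) hB.2.1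
      (fun x => hB.sym_mul (hc x))))))).exists
  rw [h2, sum_zmod_four] at h4
  obtain ⟨x, hx⟩ := h5 0 rfl
  obtain ⟨y, hy⟩ := h5 2 rfl
  rw [alHat_eq, hs, Fintype.prod_sum_type, Fintype.prod_sum_type] at h1
  generalize al _ M.w (M.sym g) ∅ 0 n = α₀ at *
  generalize al _ M.w (M.sym g) ∅ 1 n = α₁ at *
  generalize al _ M.w (M.sym g) ∅ 2 n = α₂ at *
  generalize al _ M.w (M.sym g) ∅ 3 n = α₃ at *
  simp only [weight, Sum.elim_inl, Sum.elim_inr, Finset.prod_const, Finset.card_univ,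
    Fintype.card_fin, ic_one, ic_two, ic_neg_one] at h1
  have h6 : (8 : ℤ) ∣ α₀ + α₁ + α₂ + α₃ := by
    refine Dvd.dvd.trans ?_ h4
    rw [show (8 : ℤ) = 2 ^ 3 by norm_num]
    refine pow_dvd_pow _ ?_
    rw [hcard]
    omega
  have h7 : (1 - Complex.I) * (1 - -Complex.I) = 2 := by
    linear_combination -Complex.I_mul_I
  have h8 : (2 : ℂ) ^ (n₀ + m₀) * (((α₀ - α₂ : ℤ) : ℂ) + ((α₁ - α₃ : ℤ) : ℂ) * Complex.I) =
      2 ^ (n₀ + m₀) * (-2) := by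
    have h9 : (-2 : ℂ) ^ a * (-4) ^ (b + 2 * t + 2) * ((-2) ^ (a + 4 * t + 3) * (-4) ^ b) =
        (-2) ^ (2 * (a + 2 * t + 1) + 1) * (-4) ^ (2 * (b + t + 1)) := by ring
    rw [← mul_pow, h7, h9, Odd.neg_pow ⟨_, rfl⟩, Even.neg_pow ⟨_, two_mul _⟩,
      show (1 : ℂ) - -1 = 2 by norm_num, ← pow_add, show (4 : ℂ) = 2 ^ 2 by norm_num, ← pow_mul] at h1
    rw [h1, hn₀, hm₀]
    ring
  have h9 := congrArg Complex.re (mul_left_cancel₀ (pow_ne_zero _ two_ne_zero) h8)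
  have h10 : α₀ - α₂ = -2 := by
    simp only [Complex.add_re, Complex.intCast_re, Complex.mul_re, Complex.I_re, Complex.I_im,
      Complex.intCast_im, Complex.neg_re, Complex.re_ofNat, mul_zero, zero_mul, sub_zero,
      add_zero] at h9
    exact_mod_cast h9
  omega

end QuaternionicObstruction

section Reduction

open Filter Topology

/-- The quadratic map underlying the Hopf fibration, anti-invariant under multiplication by `i`. -/
noncomputable def hopf (v : (Fin 2 → ℂ) × (Fin 0 → ℝ)) : (Fin 0 → ℂ) × (Fin 3 → ℝ) :=
  (0, ![(v.1 0 ^ 2 + v.1 1 ^ 2).re, 2 * (v.1 0 * v.1 1).im, (v.1 1 ^ 2 - v.1 0 ^ 2).im])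

theorem norm_sq_le_hopf (v : (Fin 2 → ℂ) × (Fin 0 → ℝ)) : ‖v‖ ^ 2 ≤ 2 * ‖hopf v‖ := by
  have h1 : ∀ i, (hopf v).2 i ^ 2 ≤ ‖hopf v‖ ^ 2 := fun i => by
    rw [← sq_abs, ← Real.norm_eq_abs]
    gcongr
    exact (norm_le_pi_norm _ i).trans (le_max_right _ _)
  have h2 : (Complex.normSq (v.1 0) + Complex.normSq (v.1 1)) ^ 2 =
      (hopf v).2 0 ^ 2 + (hopf v).2 1 ^ 2 + (hopf v).2 2 ^ 2 := by
    simp [hopf, Complex.normSq_apply, pow_two]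
    ring
  have h3 : ‖v‖ ^ 2 ≤ Complex.normSq (v.1 0) + Complex.normSq (v.1 1) := by
    have h4 : ‖v‖ = ‖v.1‖ := by
      rw [Prod.norm_def, Subsingleton.elim v.2 0, norm_zero]
      exact max_eq_left (norm_nonneg _)
    obtain ⟨i, hi⟩ : ∃ i, ‖v.1‖ = ‖v.1 i‖ := by
      obtain ⟨i, -, hi⟩ := Finset.exists_mem_eq_sup Finset.univ Finset.univ_nonempty fun i => ‖v.1 i‖₊
      exact ⟨i, by rw [Pi.norm_def, hi, coe_nnnorm]⟩
    rw [h4, hi, ← Complex.normSq_eq_norm_sq]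
    fin_cases i
    · exact le_add_of_nonneg_right (Complex.normSq_nonneg _)
    · exact le_add_of_nonneg_left (Complex.normSq_nonneg _)
  have h4 := norm_nonneg (hopf v)
  refine h3.trans (abs_le_of_sq_le_sq' ?_ (by positivity)).2
  nlinarith [h1 0, h1 1, h1 2]

theorem hasMap_hopf : HasMap (rep 2 0) (rep 0 3) := by
  have hc : Continuous hopf := by
    unfold hopf
    refine continuous_const.prodMk (continuous_pi fun i => ?_)
    fin_cases i <;> simp <;> fun_prop
  refine ⟨OnePoint.map hopf, OnePoint.continuous_map hc ?_, rfl, ?_, fun x => ?_⟩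
  · rw [coclosedCompact_eq_cocompact, coclosedCompact_eq_cocompact,
      ← Metric.cobounded_eq_cocompact, ← Metric.cobounded_eq_cocompact,
      ← tendsto_norm_atTop_iff_cobounded]
    have h1 : Tendsto (fun v : (Fin 2 → ℂ) × (Fin 0 → ℝ) => ‖v‖ ^ 2 / 2)
        (Bornology.cobounded _) atTop :=
      ((tendsto_pow_atTop two_ne_zero).comp tendsto_norm_cobounded_atTop).atTop_div_const two_pos
    exact tendsto_atTop_mono (fun v => by linarith [norm_sq_le_hopf v]) h1
  · rw [OnePoint.map_some]
    congr 1
    ext i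
    · exact i.elim0
    · fin_cases i <;> simp [hopf]
  · cases x with
    | infty => rfl
    | coe v =>
      simp only [OnePoint.map_some]
      congr 1
      ext i
      · exact i.elim0
      · fin_cases i <;>
          simp [hopf, rep, CliffMod.icLin_apply, ic_one, pow_two] <;> ring

variable {n₀ n₁ m₀ m₁ : ℕ}

theorem HasMap.add_two_le (h : HasMap (rep n₀ m₀) (rep n₁ m₁)) (hm : m₀ < m₁)
    (hk : 2 * n₁ + m₁ < 2 * n₀ + m₀) (he : Even (m₀ + m₁)) : n₀ + m₀ + 2 ≤ n₁ + m₁ := by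
  obtain ⟨c, p, hp⟩ : ∃ c p, m₀ + c = 2 * p := ⟨m₀, m₀, by ring⟩
  obtain ⟨q, hq⟩ : ∃ q, m₁ + c = 2 * q := by
    obtain ⟨s, hs⟩ := he
    exact ⟨s + p - m₀, by omega⟩
  have h1 := h.rep_add (hasMap_rep_self 0 c)
  rw [hp, hq, Nat.add_zero, Nat.add_zero] at h1
  have := add_two_le_of_hasMap h1 (by omega) (by omega)
  omega

theorem HasMap.add_one_le (h : HasMap (rep n₀ m₀) (rep n₁ m₁)) (hn : n₁ + 2 ≤ n₀) (hm : m₀ < m₁) :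
    n₀ + m₀ + 1 ≤ n₁ + m₁ := by
  by_contra hlt
  rcases Nat.even_or_odd (m₀ + m₁) with he | ⟨s, hs⟩
  · have := h.add_two_le hm (by omega) he
    omega
  · have := (h.rep_add (hasMap_rep_zero 0 1)).add_two_le (by omega) (by omega) ⟨s + 1, by omega⟩
    omega

theorem HasMap.ne_add_two (h : HasMap (rep n₀ m₀) (rep n₁ m₁)) {t : ℕ} (hn : n₀ = n₁ + 8 * t + 6) :
    m₁ ≠ m₀ + 8 * t + 8 := by
  intro hm
  exact not_hasMap_rep (a := n₁) (b := m₀) (t := t) (by omega) (by omega) (by omega) (by omega)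
    (h.rep_add (hasMap_rep_self n₁ (3 * m₀)))

theorem HasMap.add_crabbStolzA_le (h : HasMap (rep n₀ m₀) (rep n₁ m₁)) (hn : n₁ + 2 ≤ n₀)
    (hm : m₀ < m₁) : ((n₀ : ℤ) - n₁) + crabbStolzA ((n₀ : ℤ) - n₁) ≤ (m₁ : ℤ) - m₀ := by
  have h1 := h.add_one_le hn hm
  have h2 : Even (m₀ + m₁) → 2 * n₁ + m₁ < 2 * n₀ + m₀ → n₀ + m₀ + 2 ≤ n₁ + m₁ :=
    fun he hk => h.add_two_le hm hk he
  rw [Nat.even_iff] at h2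
  have h3 : ∀ t, n₀ = n₁ + 8 * t + 6 → m₁ ≠ m₀ + 8 * t + 8 := fun t => h.ne_add_two
  have h4 : ∀ t, n₀ = n₁ + 8 * t + 6 → m₁ ≠ m₀ + 8 * t + 7 := fun t ht hm =>
    (h.rep_add (hasMap_rep_zero 0 1)).ne_add_two (t := t) (by omega) (by omega)
  have h5 : ∀ t, n₀ = n₁ + 8 * t + 4 → m₁ ≠ m₀ + 8 * t + 5 := fun t ht hm =>
    (h.rep_add hasMap_hopf).ne_add_two (t := t) (by omega) (by omega)
  specialize h3 ((n₀ - n₁) / 8)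
  specialize h4 ((n₀ - n₁) / 8)
  specialize h5 ((n₀ - n₁) / 8)
  rw [crabbStolzA]
  split_ifs <;> omega

end Reduction

end BorsukUlam

/-- **Refined Borsuk–Ulam type theorem.**  If `n₀ - n₁ ≥ 2`, `m₁ - m₀ ≥ 1` and there is
a continuous pointed map `f : (ℂ₊^{n₀} ⊕ ℝ̃^{m₀})⁺ → (ℂ₊^{n₁} ⊕ ℝ̃^{m₁})⁺` with
`f ∞ = ∞`, `f 0 = 0`, intertwining the `ℤ/4`-actions generated by `σ`, then
`(n₀ - n₁) + A (n₀ - n₁) ≤ m₁ - m₀`. -/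
theorem refined_borsuk_ulam (n₀ n₁ m₀ m₁ : ℕ)
    (hn : 2 ≤ (n₀ : ℤ) - (n₁ : ℤ)) (hm : 1 ≤ (m₁ : ℤ) - (m₀ : ℤ))
    (f : OnePoint (EuclideanSpace ℂ (Fin n₀) × EuclideanSpace ℝ (Fin m₀)) →
      OnePoint (EuclideanSpace ℂ (Fin n₁) × EuclideanSpace ℝ (Fin m₁)))
    (hf : Continuous f)
    (hinf : f OnePoint.infty = OnePoint.infty)
    (h0 : f (OnePoint.some 0) = OnePoint.some 0)
    (heq : f ∘ sigmaMap n₀ m₀ = sigmaMap n₁ m₁ ∘ f) :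
    ((n₀ : ℤ) - (n₁ : ℤ)) + crabbStolzA ((n₀ : ℤ) - (n₁ : ℤ)) ≤ (m₁ : ℤ) - (m₀ : ℤ) := by
  have hlin : ∀ n m : ℕ, ∃ L : (EuclideanSpace ℂ (Fin n) × EuclideanSpace ℝ (Fin m)) ≃ₗ[ℝ]
      (Fin n → ℂ) × (Fin m → ℝ), ∀ p, L (Complex.I • p.1, -p.2) = BorsukUlam.rep n m (L p) := by
    intro n m
    refine ⟨((WithLp.linearEquiv 2 ℂ (Fin n → ℂ)).restrictScalars ℝ).prodCongr
      (WithLp.linearEquiv 2 ℝ (Fin m → ℝ)), fun p => ?_⟩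
    ext i <;> simp [BorsukUlam.rep, BorsukUlam.CliffMod.icLin_apply, BorsukUlam.ic_one]
  obtain ⟨L₀, hL₀⟩ := hlin n₀ m₀
  obtain ⟨L₁, hL₁⟩ := hlin n₁ m₁
  have hmap : ∀ (n m : ℕ) (L : (EuclideanSpace ℂ (Fin n) × EuclideanSpace ℝ (Fin m)) ≃ₗ[ℝ]
      (Fin n → ℂ) × (Fin m → ℝ)), (∀ p, L (Complex.I • p.1, -p.2) = BorsukUlam.rep n m (L p)) →
      ∀ x, OnePoint.map L (sigmaMap n m x) =
        OnePoint.map (BorsukUlam.rep n m) (OnePoint.map L x) := by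
    intro n m L hL x
    cases x with
    | infty => rfl
    | coe p => simp only [sigmaMap, OnePoint.map_some, hL]
  have key : BorsukUlam.HasMap (BorsukUlam.rep n₀ m₀) (BorsukUlam.rep n₁ m₁) := by
    have hinv : ∀ x, OnePoint.map L₀.symm (OnePoint.map L₀ x) = x := fun x => by
      cases x <;> simp
    have hinv' : ∀ x, OnePoint.map L₀ (OnePoint.map L₀.symm x) = x := fun x => by
      cases x <;> simp
    refine ⟨OnePoint.map L₁ ∘ f ∘ OnePoint.map L₀.symm,
      (BorsukUlam.continuous_map_linearEquiv L₁).comp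
        (hf.comp (BorsukUlam.continuous_map_linearEquiv L₀.symm)), ?_, ?_, fun x => ?_⟩
    · simp [hinf]
    · have h0' : f ((0 : EuclideanSpace ℂ (Fin n₀) × EuclideanSpace ℝ (Fin m₀)) : OnePoint _) =
        ((0 : EuclideanSpace ℂ (Fin n₁) × EuclideanSpace ℝ (Fin m₁)) : OnePoint _) := h0
      simp only [Function.comp_apply, OnePoint.map_some, map_zero, h0']
    · obtain ⟨y, rfl⟩ : ∃ y, OnePoint.map L₀ y = x := ⟨_, hinv' x⟩
      simp only [Function.comp_apply]
      rw [← hmap n₀ m₀ L₀ hL₀, hinv, hinv, ← hmap n₁ m₁ L₁ hL₁, ← Function.comp_apply (f := f), heq,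
        Function.comp_apply]
  exact key.add_crabbStolzA_le (by omega) (by omega)
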